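/- arXiv:1807.03961 — 5 statements merged into one kernel-verified Lean document; each statement's English description precedes it below -/
import Mathlib

section
/- Assume condition (𝒫). Then there exists a constant C > 0 such that |u|_{L^{p*(x)}(ℝ^N)} ≤ C ‖u‖ for all u ∈ C_c^∞(ℝ^N); since the space X is defined as the closure of C_c^∞(ℝ^N) in the weighted Sobolev norm ‖·‖, this is precisely the continuous imbedding X ↪ L^{p*(x)}(ℝ^N). -/
open MeasureTheory Filter Topology

/-- The critical Sobolev exponent `p*(x) = N p(x)/(N - p(x))`. -/
noncomputable def pstar (N : ℕ) (p : EuclideanSpace ℝ (Fin N) → ℝ)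
    (x : EuclideanSpace ℝ (Fin N)) : ℝ :=
  N * p x / (N - p x)

/-- The Luxemburg norm `|u|_{L^{p(x)}(w,ℝ^N)}` on the weighted variable exponent
Lebesgue space over `ℝ^N`. -/
noncomputable def luxNormW {N : ℕ} (w p u : EuclideanSpace ℝ (Fin N) → ℝ) : ℝ :=
  sInf {c : ℝ | 0 < c ∧ ∫ x, w x * |u x / c| ^ p x ≤ 1}

/-- The weighted variable exponent Sobolev norm
`‖u‖ = ||∇u||_{L^{p(x)}(ℝ^N)} + |u|_{L^{p(x)}(V,ℝ^N)}`. -/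
noncomputable def sobNorm {N : ℕ} (p V u : EuclideanSpace ℝ (Fin N) → ℝ) : ℝ :=
  luxNormW (fun _ => 1) p (fun x => ‖fderiv ℝ u x‖) + luxNormW V p u

/-- Condition (𝒫) on the exponent `p` and the potential `V`. -/
structure CondP (N : ℕ) (p V : EuclideanSpace ℝ (Fin N) → ℝ) : Prop where
  lip : ∃ K : NNReal, LipschitzWith K p
  pbddBelow : BddBelow (Set.range p)
  pbddAbove : BddAbove (Set.range p)
  inf_gt_one : 1 < sInf (Set.range p)
  sup_lt_N : sSup (Set.range p) < N
  Vmeas : Measurable V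
  Vpos : ∀ᵐ x ∂(volume : Measure (EuclideanSpace ℝ (Fin N))), 0 < V x
  Vloc : ∀ R : ℝ, 0 < R → ∃ c C : ℝ, 0 < c ∧
    ∀ᵐ x ∂(volume.restrict (Metric.ball (0 : EuclideanSpace ℝ (Fin N)) R)),
      c ≤ V x ∧ V x ≤ C
  logHolderDecay : essInf V (volume : Measure (EuclideanSpace ℝ (Fin N))) = 0 →
    ∃ pinf C₀ : ℝ, ∀ x, |p x - pinf| ≤ C₀ / Real.log (Real.exp 1 + ‖x‖)

/-- Condition (𝒞) (in the case `Ω = ∅`) on the exponent `q` and the weight `b`. -/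
structure CondC (N : ℕ) (p V q b : EuclideanSpace ℝ (Fin N) → ℝ) : Prop where
  qcont : Continuous q
  q_le_pstar : ∀ x, q x ≤ pstar N p x
  gap : 0 < sInf (Set.range (fun x => q x - p x))
  crit_nonempty : {x : EuclideanSpace ℝ (Fin N) | q x = pstar N p x}.Nonempty
  noncrit_finite : essInf V (volume : Measure (EuclideanSpace ℝ (Fin N))) = 0 →
    volume {x : EuclideanSpace ℝ (Fin N) | q x ≠ pstar N p x} < ⊤
  bmeas : Measurable b
  bbound : ∃ b₀ : ℝ, 0 < b₀ ∧
    ∀ᵐ x ∂(volume : Measure (EuclideanSpace ℝ (Fin N))), 0 < b x ∧ b x ≤ b₀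

/-- Condition (𝒮) on the exponent `r` and the weight `a`. -/
structure CondS (N : ℕ) (p r a : EuclideanSpace ℝ (Fin N) → ℝ) : Prop where
  rcont : Continuous r
  rbddAbove : BddAbove (Set.range r)
  inf_gt_one : 1 < sInf (Set.range r)
  gap : 0 < sInf (Set.range (fun x => pstar N p x - r x))
  ameas : Measurable a
  apos : ∀ᵐ x ∂(volume : Measure (EuclideanSpace ℝ (Fin N))), 0 < a x
  aint : (∫⁻ x, ENNReal.ofReal (a x ^ (pstar N p x / (pstar N p x - r x)))) < ⊤

/-- Weighted Young inequality, rescaled by a factor `A`. -/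
lemma rpow_mul_rpow_le_scaled {A a b γ : ℝ} (hA : 0 < A) (ha : 0 ≤ a) (hb : 0 ≤ b)
    (h0 : 0 ≤ γ) (h1 : γ ≤ 1) : a ^ γ * b ^ (1 - γ) ≤ A ^ γ * (a / A + b) := by
  have hy := Real.geom_mean_le_arith_mean2_weighted h0 (sub_nonneg.2 h1)
    (div_nonneg ha hA.le) hb (by ring)
  have hd : a ^ γ = A ^ γ * (a / A) ^ γ := by
    rw [← Real.mul_rpow hA.le (div_nonneg ha hA.le), mul_div_cancel₀ _ hA.ne']
  have h2 : γ * (a / A) ≤ a / A := mul_le_of_le_one_left (div_nonneg ha hA.le) h1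
  have h3 : (1 - γ) * b ≤ b := mul_le_of_le_one_left hb (by linarith)
  rw [hd, mul_assoc]
  exact mul_le_mul_of_nonneg_left (by linarith) (Real.rpow_nonneg hA.le _)

lemma rpow_mul_le_scaled {A a b p P : ℝ} (hA : 1 ≤ A) (ha : 0 ≤ a) (hb : 0 ≤ b)
    (hp : 1 < p) (hP : p ≤ P) :
    a ^ (1 - 1 / p) * b ≤ A ^ (1 - 1 / P) * (a / A + b ^ p) := by
  have hp0 : 0 < p := by linarith
  have h1 : 1 / p ≤ 1 := by rw [div_le_one hp0]; exact hp.le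
  have h0 : 0 < 1 / p := by positivity
  have key := rpow_mul_rpow_le_scaled (A := A) (a := a) (b := b ^ p) (γ := 1 - 1 / p)
    (by linarith) ha (Real.rpow_nonneg hb _) (by linarith) (by linarith)
  have hb' : (b ^ p) ^ (1 - (1 - 1 / p)) = b := by
    rw [← Real.rpow_mul hb, sub_sub_cancel, mul_one_div_cancel hp0.ne', Real.rpow_one]
  rw [hb'] at key
  refine key.trans (mul_le_mul_of_nonneg_right ?_ ?_)
  · refine Real.rpow_le_rpow_of_exponent_le hA ?_
    have := one_div_le_one_div_of_le hp0 hP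
    linarith
  · have := Real.rpow_nonneg hb p
    have : 0 ≤ a / A := div_nonneg ha (by linarith)
    linarith

lemma le_rpow_of_le_mul_rpow {A C θ : ℝ} (hA : 0 < A) (hθ : θ < 1)
    (h : A ≤ C * A ^ θ) : A ≤ C ^ (1 / (1 - θ)) := by
  have h1 : 0 < 1 - θ := by linarith
  have h2 : A ^ (1 - θ) ≤ C := by
    rw [Real.rpow_sub hA, Real.rpow_one, div_le_iff₀ (Real.rpow_pos_of_pos hA _)]
    exact h
  calc A = (A ^ (1 - θ)) ^ (1 / (1 - θ)) := by
        rw [← Real.rpow_mul hA.le, mul_one_div_cancel h1.ne', Real.rpow_one]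
    _ ≤ _ := Real.rpow_le_rpow (Real.rpow_nonneg hA.le _) h2 (by positivity)

/-- Changing the exponent of a number in `[0, 1]` by at most `L / log Y` costs a constant factor,
up to an error `Y ^ (-k)`. -/
lemma rpow_le_mul_rpow_add_of_log_decay {t a b Y L k : ℝ} (ht0 : 0 ≤ t) (ht1 : t ≤ 1) (ha : 1 ≤ a)
    (hY : 1 ≤ Y) (hk : 0 ≤ k) (hab : |a - b| * Real.log Y ≤ L) :
    t ^ a ≤ Real.exp (k * L) * t ^ b + Y ^ (-k) := by
  have hY0 : 0 < Y := by linarith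
  rcases le_total t (Y ^ (-k)) with h | h
  · have h1 : t ^ a ≤ t := Real.rpow_le_self_of_le_one ht0 ht1 ha
    have : 0 ≤ Real.exp (k * L) * t ^ b := by positivity
    linarith
  · have htp : 0 < t := (Real.rpow_pos_of_pos hY0 _).trans_le h
    have h1 : t ^ a = t ^ (a - b) * t ^ b := by rw [← Real.rpow_add htp]; ring_nf
    have hlog : -(k * Real.log Y) ≤ Real.log t := by
      have := Real.log_le_log (Real.rpow_pos_of_pos hY0 _) h
      rw [Real.log_rpow hY0] at this
      linarith
    have hlogt : Real.log t ≤ 0 := Real.log_nonpos ht0 ht1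
    have h2 : t ^ (a - b) ≤ Real.exp (k * L) := by
      rw [Real.rpow_def_of_pos htp]
      refine Real.exp_le_exp.2 ?_
      have e1 : Real.log t * (a - b) ≤ (-Real.log t) * |a - b| := by
        have := neg_abs_le (a - b)
        nlinarith
      have e2 : (-Real.log t) * |a - b| ≤ (k * Real.log Y) * |a - b| :=
        mul_le_mul_of_nonneg_right (by linarith) (abs_nonneg _)
      have e3 : k * (|a - b| * Real.log Y) ≤ k * L := mul_le_mul_of_nonneg_left hab hk
      linarith
    have h3 : 0 ≤ Y ^ (-k) := Real.rpow_nonneg hY0.le _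
    have h4 := mul_le_mul_of_nonneg_right h2 (Real.rpow_nonneg ht0 b)
    rw [h1]
    linarith

/-- The Gagliardo–Nirenberg–Sobolev inequality for `p = 1`, with Bochner integrals. -/
lemma exists_integral_rpow_le_integral_norm_fderiv {N : ℕ} (hN : 2 ≤ N) {q : ℝ}
    (hq : q = N / (N - 1)) :
    ∃ C : ℝ, 0 < C ∧ ∀ f : EuclideanSpace ℝ (Fin N) → ℝ, ContDiff ℝ 1 f → HasCompactSupport f →
      ∫ x, |f x| ^ q ≤ C * (∫ x, ‖fderiv ℝ f x‖) ^ q := by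
  have hN' : (2 : ℝ) ≤ N := by exact_mod_cast hN
  have hconj : Real.HolderConjugate
      (Module.finrank ℝ (EuclideanSpace ℝ (Fin N)) : ℝ) q := by
    rw [finrank_euclideanSpace_fin, hq]
    exact Real.HolderConjugate.conjExponent (by linarith)
  have hq0 : 0 < q := hconj.symm.pos
  set K := lintegralPowLePowLIntegralFDerivConst
    (volume : Measure (EuclideanSpace ℝ (Fin N))) q with hK
  refine ⟨K + 1, by positivity, fun f hf hfc => ?_⟩
  have key := lintegral_pow_le_pow_lintegral_fderiv (volume : Measure (EuclideanSpace ℝ (Fin N)))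
    hf hfc hconj
  have hcont : Continuous (fderiv ℝ f) := hf.continuous_fderiv one_ne_zero
  have hint : Integrable (fun x => ‖fderiv ℝ f x‖) :=
    (hcont.norm).integrable_of_hasCompactSupport (hfc.fderiv (𝕜 := ℝ)).norm
  have e1 : ∫⁻ x, ‖fderiv ℝ f x‖ₑ = ENNReal.ofReal (∫ x, ‖fderiv ℝ f x‖) := by
    rw [ofReal_integral_eq_lintegral_ofReal hint (ae_of_all _ fun _ => norm_nonneg _)]
    simp only [ofReal_norm]
  have hI0 : 0 ≤ ∫ x, ‖fderiv ℝ f x‖ := integral_nonneg fun _ => norm_nonneg _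
  have e2 : ∫ x, |f x| ^ q = (∫⁻ x, ‖f x‖ₑ ^ q).toReal := by
    rw [integral_eq_lintegral_of_nonneg_ae (ae_of_all _ fun _ => by positivity)
      (hf.continuous.abs.rpow_const fun _ => Or.inr hq0.le).aestronglyMeasurable]
    congr 1
    refine lintegral_congr fun x => ?_
    rw [← ENNReal.ofReal_rpow_of_nonneg (abs_nonneg _) hq0.le, ← Real.norm_eq_abs,
      ofReal_norm]
  rw [e1, ENNReal.ofReal_rpow_of_nonneg hI0 hq0.le] at key
  rw [e2]
  have h3 := ENNReal.toReal_mono (by finiteness) key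
  rw [ENNReal.toReal_mul, ENNReal.toReal_ofReal (by positivity), ENNReal.coe_toReal] at h3
  refine h3.trans ?_
  gcongr
  simp [hK]

/-- A Lipschitz function is uniformly approximated from below by smooth functions with the same
gradient bound. -/
lemma LipschitzWith.exists_contDiff_le {N : ℕ} {K : NNReal} {s : EuclideanSpace ℝ (Fin N) → ℝ}
    (hs : LipschitzWith K s) {ε : ℝ} (hε : 0 < ε) :
    ∃ σ : EuclideanSpace ℝ (Fin N) → ℝ, ContDiff ℝ 1 σ ∧ (∀ x, ‖fderiv ℝ σ x‖ ≤ K) ∧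
      (∀ x, σ x ≤ s x) ∧ ∀ x, s x - ε ≤ σ x := by
  let r : ℝ := ε / (2 * (K + 1))
  have hr : 0 < r := by positivity
  let φ : ContDiffBump (0 : EuclideanSpace ℝ (Fin N)) := ⟨r / 2, r, by positivity, by linarith⟩
  let g : EuclideanSpace ℝ (Fin N) → ℝ :=
    convolution (φ.normed volume) s (ContinuousLinearMap.lsmul ℝ ℝ) volume
  have hgs : ∀ x, dist (g x) (s x) ≤ ε / 2 := by
    intro x
    refine φ.dist_normed_convolution_le hs.continuous.aestronglyMeasurable fun y hy => ?_
    refine (hs.dist_le_mul y x).trans ?_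
    have h1 : dist y x ≤ r := (Metric.mem_ball.1 hy).le
    have h2 : (K : ℝ) * r ≤ ε / 2 := by
      simp only [r]
      rw [mul_div_assoc', div_le_div_iff₀ (by positivity) (by positivity)]
      nlinarith [K.2]
    exact (mul_le_mul_of_nonneg_left h1 K.2).trans h2
  have hgd : ContDiff ℝ 1 g :=
    φ.hasCompactSupport_normed.contDiff_convolution_left _ φ.contDiff_normed
      hs.continuous.locallyIntegrable
  have hex : ∀ x, ConvolutionExistsAt (φ.normed volume) s x (ContinuousLinearMap.lsmul ℝ ℝ)
      volume := fun x =>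
    φ.hasCompactSupport_normed.convolutionExists_left _ φ.continuous_normed
      hs.continuous.locallyIntegrable x
  have hgl : LipschitzWith K g := by
    refine LipschitzWith.of_dist_le_mul fun x y => ?_
    have hx := hex x
    have hy := hex y
    simp only [ConvolutionExistsAt, ContinuousLinearMap.lsmul_apply, smul_eq_mul] at hx hy
    have hint : Integrable (φ.normed volume) (volume : Measure (EuclideanSpace ℝ (Fin N))) :=
      φ.integrable_normed
    simp only [g, convolution_def, ContinuousLinearMap.lsmul_apply, smul_eq_mul]
    rw [Real.dist_eq, ← integral_sub hx hy, ← Real.norm_eq_abs]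
    calc ‖∫ t, (φ.normed volume t * s (x - t) - φ.normed volume t * s (y - t))‖
        ≤ ∫ t, φ.normed volume t * (K * dist x y) := by
          refine norm_integral_le_of_norm_le (hint.mul_const _) (ae_of_all _ fun t => ?_)
          rw [← mul_sub, norm_mul, Real.norm_of_nonneg (φ.nonneg_normed t)]
          refine mul_le_mul_of_nonneg_left ?_ (φ.nonneg_normed t)
          have := hs.dist_le_mul (x - t) (y - t)
          rwa [dist_sub_right] at this
      _ = K * dist x y := by
          rw [integral_mul_const, φ.integral_normed, one_mul]
  refine ⟨fun x => g x - ε / 2, hgd.sub contDiff_const, fun x => ?_, fun x => ?_, fun x => ?_⟩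
  · rw [fderiv_sub_const]
    exact norm_fderiv_le_of_lipschitz ℝ hgl
  · have := abs_le.1 (hgs x)
    linarith [this.2]
  · have := abs_le.1 (hgs x)
    linarith [this.1]

lemma hasDerivAt_sq_posPart (y : ℝ) :
    HasDerivAt (fun y : ℝ => max y 0 ^ 2) (2 * max y 0) y := by
  rcases lt_trichotomy y 0 with hy | rfl | hy
  · rw [max_eq_right hy.le]
    refine (hasDerivAt_const y (0 : ℝ)).congr_of_eventuallyEq ?_ |>.congr_deriv (by simp)
    filter_upwards [Iio_mem_nhds hy] with z hz
    simp [max_eq_right (Set.mem_Iio.1 hz).le]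
  · rw [hasDerivAt_iff_isLittleO_nhds_zero]
    simp only [zero_add, max_self, ne_eq, OfNat.ofNat_ne_zero, not_false_eq_true, zero_pow,
      sub_zero, mul_zero, smul_zero]
    refine Asymptotics.IsBigO.trans_isLittleO (g := fun h : ℝ => h ^ 2) ?_ ?_
    · refine Asymptotics.IsBigO.of_bound 1 (Eventually.of_forall fun h => ?_)
      rw [one_mul, norm_pow, norm_pow, Real.norm_eq_abs, Real.norm_eq_abs]
      refine pow_le_pow_left₀ (abs_nonneg _) ?_ 2
      rw [abs_of_nonneg (le_max_right _ _)]
      exact max_le (le_abs_self _) (abs_nonneg _)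
    · exact Asymptotics.isLittleO_pow_id one_lt_two
  · rw [max_eq_left hy.le]
    refine ((hasDerivAt_pow 2 y).congr_of_eventuallyEq ?_).congr_deriv (by simp)
    filter_upwards [Ioi_mem_nhds hy] with z hz
    simp [max_eq_left (Set.mem_Ioi.1 hz).le]

/-- A `C¹` function comparable to `max 1 |t|`, constant on `[-1, 1]`. -/
noncomputable def cutoffAbs (t : ℝ) : ℝ := (1 + max (t ^ 2 - 1) 0 ^ 2) ^ (1 / 4 : ℝ)

lemma hasDerivAt_cutoffAbs (t : ℝ) :
    HasDerivAt cutoffAbs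
      (t * max (t ^ 2 - 1) 0 * (1 + max (t ^ 2 - 1) 0 ^ 2) ^ (-3 / 4 : ℝ)) t := by
  have h1 : HasDerivAt (fun t : ℝ => t ^ 2 - 1) (2 * t) t := by
    simpa using (hasDerivAt_pow 2 t).sub_const 1
  have h2 := ((hasDerivAt_sq_posPart (t ^ 2 - 1)).comp t h1).const_add 1
  have h3 := h2.rpow_const (p := (1 / 4 : ℝ)) (Or.inl (by simp only [Function.comp]; positivity))
  refine h3.congr_deriv ?_
  simp only [Function.comp]
  rw [show (1 / 4 - 1 : ℝ) = -3 / 4 by norm_num]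
  ring

lemma contDiff_cutoffAbs : ContDiff ℝ 1 cutoffAbs := by
  rw [contDiff_one_iff_deriv]
  refine ⟨fun t => (hasDerivAt_cutoffAbs t).differentiableAt, ?_⟩
  rw [show deriv cutoffAbs = _ from funext fun t => (hasDerivAt_cutoffAbs t).deriv]
  refine Continuous.mul (by fun_prop) (Continuous.rpow_const (by fun_prop) fun t => Or.inl ?_)
  positivity

lemma one_le_cutoffAbs (t : ℝ) : 1 ≤ cutoffAbs t :=
  Real.one_le_rpow (by nlinarith [sq_nonneg (max (t ^ 2 - 1) 0)]) (by norm_num)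

lemma max_sq_sub_one_eq_zero {t : ℝ} (ht : |t| ≤ 1) : max (t ^ 2 - 1) 0 = 0 := by
  refine max_eq_right ?_
  rw [← sq_abs]
  nlinarith [abs_nonneg t]

lemma cutoffAbs_eq_one {t : ℝ} (ht : |t| ≤ 1) : cutoffAbs t = 1 := by
  simp [cutoffAbs, max_sq_sub_one_eq_zero ht]

lemma deriv_cutoffAbs_eq_zero {t : ℝ} (ht : |t| ≤ 1) : deriv cutoffAbs t = 0 := by
  simp [(hasDerivAt_cutoffAbs t).deriv, max_sq_sub_one_eq_zero ht]

lemma abs_le_two_mul_cutoffAbs (t : ℝ) : |t| ≤ 2 * cutoffAbs t := by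
  have h0 : 0 ≤ cutoffAbs t := by linarith [one_le_cutoffAbs t]
  have h4 : cutoffAbs t ^ 4 = 1 + max (t ^ 2 - 1) 0 ^ 2 := by
    rw [cutoffAbs, ← Real.rpow_natCast, ← Real.rpow_mul (by positivity)]
    norm_num
  refine le_of_pow_le_pow_left₀ (n := 4) (by norm_num) (by positivity) ?_
  rw [mul_pow, h4]
  have h5 : |t| ^ 4 = (t ^ 2) ^ 2 := by rw [← sq_abs t]; ring
  rw [h5]
  nlinarith [le_max_left (t ^ 2 - 1) 0, le_max_right (t ^ 2 - 1) 0, sq_nonneg t,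
    sq_nonneg (max (t ^ 2 - 1) 0 - 1)]

lemma abs_deriv_cutoffAbs_le (t : ℝ) : |deriv cutoffAbs t| ≤ 2 := by
  rcases le_or_gt |t| 1 with ht | ht
  · simp [deriv_cutoffAbs_eq_zero ht]
  rw [(hasDerivAt_cutoffAbs t).deriv]
  set y := max (t ^ 2 - 1) 0 with hy
  have hy0 : 0 ≤ y := le_max_right _ _
  have hty : t ^ 2 ≤ 1 + y := by linarith [le_max_left (t ^ 2 - 1) 0]
  have hz : 0 < 1 + y ^ 2 := by positivity
  refine le_of_pow_le_pow_left₀ (n := 4) (by norm_num) (by positivity) ?_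
  have e1 : ((1 + y ^ 2) ^ (-3 / 4 : ℝ)) ^ 4 = ((1 + y ^ 2) ^ 3)⁻¹ := by
    rw [← Real.rpow_natCast, ← Real.rpow_mul hz.le, ← Real.rpow_natCast (1 + y ^ 2) 3,
      ← Real.rpow_neg hz.le]
    norm_num
  rw [abs_mul, abs_mul, mul_pow, mul_pow, abs_of_nonneg (Real.rpow_nonneg hz.le _), e1,
    abs_of_nonneg hy0, mul_inv_le_iff₀ (by positivity)]
  have h5 : |t| ^ 4 = (t ^ 2) ^ 2 := by rw [← sq_abs t]; ring
  rw [h5]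
  have h6 : (t ^ 2) ^ 2 ≤ 2 * (1 + y ^ 2) := by nlinarith [sq_nonneg t, sq_nonneg (y - 1)]
  have h7 : y ^ 4 ≤ (1 + y ^ 2) ^ 2 := by nlinarith [sq_nonneg y]
  calc (t ^ 2) ^ 2 * y ^ 4 ≤ (2 * (1 + y ^ 2)) * (1 + y ^ 2) ^ 2 := by gcongr
    _ ≤ _ := by nlinarith [pow_pos hz 3]

lemma add_one_rpow_le {a q : ℝ} (ha : 0 ≤ a) (hq : 0 ≤ q) :
    (a + 1) ^ q ≤ 2 ^ q * (a ^ q + 1) := by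
  have h2 : (0 : ℝ) ≤ 2 ^ q := by positivity
  rcases le_total a 1 with h | h
  · calc (a + 1) ^ q ≤ 2 ^ q := Real.rpow_le_rpow (by linarith) (by linarith) hq
      _ ≤ _ := by nlinarith [Real.rpow_nonneg ha q]
  · calc (a + 1) ^ q ≤ (2 * a) ^ q := Real.rpow_le_rpow (by linarith) (by linarith) hq
      _ = 2 ^ q * a ^ q := Real.mul_rpow (by norm_num) ha
      _ ≤ _ := by nlinarith

/-- Sobolev estimate for `v ^ s(x)`, where `v` is the function `cutoffAbs ∘ u`. -/
lemma setIntegral_cutoffAbs_rpow_le {N : ℕ} {q CG : ℝ} (hq : 1 ≤ q) (hCG : 0 < CG)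
    (hG : ∀ f : EuclideanSpace ℝ (Fin N) → ℝ, ContDiff ℝ 1 f → HasCompactSupport f →
      ∫ x, |f x| ^ q ≤ CG * (∫ x, ‖fderiv ℝ f x‖) ^ q)
    {K : NNReal} {s : EuclideanSpace ℝ (Fin N) → ℝ} {S : ℝ} (hs : LipschitzWith K s)
    (hs1 : ∀ x, 1 ≤ s x) (hsS : ∀ x, s x ≤ S)
    {u : EuclideanSpace ℝ (Fin N) → ℝ} (hu : ContDiff ℝ 1 u) (huc : HasCompactSupport u) :
    ∫ x in {x | 1 < |u x|}, cutoffAbs (u x) ^ (q * s x) ≤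
      4 ^ q * (CG * (∫ x in {x | 1 < |u x|}, (2 * S * (cutoffAbs (u x) ^ (s x - 1) *
        ‖fderiv ℝ u x‖) + K * (cutoffAbs (u x) ^ s x * Real.log (cutoffAbs (u x))))) ^ q +
        volume.real {x | 1 < |u x|}) := by
  have hq0 : 0 < q := by linarith
  set E : Set (EuclideanSpace ℝ (Fin N)) := {x | 1 < |u x|} with hE
  set v : EuclideanSpace ℝ (Fin N) → ℝ := fun x => cutoffAbs (u x) with hv
  have hEc : E ⊆ tsupport u := fun x hx => by
    refine subset_tsupport u ?_
    intro h0
    simp only [hE, Set.mem_ofPred_eq, h0, abs_zero] at hx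
    linarith
  have hint : ∀ {g : EuclideanSpace ℝ (Fin N) → ℝ}, Continuous g → IntegrableOn g E :=
    fun hg => (hg.continuousOn.integrableOn_compact huc).mono_set hEc
  have hv1 : ∀ x, 1 ≤ v x := fun x => one_le_cutoffAbs _
  have hv0 : ∀ x, 0 < v x := fun x => by linarith [hv1 x]
  have hvd : ContDiff ℝ 1 v := contDiff_cutoffAbs.comp hu
  have hvE : ∀ x, x ∉ E → v x = 1 := fun x hx => cutoffAbs_eq_one (not_lt.1 hx)
  have hvfd : ∀ x, HasFDerivAt v (deriv cutoffAbs (u x) • fderiv ℝ u x) x := fun x =>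
    (hasDerivAt_cutoffAbs (u x)).differentiableAt.hasDerivAt.comp_hasFDerivAt x
      (hu.differentiable one_ne_zero x).hasFDerivAt
  obtain ⟨M, hM2, hM⟩ : ∃ M : ℝ, 2 ≤ M ∧ ∀ x, v x ≤ M := by
    have hc : HasCompactSupport (fun x => v x - 1) := by
      refine huc.mono fun x hx => ?_
      intro h0
      refine hx ?_
      simp only [hv, h0, sub_eq_zero]
      exact cutoffAbs_eq_one (by simp)
    obtain ⟨M, hM⟩ := (hvd.continuous.sub continuous_const).bounded_above_of_compact_support hc
    refine ⟨max 2 (M + 1), le_max_left _ _, fun x => ?_⟩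
    have : v x - 1 ≤ M := (le_abs_self _).trans (hM x)
    refine le_trans ?_ (le_max_right _ _)
    linarith
  have hlogM : 0 < Real.log M := Real.log_pos (by linarith)
  set ε : ℝ := Real.log 2 / Real.log M with hε
  have hε0 : 0 < ε := div_pos (Real.log_pos one_lt_two) hlogM
  have hε1 : ε ≤ 1 := (div_le_one hlogM).2 (Real.log_le_log (by norm_num) hM2)
  have hMε : M ^ ε = 2 := by
    rw [Real.rpow_def_of_pos (by linarith), hε, mul_div_cancel₀ _ hlogM.ne',
      Real.exp_log (by norm_num)]
  obtain ⟨σ, hσd, hσK, hσs, hsσ⟩ := hs.exists_contDiff_le hε0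
  have hσ0 : ∀ x, 0 ≤ σ x := fun x => by linarith [hsσ x, hs1 x]
  set f : EuclideanSpace ℝ (Fin N) → ℝ := fun x => v x ^ σ x - 1 with hf
  have hfd : ContDiff ℝ 1 f := (hvd.rpow hσd fun x => (hv0 x).ne').sub contDiff_const
  have hfE : ∀ x, x ∉ E → f x = 0 := fun x hx => by simp [hf, hvE x hx]
  have hfc : HasCompactSupport f := by
    refine huc.mono' fun x hx => ?_
    by_contra h
    exact hx (hfE x fun hxE => h (hEc hxE))
  have hfder : ∀ x, fderiv ℝ f x = (σ x * v x ^ (σ x - 1)) • (deriv cutoffAbs (u x) • fderiv ℝ u x)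
      + (v x ^ σ x * Real.log (v x)) • fderiv ℝ σ x := fun x =>
    (((hvfd x).rpow (hσd.differentiable one_ne_zero x).hasFDerivAt (hv0 x)).sub_const 1).fderiv
  have hfderE : ∀ x, x ∉ E → ‖fderiv ℝ f x‖ = 0 := fun x hx => by
    rw [hfder x, hvE x hx, deriv_cutoffAbs_eq_zero (not_lt.1 hx)]
    simp
  have hS0 : 0 ≤ S := by linarith [hs1 0, hsS 0]
  have hfderle : ∀ x, ‖fderiv ℝ f x‖ ≤ 2 * S * (v x ^ (s x - 1) * ‖fderiv ℝ u x‖) +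
      K * (v x ^ s x * Real.log (v x)) := fun x => by
    rw [hfder x]
    refine (norm_add_le _ _).trans (add_le_add ?_ ?_)
    · rw [norm_smul, norm_smul, Real.norm_of_nonneg
        (mul_nonneg (hσ0 x) (Real.rpow_nonneg (hv0 x).le _))]
      have h1 : v x ^ (σ x - 1) ≤ v x ^ (s x - 1) :=
        Real.rpow_le_rpow_of_exponent_le (hv1 x) (by linarith [hσs x])
      have h2 : σ x * v x ^ (σ x - 1) ≤ S * v x ^ (s x - 1) :=
        mul_le_mul ((hσs x).trans (hsS x)) h1 (Real.rpow_nonneg (hv0 x).le _) hS0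
      have h3 : ‖deriv cutoffAbs (u x)‖ * ‖fderiv ℝ u x‖ ≤ 2 * ‖fderiv ℝ u x‖ :=
        mul_le_mul_of_nonneg_right (abs_deriv_cutoffAbs_le _) (norm_nonneg _)
      calc _ ≤ (S * v x ^ (s x - 1)) * (2 * ‖fderiv ℝ u x‖) :=
            mul_le_mul h2 h3 (by positivity)
              (mul_nonneg hS0 (Real.rpow_nonneg (hv0 x).le _))
        _ = _ := by ring
    · have hl : 0 ≤ Real.log (v x) := Real.log_nonneg (hv1 x)
      have h1 : v x ^ σ x ≤ v x ^ s x := Real.rpow_le_rpow_of_exponent_le (hv1 x) (hσs x)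
      rw [norm_smul, Real.norm_of_nonneg (mul_nonneg (Real.rpow_nonneg (hv0 x).le _) hl), mul_comm]
      exact mul_le_mul (hσK x) (mul_le_mul_of_nonneg_right h1 hl)
        (mul_nonneg (Real.rpow_nonneg (hv0 x).le _) hl) K.2
  have hvs : ∀ x, v x ^ (q * s x) ≤ 4 ^ q * (|f x| ^ q + 1) := fun x => by
    have h1 : v x ^ s x ≤ 2 * (|f x| + 1) := by
      calc v x ^ s x ≤ v x ^ (ε + σ x) :=
            Real.rpow_le_rpow_of_exponent_le (hv1 x) (by linarith [hsσ x])
        _ = v x ^ ε * v x ^ σ x := Real.rpow_add (hv0 x) _ _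
        _ ≤ M ^ ε * v x ^ σ x := mul_le_mul_of_nonneg_right
            (Real.rpow_le_rpow (hv0 x).le (hM x) hε0.le) (Real.rpow_nonneg (hv0 x).le _)
        _ = 2 * (f x + 1) := by rw [hMε, hf]; ring
        _ ≤ _ := by linarith [le_abs_self (f x)]
    calc v x ^ (q * s x) = (v x ^ s x) ^ q := by rw [mul_comm, Real.rpow_mul (hv0 x).le]
      _ ≤ (2 * (|f x| + 1)) ^ q := Real.rpow_le_rpow (Real.rpow_nonneg (hv0 x).le _) h1 hq0.le
      _ = 2 ^ q * (|f x| + 1) ^ q := Real.mul_rpow (by norm_num) (by positivity)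
      _ ≤ 2 ^ q * (2 ^ q * (|f x| ^ q + 1)) :=
          mul_le_mul_of_nonneg_left (add_one_rpow_le (abs_nonneg _) hq0.le) (by positivity)
      _ = _ := by
          rw [← mul_assoc, ← Real.mul_rpow (by norm_num) (by norm_num)]
          norm_num
  have hfq : Continuous fun x => |f x| ^ q :=
    hfd.continuous.abs.rpow_const fun _ => Or.inr hq0.le
  have hfqc : HasCompactSupport fun x => |f x| ^ q :=
    hfc.comp_left (g := fun t : ℝ => |t| ^ q) (by simp [hq0.ne'])
  have hderint : Continuous fun x => ‖fderiv ℝ f x‖ := (hfd.continuous_fderiv one_ne_zero).norm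
  have hvr : ∀ {g : EuclideanSpace ℝ (Fin N) → ℝ}, Continuous g → Continuous fun x => v x ^ g x :=
    fun hg => hvd.continuous.rpow hg fun x => Or.inl (hv0 x).ne'
  have hlog : Continuous fun x => Real.log (v x) :=
    hvd.continuous.log fun x => (hv0 x).ne'
  have hud : Continuous fun x => ‖fderiv ℝ u x‖ := (hu.continuous_fderiv one_ne_zero).norm
  have hsc := hs.continuous
  calc ∫ x in E, v x ^ (q * s x) ≤ ∫ x in E, 4 ^ q * (|f x| ^ q + 1) :=
        setIntegral_mono (hint (hvr (by fun_prop))) (hint (by fun_prop)) hvs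
    _ = 4 ^ q * ((∫ x in E, |f x| ^ q) + volume.real E) := by
        rw [integral_const_mul, integral_add (hint hfq) (hint continuous_const)]
        simp
    _ ≤ 4 ^ q * ((∫ x, |f x| ^ q) + volume.real E) := by
        have hfqi : Integrable (fun x => |f x| ^ q) volume :=
          hfq.integrable_of_hasCompactSupport hfqc
        have hle := setIntegral_le_integral (s := E) hfqi (ae_of_all _ fun x => by positivity)
        exact mul_le_mul_of_nonneg_left (by linarith) (by positivity)
    _ ≤ _ := by
        gcongr
        refine (hG f hfd hfc).trans ?_
        gcongr
        rw [← setIntegral_eq_integral_of_forall_compl_eq_zero hfderE]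
        refine setIntegral_mono (hint hderint) (hint ?_) hfderle
        have := hvr (g := fun x => s x - 1) (by fun_prop)
        have := hvr hsc
        fun_prop

section Exponents

variable {N : ℕ} {p : EuclideanSpace ℝ (Fin N) → ℝ}

/-- The exponent `s = p* (N - 1) / N`, for which `|u| ^ s` is admissible in the `W^{1,1}` Sobolev
inequality. -/
noncomputable def sobolevPower (N : ℕ) (r : ℝ) : ℝ := (N - 1) * r / (N - r)

lemma mul_sobolevPower (hN : 2 ≤ N) (r : ℝ) :
    (N / (N - 1) : ℝ) * sobolevPower N r = N * r / (N - r) := by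
  have hN' : (2 : ℝ) ≤ N := by exact_mod_cast hN
  have : (N - 1 : ℝ) ≠ 0 := by linarith
  rw [sobolevPower]
  field_simp

lemma sobolevPower_sub_one {r : ℝ} (h1 : 1 < r) (h2 : r < N) :
    sobolevPower N r - 1 = N * r / (N - r) * (1 - 1 / r) := by
  have : (N - r : ℝ) ≠ 0 := by linarith
  have : r ≠ 0 := by linarith
  rw [sobolevPower]
  field_simp
  ring

lemma one_lt_sobolevPower {r : ℝ} (h1 : 1 < r) (h2 : r < N) : 1 < sobolevPower N r := by
  rw [sobolevPower, lt_div_iff₀ (by linarith)]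
  nlinarith

lemma div_sub_mono {r P c : ℝ} (hc : 0 ≤ c) (hr : 0 ≤ r) (h : r ≤ P) (hP : P < N) :
    c * r / (N - r) ≤ c * P / (N - P) := by
  have : (0 : ℝ) < N - P := by linarith
  have : (0 : ℝ) ≤ P := by linarith
  gcongr

lemma abs_div_sub_sub_le {a b P c : ℝ} (hc : 0 ≤ c) (ha : a ≤ P) (hb : b ≤ P) (hP : P < N) :
    |c * a / (N - a) - c * b / (N - b)| ≤ c * N / (N - P) ^ 2 * |a - b| := by
  have h1 : (0 : ℝ) < N - a := by linarith
  have h2 : (0 : ℝ) < N - b := by linarith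
  have h3 : (0 : ℝ) < N - P := by linarith
  have h4 : (0 : ℝ) ≤ N := Nat.cast_nonneg N
  have e : c * a / (N - a) - c * b / (N - b) = c * N / ((N - a) * (N - b)) * (a - b) := by
    field_simp
    ring
  rw [e, abs_mul, abs_of_nonneg (by positivity), sq]
  gcongr

lemma lipschitzWith_sobolevPower (hN : 2 ≤ N) {K : NNReal} (hp : LipschitzWith K p) {P : ℝ}
    (hP : ∀ x, p x ≤ P) (hPN : P < N) :
    ∃ K' : NNReal, LipschitzWith K' fun x => sobolevPower N (p x) := by
  have hN' : (2 : ℝ) ≤ N := by exact_mod_cast hN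
  have h3 : (0 : ℝ) < N - P := by linarith
  have h0 : (0 : ℝ) ≤ (N - 1) * N / (N - P) ^ 2 :=
    div_nonneg (mul_nonneg (by linarith) (by linarith)) (by positivity)
  refine ⟨Real.toNNReal ((N - 1) * N / (N - P) ^ 2) * K, LipschitzWith.of_dist_le_mul fun x y => ?_⟩
  rw [Real.dist_eq]
  refine (abs_div_sub_sub_le (by linarith) (hP x) (hP y) hPN).trans ?_
  rw [NNReal.coe_mul, Real.coe_toNNReal _ h0, mul_assoc]
  exact mul_le_mul_of_nonneg_left (hp.dist_le_mul x y) h0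

end Exponents

set_option maxHeartbeats 400000 in
/-- The modular of `u` in `L^{p*(x)}` over `{|u| > 1}` is controlled by the modular of the gradient
and the measure of that set. -/
lemma exists_setIntegral_pstar_le {N : ℕ} (hN : 2 ≤ N) {p : EuclideanSpace ℝ (Fin N) → ℝ}
    {K : NNReal} (hp : LipschitzWith K p) {P : ℝ} (hp1 : ∀ x, 1 < p x) (hpP : ∀ x, p x ≤ P)
    (hPN : P < N) {M : ℝ} (hM : 0 ≤ M) :
    ∃ C : ℝ, ∀ u : EuclideanSpace ℝ (Fin N) → ℝ, ContDiff ℝ 1 u → HasCompactSupport u →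
      ∫ x, ‖fderiv ℝ u x‖ ^ p x ≤ 1 → volume.real {x | 1 < |u x|} ≤ M →
      ∫ x in {x | 1 < |u x|}, |u x| ^ pstar N p x ≤ C := by
  have hN' : (2 : ℝ) ≤ N := by exact_mod_cast hN
  have hP1 : 1 < P := (hp1 0).trans_le (hpP 0)
  set q : ℝ := N / (N - 1) with hq
  have hN1 : (0 : ℝ) < N - 1 := by linarith
  have hq1 : 1 ≤ q := by rw [hq, le_div_iff₀ hN1]; linarith
  have hq0 : 0 < q := by linarith
  obtain ⟨CG, hCG, hG⟩ := exists_integral_rpow_le_integral_norm_fderiv hN hq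
  obtain ⟨K', hs⟩ := lipschitzWith_sobolevPower hN hp hpP hPN
  set s : EuclideanSpace ℝ (Fin N) → ℝ := fun x => sobolevPower N (p x) with hsdef
  set S : ℝ := sobolevPower N P with hS
  have hps : ∀ x, pstar N p x = q * s x := fun x => (mul_sobolevPower hN (p x)).symm
  have hs1 : ∀ x, 1 < s x := fun x => one_lt_sobolevPower (hp1 x) ((hpP x).trans_lt hPN)
  have hsS : ∀ x, s x ≤ S := fun x => div_sub_mono hN1.le (by linarith [hp1 x]) (hpP x) hPN
  have hS1 : 1 < S := (hs1 0).trans_le (hsS 0)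
  set M₁ : ℝ := 4 ^ q * (CG * (2 * (M + 1)) ^ q + M) with hM₁
  have hM₁0 : 0 ≤ M₁ := by positivity
  set δ : ℝ := 1 / (2 * N) with hδ
  have hδ0 : 0 < δ := by positivity
  set γ₂ : ℝ := 1 / q - δ / (q * S) with hγ₂
  set γ : ℝ := max (1 - 1 / P) γ₂ with hγ
  have hγl : 1 - 1 / P ≤ γ := le_max_left _ _
  have hγr : γ₂ ≤ γ := le_max_right _ _
  have hqi : 1 / q = 1 - 1 / N := by
    rw [hq]; field_simp
  have hγq : γ < 1 / q := by
    refine max_lt ?_ ?_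
    · rw [hqi]
      have := one_div_lt_one_div_of_lt (by linarith) hPN
      linarith
    · have : 0 < δ / (q * S) := by positivity
      linarith
  have hγ₂0 : 0 ≤ γ₂ := by
    have h1 : δ / (q * S) ≤ δ := div_le_self hδ0.le (by nlinarith)
    have h2 : δ ≤ 1 / 4 := by
      rw [hδ]; exact one_div_le_one_div_of_le (by norm_num) (by linarith)
    have h3 : 1 / (N : ℝ) ≤ 1 / 2 := one_div_le_one_div_of_le (by norm_num) hN'
    rw [hγ₂, hqi]; linarith
  have hγ₂1 : γ₂ ≤ 1 := by
    have : 0 < δ / (q * S) := by positivity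
    have : 0 < 1 / (N : ℝ) := by positivity
    rw [hγ₂, hqi]; linarith
  have hexp : ∀ x, s x + δ ≤ pstar N p x * γ₂ + q * (1 - γ₂) := fun x => by
    have h1 : pstar N p x * (δ / (q * S)) ≤ δ := by
      rw [hps, mul_div_assoc', div_le_iff₀ (by positivity)]
      nlinarith [mul_le_mul_of_nonneg_left (hsS x) (mul_pos hq0 hδ0).le]
    have h2 : pstar N p x * (1 / q) = s x := by rw [hps]; field_simp
    have h3 : 2 * δ = 1 / N := by rw [hδ]; field_simp
    have h4 : 1 / N ≤ 1 - γ₂ := by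
      have : 0 < δ / (q * S) := by positivity
      rw [hγ₂, hqi]; linarith
    have h5 : 1 - γ₂ ≤ q * (1 - γ₂) := by nlinarith
    have h6 : pstar N p x * γ₂ = s x - pstar N p x * (δ / (q * S)) := by
      rw [hγ₂, mul_sub, h2]
    linarith
  set L : ℝ := 4 * S + K' * (1 / δ * (1 + M₁)) with hL
  have hL0 : 0 ≤ L := by positivity
  set C₁ : ℝ := 4 ^ q * (CG * L ^ q + M) with hC₁
  refine ⟨2 ^ (q * S) * max 1 (C₁ ^ (1 / (1 - γ * q))), fun u hu huc hgrad hvol => ?_⟩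
  clear_value M₁ δ γ₂ γ L C₁
  set E : Set (EuclideanSpace ℝ (Fin N)) := {x | 1 < |u x|} with hE
  set v : EuclideanSpace ℝ (Fin N) → ℝ := fun x => cutoffAbs (u x) with hv
  have hEc : E ⊆ tsupport u := fun x hx => by
    refine subset_tsupport u ?_
    intro h0
    simp only [hE, Set.mem_ofPred_eq, h0, abs_zero] at hx
    linarith
  have hint : ∀ {g : EuclideanSpace ℝ (Fin N) → ℝ}, Continuous g → IntegrableOn g E :=
    fun hg => (hg.continuousOn.integrableOn_compact huc).mono_set hEc
  have hv1 : ∀ x, 1 ≤ v x := fun x => one_le_cutoffAbs _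
  have hv0 : ∀ x, 0 < v x := fun x => by linarith [hv1 x]
  have hvc : Continuous v := contDiff_cutoffAbs.continuous.comp hu.continuous
  have hvr : ∀ {g : EuclideanSpace ℝ (Fin N) → ℝ}, Continuous g → Continuous fun x => v x ^ g x :=
    fun hg => hvc.rpow hg fun x => Or.inl (hv0 x).ne'
  have hlog : Continuous fun x => Real.log (v x) := hvc.log fun x => (hv0 x).ne'
  have hud : Continuous fun x => ‖fderiv ℝ u x‖ := (hu.continuous_fderiv one_ne_zero).norm
  have hpc := hp.continuous
  have hsc := hs.continuous
  have hpsc : Continuous (pstar N p) := by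
    rw [show pstar N p = fun x => q * s x from funext hps]; fun_prop
  have hgc : Continuous fun x => ‖fderiv ℝ u x‖ ^ p x :=
    hud.rpow hpc fun x => Or.inr (by linarith [hp1 x])
  have hgcs : HasCompactSupport fun x => ‖fderiv ℝ u x‖ ^ p x := by
    refine (huc.fderiv (𝕜 := ℝ)).mono fun x hx h0 => hx ?_
    simp [h0, Real.zero_rpow (show p x ≠ 0 by linarith [hp1 x])]
  have hgi : Integrable (fun x => ‖fderiv ℝ u x‖ ^ p x) volume :=
    hgc.integrable_of_hasCompactSupport hgcs
  have hgradE : ∫ x in E, ‖fderiv ℝ u x‖ ^ p x ≤ 1 :=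
    (setIntegral_le_integral hgi (ae_of_all _ fun x => Real.rpow_nonneg (norm_nonneg _) _)).trans
      hgrad
  have hvq : ∫ x in E, v x ^ q ≤ M₁ := by
    have key := setIntegral_cutoffAbs_rpow_le hq1 hCG hG (LipschitzWith.const (1 : ℝ))
      (fun _ => le_rfl) (S := 1) (fun _ => le_rfl) hu huc
    simp only [mul_one, sub_self, Real.rpow_zero, one_mul, NNReal.coe_zero, zero_mul,
      add_zero] at key
    refine key.trans ?_
    have h1 : ∫ x in E, 2 * ‖fderiv ℝ u x‖ ≤ 2 * (M + 1) := by
      calc ∫ x in E, 2 * ‖fderiv ℝ u x‖ ≤ ∫ x in E, 2 * (1 + ‖fderiv ℝ u x‖ ^ p x) := by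
            refine setIntegral_mono (hint (by fun_prop)) (hint (by fun_prop)) fun x => ?_
            have h2 : ‖fderiv ℝ u x‖ ≤ 1 + ‖fderiv ℝ u x‖ ^ p x := by
              rcases le_total ‖fderiv ℝ u x‖ 1 with h | h
              · linarith [Real.rpow_nonneg (norm_nonneg (fderiv ℝ u x)) (p x)]
              · linarith [Real.self_le_rpow_of_one_le h (hp1 x).le]
            simp only
            linarith
        _ = 2 * (volume.real E + ∫ x in E, ‖fderiv ℝ u x‖ ^ p x) := by
            rw [integral_const_mul, integral_add (hint continuous_const) (hint hgc)]
            simp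
        _ ≤ _ := by linarith
    rw [hM₁]
    gcongr
  set A : ℝ := ∫ x in E, v x ^ pstar N p x with hA
  clear_value A
  have hAle : A ≤ max 1 (C₁ ^ (1 / (1 - γ * q))) := by
    rcases le_total A 1 with hA1 | hA1
    · exact hA1.trans (le_max_left _ _)
    refine le_trans ?_ (le_max_right _ _)
    have hA0 : 0 < A := by linarith
    refine le_rpow_of_le_mul_rpow hA0 ((lt_div_iff₀ hq0).1 hγq) ?_
    have key := setIntegral_cutoffAbs_rpow_le hq1 hCG hG hs (fun x => (hs1 x).le) hsS hu huc
    simp only [← hps] at key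
    refine (hA.trans_le key).trans ?_
    have hAγ : 1 ≤ A ^ (γ * q) := by
      refine Real.one_le_rpow hA1 (mul_nonneg ?_ hq0.le)
      exact hγ₂0.trans hγr
    have hgrow : ∀ x, v x ^ (s x - 1) * ‖fderiv ℝ u x‖ ≤
        A ^ γ * (v x ^ pstar N p x / A + ‖fderiv ℝ u x‖ ^ p x) := fun x => by
      have h1 : v x ^ (s x - 1) = (v x ^ pstar N p x) ^ (1 - 1 / p x) := by
        rw [← Real.rpow_mul (hv0 x).le]
        congr 1
        exact sobolevPower_sub_one (hp1 x) ((hpP x).trans_lt hPN)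
      rw [h1]
      refine (rpow_mul_le_scaled hA1 (Real.rpow_nonneg (hv0 x).le _) (norm_nonneg _)
        (hp1 x) (hpP x)).trans (mul_le_mul_of_nonneg_right ?_ ?_)
      · exact Real.rpow_le_rpow_of_exponent_le hA1 hγl
      · exact add_nonneg (div_nonneg (Real.rpow_nonneg (hv0 x).le _) hA0.le)
          (Real.rpow_nonneg (norm_nonneg _) _)
    have hlogterm : ∀ x, v x ^ s x * Real.log (v x) ≤
        A ^ γ * (1 / δ * (v x ^ pstar N p x / A + v x ^ q)) := fun x => by
      have hvx := hv0 x
      have h1 : v x ^ s x * Real.log (v x) ≤ 1 / δ * v x ^ (s x + δ) := by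
        rw [Real.rpow_add hvx]
        calc v x ^ s x * Real.log (v x) ≤ v x ^ s x * (v x ^ δ / δ) := by
              gcongr
              exact Real.log_le_rpow_div hvx.le hδ0
          _ = _ := by ring
      have h2 : v x ^ (s x + δ) ≤ (v x ^ pstar N p x) ^ γ₂ * (v x ^ q) ^ (1 - γ₂) := by
        rw [← Real.rpow_mul hvx.le, ← Real.rpow_mul hvx.le, ← Real.rpow_add hvx]
        exact Real.rpow_le_rpow_of_exponent_le (hv1 x) (hexp x)
      have h3 := rpow_mul_rpow_le_scaled hA0 (Real.rpow_nonneg hvx.le (pstar N p x))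
        (Real.rpow_nonneg hvx.le q) hγ₂0 hγ₂1
      have h4 : A ^ γ₂ ≤ A ^ γ := Real.rpow_le_rpow_of_exponent_le hA1 hγr
      calc _ ≤ 1 / δ * v x ^ (s x + δ) := h1
        _ ≤ 1 / δ * (A ^ γ * (v x ^ pstar N p x / A + v x ^ q)) := by
            gcongr
            refine (h2.trans h3).trans ?_
            gcongr
        _ = _ := by ring
    have hI : ∫ x in E, (2 * S * (v x ^ (s x - 1) * ‖fderiv ℝ u x‖) +
        K' * (v x ^ s x * Real.log (v x))) ≤ A ^ γ * L := by
      have c1 : Continuous fun x => v x ^ (s x - 1) := hvr (by fun_prop)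
      have c2 : Continuous fun x => v x ^ s x := hvr hsc
      have c3 : Continuous fun x => v x ^ pstar N p x := hvr hpsc
      have c4 : Continuous fun x => v x ^ q := hvr continuous_const
      calc _ ≤ ∫ x in E, A ^ γ * (2 * S * (v x ^ pstar N p x / A + ‖fderiv ℝ u x‖ ^ p x) +
            K' * (1 / δ * (v x ^ pstar N p x / A + v x ^ q))) := by
            refine setIntegral_mono (hint (by fun_prop)) (hint (by fun_prop)) fun x => ?_
            have h1 := mul_le_mul_of_nonneg_left (hgrow x) (show 0 ≤ 2 * S by linarith)
            have h2 := mul_le_mul_of_nonneg_left (hlogterm x) K'.2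
            simp only [NNReal.val_eq_coe] at h2 ⊢
            linarith
        _ = A ^ γ * (2 * S * (A / A + ∫ x in E, ‖fderiv ℝ u x‖ ^ p x) +
            K' * (1 / δ * (A / A + ∫ x in E, v x ^ q))) := by
            rw [integral_const_mul, integral_add (hint (by fun_prop)) (hint (by fun_prop)),
              integral_const_mul, integral_const_mul, integral_const_mul,
              integral_add (hint (by fun_prop)) (hint (by fun_prop)),
              integral_add (hint (by fun_prop)) (hint (by fun_prop)), integral_div, ← hA]
        _ ≤ _ := by
            rw [div_self hA0.ne', hL]
            have : 2 * S * (1 + ∫ x in E, ‖fderiv ℝ u x‖ ^ p x) ≤ 4 * S := by nlinarith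
            gcongr
    have hI0 : 0 ≤ ∫ x in E, (2 * S * (v x ^ (s x - 1) * ‖fderiv ℝ u x‖) +
        K' * (v x ^ s x * Real.log (v x))) := integral_nonneg fun x => by
      have := hv0 x
      have := Real.log_nonneg (hv1 x)
      positivity
    calc _ ≤ 4 ^ q * (CG * (A ^ γ * L) ^ q + M * A ^ (γ * q)) := by
          gcongr
          exact hvol.trans (le_mul_of_one_le_right hM hAγ)
      _ = C₁ * A ^ (γ * q) := by
          rw [Real.mul_rpow (by positivity) hL0, ← Real.rpow_mul hA0.le, hC₁]
          ring
  calc ∫ x in E, |u x| ^ pstar N p x ≤ ∫ x in E, 2 ^ (q * S) * v x ^ pstar N p x := by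
        have hps0 : ∀ x, 0 < pstar N p x := fun x => by
          rw [hps]; exact mul_pos hq0 (by linarith [hs1 x])
        have c3 : Continuous fun x => v x ^ pstar N p x := hvr hpsc
        refine setIntegral_mono (hint (hu.continuous.abs.rpow hpsc fun x => Or.inr (hps0 x)))
          (hint (by fun_prop)) fun x => ?_
        calc |u x| ^ pstar N p x ≤ (2 * v x) ^ pstar N p x :=
              Real.rpow_le_rpow (abs_nonneg _) (abs_le_two_mul_cutoffAbs _) (hps0 x).le
          _ = 2 ^ pstar N p x * v x ^ pstar N p x := Real.mul_rpow (by norm_num) (hv0 x).le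
          _ ≤ _ := by
              refine mul_le_mul_of_nonneg_right ?_ (Real.rpow_nonneg (hv0 x).le _)
              refine Real.rpow_le_rpow_of_exponent_le (by norm_num) ?_
              rw [hps]
              exact mul_le_mul_of_nonneg_left (hsS x) hq0.le
    _ = 2 ^ (q * S) * A := by rw [integral_const_mul, hA]
    _ ≤ _ := by gcongr

/-- The derivative of the bounded power `|t| ^ s / (1 + |t| ^ s)`. -/
lemma exists_hasDerivAt_boundedPower {s : ℝ} (hs : 1 < s) (t : ℝ) :
    ∃ d : ℝ, HasDerivAt (fun t : ℝ => |t| ^ s / (1 + |t| ^ s)) d t ∧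
      |d| ≤ s * (|t| ^ s / (1 + |t| ^ s)) ^ (1 - 1 / s) := by
  have h1 := hasDerivAt_abs_rpow t hs
  have hs0 : 0 < s := by linarith
  have hy : 0 ≤ |t| ^ s := by positivity
  have h2 := h1.div (h1.const_add 1) (by positivity)
  refine ⟨_, h2, ?_⟩
  set y := |t| ^ s with hydef
  have e1 : s * |t| ^ (s - 2) * t * (1 + y) - y * (s * |t| ^ (s - 2) * t) =
      s * (|t| ^ (s - 2) * t) := by ring
  have e2 : |(|t| ^ (s - 2) * t)| = y ^ (1 - 1 / s) := by
    rw [hydef, ← Real.rpow_mul (abs_nonneg t), abs_mul,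
      abs_of_nonneg (by positivity : 0 ≤ |t| ^ (s - 2))]
    rw [show s * (1 - 1 / s) = s - 2 + 1 by field_simp; ring]
    rcases eq_or_ne t 0 with rfl | ht
    · rw [abs_zero, mul_zero, Real.zero_rpow (by linarith)]
    · rw [Real.rpow_add_one (abs_ne_zero.2 ht)]
  have hexp : 1 - 1 / s ≤ 1 := by
    have : 0 < 1 / s := by positivity
    linarith
  rw [e1, abs_div, abs_mul, e2, abs_of_pos hs0, Real.div_rpow hy (by positivity), mul_div_assoc,
    abs_of_nonneg (by positivity)]
  refine mul_le_mul_of_nonneg_left ?_ hs0.le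
  refine div_le_div_of_nonneg_left (by positivity) (by positivity) ?_
  calc (1 + y) ^ (1 - 1 / s) ≤ (1 + y) ^ (1 : ℝ) :=
        Real.rpow_le_rpow_of_exponent_le (by linarith) hexp
    _ ≤ (1 + y) ^ 2 := by rw [Real.rpow_one]; nlinarith

lemma tendsto_of_log_decay {N : ℕ} (hN : 2 ≤ N) {p : EuclideanSpace ℝ (Fin N) → ℝ} {pinf C₀ : ℝ}
    (h : ∀ x, |p x - pinf| ≤ C₀ / Real.log (Real.exp 1 + ‖x‖)) :
    Tendsto (fun n : ℕ => p (EuclideanSpace.single ⟨0, by omega⟩ (n : ℝ))) atTop (𝓝 pinf) := by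
  rw [tendsto_iff_dist_tendsto_zero]
  refine squeeze_zero (fun _ => dist_nonneg)
    (g := fun n : ℕ => C₀ / Real.log (Real.exp 1 + n)) (fun n => ?_) ?_
  · have := h (EuclideanSpace.single ⟨0, by omega⟩ (n : ℝ))
    rwa [PiLp.norm_single, Real.norm_natCast] at this
  · refine Tendsto.const_div_atTop ?_ _
    exact Real.tendsto_log_atTop.comp
      (tendsto_atTop_add_const_left _ _ tendsto_natCast_atTop_atTop)

set_option maxHeartbeats 1000000 in
/-- Under log-Hölder decay at infinity, the modular of the gradient controls the measure of
`{|u| > 1}` and the modular of `u` in `L^{p*(x)}` over the complement. -/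
lemma exists_measure_le_and_setIntegral_compl_le {N : ℕ} (hN : 2 ≤ N)
    {p : EuclideanSpace ℝ (Fin N) → ℝ} (hpc : Continuous p) {P pinf L : ℝ}
    (hp1 : ∀ x, 1 < p x) (hpP : ∀ x, p x ≤ P) (hPN : P < N) (hinf1 : 1 < pinf) (hinfP : pinf ≤ P)
    (hdecay : ∀ x, |p x - pinf| ≤ L / Real.log (Real.exp 1 + ‖x‖)) :
    ∃ M : ℝ, 0 ≤ M ∧ ∀ u : EuclideanSpace ℝ (Fin N) → ℝ, ContDiff ℝ 1 u → HasCompactSupport u →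
      ∫ x, ‖fderiv ℝ u x‖ ^ p x ≤ 1 → volume.real {x | 1 < |u x|} ≤ M ∧
      ∫ x in {x | 1 < |u x|}ᶜ, |u x| ^ pstar N p x ≤ M := by
  have hN' : (2 : ℝ) ≤ N := by exact_mod_cast hN
  have hN1 : (0 : ℝ) < N - 1 := by linarith
  set q : ℝ := N / (N - 1) with hq
  have hq1 : 1 ≤ q := by rw [hq, le_div_iff₀ hN1]; linarith
  have hq0 : 0 < q := by linarith
  obtain ⟨CG, hCG, hG⟩ := exists_integral_rpow_le_integral_norm_fderiv hN hq
  set s : ℝ := sobolevPower N pinf with hs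
  have hs1 : 1 < s := one_lt_sobolevPower hinf1 (hinfP.trans_lt hPN)
  have hs0 : 0 < s := by linarith
  have hqs : q * s = N * pinf / (N - pinf) := mul_sobolevPower hN pinf
  have hexp : 1 - 1 / s = q * (1 - 1 / pinf) := by
    have h1 := sobolevPower_sub_one hinf1 (hinfP.trans_lt hPN)
    rw [← hqs, ← hs] at h1
    have h2 : (1 - 1 / s) * s = (q * (1 - 1 / pinf)) * s := by
      rw [sub_mul, one_mul, one_div_mul_cancel hs0.ne', h1]; ring
    exact mul_right_cancel₀ hs0.ne' h2
  set γ : ℝ := 1 - 1 / pinf with hγ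
  have hγ0 : 0 ≤ γ := by
    have := one_div_le_one_div_of_le one_pos hinf1.le
    rw [hγ]; linarith
  have hγq : γ * q < 1 := by
    have : 0 < 1 / s := by positivity
    rw [mul_comm, ← hexp]; linarith
  set Y : EuclideanSpace ℝ (Fin N) → ℝ := fun x => Real.exp 1 + ‖x‖ with hY
  have he : 1 < Real.exp 1 := by simp
  have hY1 : ∀ x, 1 < Y x := fun x => by simp only [hY]; linarith [norm_nonneg x]
  have hlogY : ∀ x, 0 < Real.log (Y x) := fun x => Real.log_pos (hY1 x)
  have hdec : ∀ x, |p x - pinf| * Real.log (Y x) ≤ L := fun x =>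
    (le_div_iff₀ (hlogY x)).1 (hdecay x)
  have hL0 : 0 ≤ L := (mul_nonneg (abs_nonneg _) (hlogY 0).le).trans (hdec 0)
  set k : ℝ := N + 1 with hk
  have hk0 : 0 ≤ k := by positivity
  set h : EuclideanSpace ℝ (Fin N) → ℝ := fun x => (1 + ‖x‖) ^ (-k) with hh
  have hh0 : ∀ x, 0 ≤ h x := fun x => by positivity
  have hhi : Integrable h volume := integrable_one_add_norm (by
    rw [finrank_euclideanSpace_fin, hk]; linarith)
  have hYh : ∀ x, Y x ^ (-k) ≤ h x := fun x => by
    refine Real.rpow_le_rpow_of_nonpos (by positivity) ?_ (by linarith)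
    simp only [hY]; linarith
  set H : ℝ := ∫ x, h x with hH
  have hH0 : 0 ≤ H := integral_nonneg hh0
  set B : ℝ := Real.exp (k * L) with hB
  have hB1 : 1 ≤ B := Real.one_le_exp (by positivity)
  set L' : ℝ := N * N / (N - P) ^ 2 * L with hL'
  set B' : ℝ := Real.exp (k * L') with hB'
  have hB'0 : 0 < B' := Real.exp_pos _
  set C₁ : ℝ := CG * (s * (1 + B + H)) ^ q with hC₁
  set D₀ : ℝ := max 1 (C₁ ^ (1 / (1 - γ * q))) with hD₀
  have hD₀1 : 1 ≤ D₀ := le_max_left _ _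
  have hD₀2 : C₁ ^ (1 / (1 - γ * q)) ≤ D₀ := le_max_right _ _
  have hdecs : ∀ x, |pstar N p x - q * s| * Real.log (Y x) ≤ L' := fun x => by
    rw [hqs, pstar]
    have h1 := abs_div_sub_sub_le (N := N) (Nat.cast_nonneg N) (hpP x) hinfP hPN
    have h2 : (0 : ℝ) ≤ N * N / (N - P) ^ 2 := by positivity
    calc _ ≤ N * N / (N - P) ^ 2 * |p x - pinf| * Real.log (Y x) :=
          mul_le_mul_of_nonneg_right h1 (hlogY x).le
      _ ≤ _ := by
          rw [mul_assoc]
          exact mul_le_mul_of_nonneg_left (hdec x) h2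
  refine ⟨2 ^ q * D₀ + (B' * (2 ^ q * D₀) + H), by positivity, fun u hu huc hgrad => ?_⟩
  clear_value L' B' C₁ D₀ B H γ k
  set f : EuclideanSpace ℝ (Fin N) → ℝ := fun x => |u x| ^ s / (1 + |u x| ^ s) with hf
  have hf0 : ∀ x, 0 ≤ f x := fun x => by positivity
  have hf1 : ∀ x, f x ≤ 1 := fun x => by
    simp only [hf]
    rw [div_le_one (by positivity)]
    linarith
  have hpow : ContDiff ℝ 1 fun x => |u x| ^ s := hu.norm_rpow hs1
  have hfd : ContDiff ℝ 1 f := hpow.div (contDiff_const.add hpow) fun x => by positivity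
  have hfc : HasCompactSupport f :=
    huc.comp_left (g := fun t : ℝ => |t| ^ s / (1 + |t| ^ s)) (by simp [hs0.ne'])
  have hfder : ∀ x, ‖fderiv ℝ f x‖ ≤ s * (f x ^ (1 - 1 / s) * ‖fderiv ℝ u x‖) := fun x => by
    obtain ⟨d, hd, hdle⟩ := exists_hasDerivAt_boundedPower hs1 (u x)
    have h1 := hd.comp_hasFDerivAt x (hu.differentiable one_ne_zero x).hasFDerivAt
    have h2 : fderiv ℝ f x = d • fderiv ℝ u x := h1.fderiv
    rw [h2, norm_smul, ← mul_assoc]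
    exact mul_le_mul_of_nonneg_right hdle (norm_nonneg _)
  have hfq : Continuous fun x => f x ^ q :=
    hfd.continuous.rpow_const fun _ => Or.inr hq0.le
  have hfqc : HasCompactSupport fun x => f x ^ q :=
    hfc.comp_left (g := fun t : ℝ => t ^ q) (by simp [hq0.ne'])
  have hfqi : Integrable (fun x => f x ^ q) volume :=
    hfq.integrable_of_hasCompactSupport hfqc
  have hud : Continuous fun x => ‖fderiv ℝ u x‖ := (hu.continuous_fderiv one_ne_zero).norm
  have hgc : Continuous fun x => ‖fderiv ℝ u x‖ ^ p x :=
    hud.rpow hpc fun x => Or.inr (by linarith [hp1 x])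
  have hgcs : HasCompactSupport fun x => ‖fderiv ℝ u x‖ ^ p x := by
    refine (huc.fderiv (𝕜 := ℝ)).mono fun x hx h0 => hx ?_
    simp [h0, Real.zero_rpow (show p x ≠ 0 by linarith [hp1 x])]
  have hgi : Integrable (fun x => ‖fderiv ℝ u x‖ ^ p x) volume :=
    hgc.integrable_of_hasCompactSupport hgcs
  obtain ⟨D, hD⟩ : ∃ D, D = ∫ x, f x ^ q := ⟨_, rfl⟩
  have hDle : D ≤ D₀ := by
    rcases le_total D 1 with hD1 | hD1
    · exact hD1.trans hD₀1
    have hDpos : 0 < D := by linarith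
    refine (le_rpow_of_le_mul_rpow hDpos hγq ?_).trans hD₀2
    have hDγ : 1 ≤ D ^ γ := Real.one_le_rpow hD1 hγ0
    have hpt : ∀ x, f x ^ (1 - 1 / s) * ‖fderiv ℝ u x‖ ≤
        D ^ γ * (f x ^ q / D + B * ‖fderiv ℝ u x‖ ^ p x + h x) := fun x => by
      set g := ‖fderiv ℝ u x‖ with hgdef
      have hg0 : 0 ≤ g := norm_nonneg _
      have hgp : 0 ≤ g ^ p x := Real.rpow_nonneg hg0 _
      have hd0 : 0 ≤ f x ^ q := Real.rpow_nonneg (hf0 x) _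
      have hdD : 0 ≤ f x ^ q / D := div_nonneg hd0 hDpos.le
      rcases le_total g 1 with hg1 | hg1
      · have h1 : f x ^ (1 - 1 / s) = (f x ^ q) ^ (1 - 1 / pinf) := by
          rw [hexp, Real.rpow_mul (hf0 x), hγ]
        rw [h1]
        refine (rpow_mul_le_scaled hD1 hd0 hg0 hinf1 le_rfl).trans ?_
        rw [← hγ]
        refine mul_le_mul_of_nonneg_left ?_ (by linarith)
        have h2 := rpow_le_mul_rpow_add_of_log_decay (a := pinf) (b := p x) hg0 hg1 hinf1.le
          (hY1 x).le hk0 (by rw [abs_sub_comm]; exact hdec x : |pinf - p x| * Real.log (Y x) ≤ L)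
        rw [← hB] at h2
        linarith [hYh x]
      · have h1 : f x ^ (1 - 1 / s) ≤ 1 := by
          refine Real.rpow_le_one (hf0 x) (hf1 x) ?_
          rw [hexp]; exact mul_nonneg hq0.le hγ0
        have h2 : g ≤ g ^ p x := Real.self_le_rpow_of_one_le hg1 (hp1 x).le
        have h3 : f x ^ (1 - 1 / s) * g ≤ g := mul_le_of_le_one_left hg0 h1
        have h4 : g ^ p x ≤ B * g ^ p x := le_mul_of_one_le_left hgp hB1
        have h5 : g ≤ f x ^ q / D + B * g ^ p x + h x := by linarith [hh0 x]
        exact h3.trans (h5.trans (le_mul_of_one_le_left (by linarith) hDγ))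
    have hI : ∫ x, ‖fderiv ℝ f x‖ ≤ D ^ γ * (s * (1 + B + H)) := by
      have i1 : Integrable (fun x => f x ^ q / D) volume := hfqi.div_const D
      have i2 : Integrable (fun x => B * ‖fderiv ℝ u x‖ ^ p x) volume := hgi.const_mul B
      calc ∫ x, ‖fderiv ℝ f x‖
          ≤ ∫ x, s * (D ^ γ * (f x ^ q / D + B * ‖fderiv ℝ u x‖ ^ p x + h x)) := by
            refine integral_mono_of_nonneg (ae_of_all _ fun x => norm_nonneg _)
              ((((i1.add i2).add hhi).const_mul _).const_mul _) (ae_of_all _ fun x => ?_)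
            exact (hfder x).trans (mul_le_mul_of_nonneg_left (hpt x) hs0.le)
        _ = s * (D ^ γ * (D / D + B * (∫ x, ‖fderiv ℝ u x‖ ^ p x) + H)) := by
            rw [integral_const_mul, integral_const_mul,
              integral_add (f := fun x => f x ^ q / D + B * ‖fderiv ℝ u x‖ ^ p x) (i1.add i2) hhi,
              integral_add i1 i2, integral_div, integral_const_mul, ← hD, ← hH]
        _ = D ^ γ * (s * (1 + B * (∫ x, ‖fderiv ℝ u x‖ ^ p x) + H)) := by
            rw [div_self hDpos.ne']; ring
        _ ≤ _ := by
            have : B * (∫ x, ‖fderiv ℝ u x‖ ^ p x) ≤ B :=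
              mul_le_of_le_one_right (by linarith) hgrad
            gcongr
    have hI0 : 0 ≤ ∫ x, ‖fderiv ℝ f x‖ := integral_nonneg fun _ => norm_nonneg _
    have key := hG f hfd hfc
    simp only [abs_of_nonneg (hf0 _)] at key
    rw [← hD] at key
    refine key.trans ?_
    calc CG * (∫ x, ‖fderiv ℝ f x‖) ^ q ≤ CG * (D ^ γ * (s * (1 + B + H))) ^ q := by gcongr
      _ = C₁ * D ^ (γ * q) := by
          rw [Real.mul_rpow (by positivity) (by positivity), ← Real.rpow_mul hDpos.le, hC₁]
          ring
  have hE : MeasurableSet {x | 1 < |u x|} :=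
    (isOpen_lt continuous_const hu.continuous.abs).measurableSet
  have hmeas : volume.real {x | 1 < |u x|} ≤ 2 ^ q * D₀ := by
    have hsub : {x | 1 < |u x|} ⊆ tsupport u := fun x hx => by
      refine subset_tsupport u ?_
      intro h0
      simp only [Set.mem_ofPred_eq, h0, abs_zero] at hx
      linarith
    have hfin : volume {x | 1 < |u x|} ≠ ⊤ :=
      ((measure_mono hsub).trans_lt huc.measure_lt_top).ne
    have hi1 : IntegrableOn (fun _ => (1 : ℝ)) {x | 1 < |u x|} volume :=
      integrableOn_const hfin
    calc volume.real {x | 1 < |u x|} = ∫ x in {x | 1 < |u x|}, (1 : ℝ) := by simp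
      _ ≤ ∫ x in {x | 1 < |u x|}, 2 ^ q * f x ^ q := by
          refine setIntegral_mono_on hi1 (hfqi.const_mul _).integrableOn hE fun x hx => ?_
          rw [← Real.mul_rpow (by norm_num) (hf0 x)]
          refine Real.one_le_rpow ?_ hq0.le
          have hy : 1 ≤ |u x| ^ s := Real.one_le_rpow (le_of_lt hx) hs0.le
          simp only [hf]
          rw [mul_div_assoc', le_div_iff₀ (by positivity)]
          linarith
      _ ≤ ∫ x, 2 ^ q * f x ^ q :=
          setIntegral_le_integral (hfqi.const_mul _) (ae_of_all _ fun x =>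
            mul_nonneg (by positivity) (Real.rpow_nonneg (hf0 x) _))
      _ = 2 ^ q * D := by rw [integral_const_mul, hD]
      _ ≤ _ := by gcongr
  have hsmall : ∫ x in {x | 1 < |u x|}ᶜ, |u x| ^ pstar N p x ≤ B' * (2 ^ q * D₀) + H := by
    calc ∫ x in {x | 1 < |u x|}ᶜ, |u x| ^ pstar N p x
        ≤ ∫ x in {x | 1 < |u x|}ᶜ, (B' * (2 ^ q * f x ^ q) + h x) := by
          refine integral_mono_of_nonneg (ae_of_all _ fun x => by positivity)
            (((hfqi.const_mul _).const_mul _).add hhi).integrableOn ?_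
          refine (ae_restrict_iff' hE.compl).2 (ae_of_all _ fun x hx => ?_)
          have hx1 : |u x| ≤ 1 := not_lt.1 hx
          have hps1 : 1 ≤ pstar N p x := by
            have h1 := one_lt_sobolevPower (hp1 x) ((hpP x).trans_lt hPN)
            have h2 : pstar N p x = q * sobolevPower N (p x) := (mul_sobolevPower hN (p x)).symm
            rw [h2]; nlinarith
          have h2 := rpow_le_mul_rpow_add_of_log_decay (a := pstar N p x) (b := q * s)
            (abs_nonneg (u x)) hx1 hps1 (hY1 x).le hk0 (hdecs x)
          rw [← hB'] at h2
          refine h2.trans (add_le_add (mul_le_mul_of_nonneg_left ?_ hB'0.le) (hYh x))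
          rw [← Real.mul_rpow (by norm_num) (hf0 x), mul_comm q s, Real.rpow_mul (abs_nonneg _)]
          refine Real.rpow_le_rpow (by positivity) ?_ hq0.le
          have hy : |u x| ^ s ≤ 1 := Real.rpow_le_one (abs_nonneg _) hx1 hs0.le
          have hy0 : 0 ≤ |u x| ^ s := by positivity
          simp only [hf]
          rw [mul_div_assoc', le_div_iff₀ (by positivity)]
          nlinarith
      _ ≤ ∫ x, (B' * (2 ^ q * f x ^ q) + h x) :=
          setIntegral_le_integral (((hfqi.const_mul _).const_mul _).add hhi)
            (ae_of_all _ fun x => add_nonneg (mul_nonneg hB'0.le (mul_nonneg (by positivity)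
              (Real.rpow_nonneg (hf0 x) _))) (hh0 x))
      _ = B' * (2 ^ q * D) + H := by
          rw [integral_add ((hfqi.const_mul _).const_mul _) hhi, integral_const_mul,
            integral_const_mul, hD, hH]
      _ ≤ _ := by gcongr
  have h2D : 0 ≤ 2 ^ q * D₀ := by positivity
  have hBD : 0 ≤ B' * (2 ^ q * D₀) := by positivity
  exact ⟨by linarith, by linarith⟩

lemma exists_pos_ae_le_of_essInf_ne_zero {α : Type*} [MeasurableSpace α] {μ : Measure α}
    {V : α → ℝ} (hV : ∀ᵐ x ∂μ, 0 < V x) (h : essInf V μ ≠ 0) :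
    ∃ c : ℝ, 0 < c ∧ ∀ᵐ x ∂μ, c ≤ V x := by
  by_contra hne
  refine h ?_
  rw [essInf, Filter.liminf_eq]
  have h0 : (0 : ℝ) ∈ {a | ∀ᶠ n in ae μ, a ≤ V n} := hV.mono fun x hx => hx.le
  have hub : ∀ a ∈ {a | ∀ᶠ n in ae μ, a ≤ V n}, a ≤ 0 := fun a ha =>
    not_lt.1 fun hpos => hne ⟨a, hpos, ha⟩
  exact le_antisymm (csSup_le ⟨0, h0⟩ hub) (le_csSup ⟨0, hub⟩ h0)

section Modular

variable {N : ℕ} {p V : EuclideanSpace ℝ (Fin N) → ℝ}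

lemma CondP.sInf_le (hP : CondP N p V) (x : EuclideanSpace ℝ (Fin N)) :
    sInf (Set.range p) ≤ p x := csInf_le hP.pbddBelow ⟨x, rfl⟩

lemma CondP.le_sSup (hP : CondP N p V) (x : EuclideanSpace ℝ (Fin N)) :
    p x ≤ sSup (Set.range p) := le_csSup hP.pbddAbove ⟨x, rfl⟩

lemma CondP.one_lt (hP : CondP N p V) (x : EuclideanSpace ℝ (Fin N)) : 1 < p x :=
  hP.inf_gt_one.trans_le (hP.sInf_le x)

lemma CondP.two_le (hP : CondP N p V) : 2 ≤ N := by
  have h : (1 : ℝ) < N := (hP.one_lt 0).trans_le ((hP.le_sSup 0).trans hP.sup_lt_N.le)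
  exact_mod_cast h

lemma CondP.continuous (hP : CondP N p V) : Continuous p := by
  obtain ⟨K, hK⟩ := hP.lip
  exact hK.continuous

lemma CondP.le_pstar (hP : CondP N p V) (x : EuclideanSpace ℝ (Fin N)) : p x ≤ pstar N p x := by
  have h1 := hP.one_lt x
  have h2 : p x < N := (hP.le_sSup x).trans_lt hP.sup_lt_N
  rw [pstar, le_div_iff₀ (by linarith)]
  nlinarith

lemma CondP.continuous_pstar (hP : CondP N p V) : Continuous (pstar N p) := by
  refine (continuous_const.mul hP.continuous).div (continuous_const.sub hP.continuous) fun x => ?_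
  have h2 : p x < N := (hP.le_sSup x).trans_lt hP.sup_lt_N
  linarith

lemma integrable_abs_rpow {r u : EuclideanSpace ℝ (Fin N) → ℝ} (hr : Continuous r)
    (hr0 : ∀ x, 0 < r x) (hu : Continuous u) (huc : HasCompactSupport u) :
    Integrable (fun x => |u x| ^ r x) volume := by
  refine (hu.abs.rpow hr fun x => Or.inr (hr0 x)).integrable_of_hasCompactSupport
    (huc.mono fun x hx h0 => hx ?_)
  simp [h0, (hr0 x).ne']

/-- The weight is bounded on the support of a test function, so its modular is finite. -/
lemma CondP.integrable_mul_abs_rpow (hP : CondP N p V) {u : EuclideanSpace ℝ (Fin N) → ℝ}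
    (hu : Continuous u) (huc : HasCompactSupport u) :
    Integrable (fun x => V x * |u x| ^ p x) volume := by
  have hi := integrable_abs_rpow hP.continuous (fun x => by linarith [hP.one_lt x]) hu huc
  obtain ⟨R, hR0, hR⟩ := huc.isBounded.subset_ball_lt 0 0
  obtain ⟨c, C, hc, hV⟩ := hP.Vloc R hR0
  have hV' := (ae_restrict_iff' measurableSet_ball).1 hV
  refine (hi.const_mul C).mono' (hP.Vmeas.aestronglyMeasurable.mul hi.aestronglyMeasurable) ?_
  filter_upwards [hV'] with x hx
  have h0 : 0 ≤ |u x| ^ p x := Real.rpow_nonneg (abs_nonneg _) _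
  by_cases hxs : x ∈ tsupport u
  · obtain ⟨h1, h2⟩ := hx (hR hxs)
    rw [Real.norm_of_nonneg (mul_nonneg (hc.le.trans h1) h0)]
    exact mul_le_mul_of_nonneg_right h2 h0
  · have h1 : |u x| ^ p x = 0 := by
      rw [image_eq_zero_of_notMem_tsupport hxs, abs_zero,
        Real.zero_rpow (by linarith [hP.one_lt x])]
    simp [h1]

/-- If the weight is bounded below, the weighted modular controls the measure of `{|u| > 1}` and
the modular of `u` in `L^{p*(x)}` over the complement. -/
lemma CondP.measure_le_and_setIntegral_compl_le_of_le (hP : CondP N p V) {c : ℝ} (hc : 0 < c)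
    (hcV : ∀ᵐ x ∂(volume : Measure (EuclideanSpace ℝ (Fin N))), c ≤ V x)
    {u : EuclideanSpace ℝ (Fin N) → ℝ} (hu : Continuous u) (huc : HasCompactSupport u)
    (hmod : ∫ x, V x * |u x| ^ p x ≤ 1) :
    volume.real {x | 1 < |u x|} ≤ 1 / c ∧
      ∫ x in {x | 1 < |u x|}ᶜ, |u x| ^ pstar N p x ≤ 1 / c := by
  have hi := integrable_abs_rpow hP.continuous (fun x => by linarith [hP.one_lt x]) hu huc
  have h0 : ∀ x, 0 ≤ |u x| ^ p x := fun x => Real.rpow_nonneg (abs_nonneg _) _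
  have hmass : ∫ x, |u x| ^ p x ≤ 1 / c := by
    rw [le_div_iff₀ hc, mul_comm, ← integral_const_mul]
    refine (integral_mono_ae (hi.const_mul c) (hP.integrable_mul_abs_rpow hu huc) ?_).trans hmod
    filter_upwards [hcV] with x hx using mul_le_mul_of_nonneg_right hx (h0 x)
  have hE : MeasurableSet {x | 1 < |u x|} := (isOpen_lt continuous_const hu.abs).measurableSet
  have hset : ∀ s : Set (EuclideanSpace ℝ (Fin N)), ∫ x in s, |u x| ^ p x ≤ 1 / c := fun s =>
    (setIntegral_le_integral hi (ae_of_all _ h0)).trans hmass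
  constructor
  · have hsub : {x | 1 < |u x|} ⊆ tsupport u := fun x hx => by
      refine subset_tsupport u fun h0 => ?_
      simp only [Set.mem_ofPred_eq, h0, abs_zero] at hx
      linarith
    have hfin : volume {x | 1 < |u x|} ≠ ⊤ :=
      ((measure_mono hsub).trans_lt huc.measure_lt_top).ne
    have hi1 : IntegrableOn (fun _ => (1 : ℝ)) {x | 1 < |u x|} volume := integrableOn_const hfin
    calc volume.real {x | 1 < |u x|} = ∫ x in {x | 1 < |u x|}, (1 : ℝ) := by simp
      _ ≤ ∫ x in {x | 1 < |u x|}, |u x| ^ p x :=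
          setIntegral_mono_on hi1 hi.integrableOn hE fun x hx =>
            Real.one_le_rpow (le_of_lt hx) (by linarith [hP.one_lt x])
      _ ≤ _ := hset _
  · refine le_trans ?_ (hset {x | 1 < |u x|}ᶜ)
    refine integral_mono_of_nonneg (ae_of_all _ fun x => Real.rpow_nonneg (abs_nonneg _) _)
      hi.integrableOn ((ae_restrict_iff' hE.compl).2 (ae_of_all _ fun x hx => ?_))
    exact Real.rpow_le_rpow_of_exponent_ge' (abs_nonneg _) (not_lt.1 hx)
      (by linarith [hP.one_lt x]) (hP.le_pstar x)

/-- The modular form of the imbedding. -/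
lemma CondP.exists_integral_pstar_le (hP : CondP N p V) :
    ∃ C : ℝ, 1 ≤ C ∧ ∀ u : EuclideanSpace ℝ (Fin N) → ℝ, ContDiff ℝ 1 u → HasCompactSupport u →
      ∫ x, ‖fderiv ℝ u x‖ ^ p x ≤ 1 → ∫ x, V x * |u x| ^ p x ≤ 1 →
      ∫ x, |u x| ^ pstar N p x ≤ C := by
  have hsplit : ∃ M : ℝ, 0 ≤ M ∧ ∀ u : EuclideanSpace ℝ (Fin N) → ℝ, ContDiff ℝ 1 u →
      HasCompactSupport u → ∫ x, ‖fderiv ℝ u x‖ ^ p x ≤ 1 → ∫ x, V x * |u x| ^ p x ≤ 1 →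
      volume.real {x | 1 < |u x|} ≤ M ∧ ∫ x in {x | 1 < |u x|}ᶜ, |u x| ^ pstar N p x ≤ M := by
    by_cases hV : essInf V (volume : Measure (EuclideanSpace ℝ (Fin N))) = 0
    · obtain ⟨pinf, L, hdecay⟩ := hP.logHolderDecay hV
      have hlim := tendsto_of_log_decay hP.two_le hdecay
      have hinf1 : 1 < pinf :=
        hP.inf_gt_one.trans_le (ge_of_tendsto' hlim fun _ => hP.sInf_le _)
      have hinfP : pinf ≤ sSup (Set.range p) := le_of_tendsto' hlim fun _ => hP.le_sSup _
      obtain ⟨M, hM0, hM⟩ := exists_measure_le_and_setIntegral_compl_le hP.two_le hP.continuous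
        hP.one_lt hP.le_sSup hP.sup_lt_N hinf1 hinfP hdecay
      exact ⟨M, hM0, fun u hu huc hgrad _ => hM u hu huc hgrad⟩
    · obtain ⟨c, hc, hcV⟩ := exists_pos_ae_le_of_essInf_ne_zero hP.Vpos hV
      exact ⟨1 / c, by positivity, fun u hu huc _ hmod =>
        hP.measure_le_and_setIntegral_compl_le_of_le hc hcV hu.continuous huc hmod⟩
  obtain ⟨M, hM0, hM⟩ := hsplit
  obtain ⟨K, hK⟩ := hP.lip
  obtain ⟨C, hC⟩ := exists_setIntegral_pstar_le hP.two_le hK hP.one_lt hP.le_sSup hP.sup_lt_N hM0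
  refine ⟨max 1 (C + M), le_max_left _ _, fun u hu huc hgrad hmod => ?_⟩
  obtain ⟨h1, h2⟩ := hM u hu huc hgrad hmod
  have hE : MeasurableSet {x | 1 < |u x|} :=
    (isOpen_lt continuous_const hu.continuous.abs).measurableSet
  have hi := integrable_abs_rpow hP.continuous_pstar
    (fun x => by linarith [hP.one_lt x, hP.le_pstar x]) hu.continuous huc
  rw [← integral_add_compl hE hi]
  exact (add_le_add (hC u hu huc hgrad h1) h2).trans (le_max_right _ _)

end Modular

section Luxemburg

variable {N : ℕ} {w r u : EuclideanSpace ℝ (Fin N) → ℝ}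

lemma abs_div_rpow_eq {a c t : ℝ} (hc : 0 < c) : |a / c| ^ t = |a| ^ t / c ^ t := by
  rw [abs_div, abs_of_pos hc, Real.div_rpow (abs_nonneg _) hc.le]

lemma luxNormW_nonneg : 0 ≤ luxNormW w r u := Real.sInf_nonneg fun _ hc => hc.1.le

lemma luxNormW_le {c : ℝ} (hc : 0 < c) (h : ∫ x, w x * |u x / c| ^ r x ≤ 1) :
    luxNormW w r u ≤ c := csInf_le ⟨0, fun _ hc => hc.1.le⟩ ⟨hc, h⟩

/-- For exponents at least one, dividing by `C * c` with `1 ≤ C` divides the modular by `C`. -/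
lemma integral_mul_abs_div_rpow_le {C c : ℝ} (hC : 1 ≤ C) (hr : ∀ x, 1 ≤ r x)
    (hw : ∀ᵐ x ∂(volume : Measure (EuclideanSpace ℝ (Fin N))), 0 ≤ w x)
    (hi : Integrable (fun x => w x * |u x / c| ^ r x) volume) :
    ∫ x, w x * |u x / (C * c)| ^ r x ≤ (∫ x, w x * |u x / c| ^ r x) / C := by
  have hC0 : 0 < C := by linarith
  rw [← integral_div]
  refine integral_mono_of_nonneg ?_ (hi.div_const C) ?_
  · filter_upwards [hw] with x hx using mul_nonneg hx (Real.rpow_nonneg (abs_nonneg _) _)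
  · filter_upwards [hw] with x hx
    rw [mul_comm C c, ← div_div, abs_div_rpow_eq hC0, mul_div_assoc]
    refine mul_le_mul_of_nonneg_left ?_ hx
    exact div_le_div_of_nonneg_left (Real.rpow_nonneg (abs_nonneg _) _) hC0
      (Real.self_le_rpow_of_one_le hC (hr x))

/-- The modular is at most one at every scale above the Luxemburg norm. -/
lemma integral_le_one_of_luxNormW_lt {c : ℝ} (hr : ∀ x, 1 ≤ r x)
    (hw : ∀ᵐ x ∂(volume : Measure (EuclideanSpace ℝ (Fin N))), 0 ≤ w x)
    (hi : ∀ c : ℝ, Integrable (fun x => w x * |u x / c| ^ r x) volume)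
    (hc : luxNormW w r u < c) : ∫ x, w x * |u x / c| ^ r x ≤ 1 := by
  have hne : {c : ℝ | 0 < c ∧ ∫ x, w x * |u x / c| ^ r x ≤ 1}.Nonempty := by
    have hm : 1 ≤ max 1 (∫ x, w x * |u x / 1| ^ r x) := le_max_left _ _
    refine ⟨max 1 (∫ x, w x * |u x / 1| ^ r x) * 1, by linarith, ?_⟩
    refine (integral_mul_abs_div_rpow_le hm hr hw (hi 1)).trans ?_
    exact (div_le_one (by linarith)).2 (le_max_right _ _)
  obtain ⟨d, ⟨hd0, hd⟩, hdc⟩ := exists_lt_of_csInf_lt hne hc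
  have hC : 1 ≤ c / d := (one_le_div hd0).2 hdc.le
  have h := integral_mul_abs_div_rpow_le hC hr hw (hi d)
  rw [div_mul_cancel₀ _ hd0.ne'] at h
  exact h.trans ((div_le_one (by linarith)).2 (hd.trans hC))

end Luxemburg

/-- Continuous imbedding `X ↪ L^{p*(x)}(ℝ^N)` under condition (𝒫):
`|u|_{L^{p*(x)}(ℝ^N)} ≤ C ‖u‖` for all `u ∈ C_c^∞(ℝ^N)`. -/
theorem imbedding_X_into_Lpstar
    (N : ℕ) (p V : EuclideanSpace ℝ (Fin N) → ℝ) (hP : CondP N p V) :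
    ∃ C : ℝ, 0 < C ∧
      ∀ u : EuclideanSpace ℝ (Fin N) → ℝ, ContDiff ℝ (⊤ : ℕ∞) u → HasCompactSupport u →
        luxNormW (fun _ => 1) (pstar N p) u ≤ C * sobNorm p V u := by
  obtain ⟨C, hC1, hC⟩ := hP.exists_integral_pstar_le
  have hp1 : ∀ x, 1 ≤ p x := fun x => (hP.one_lt x).le
  refine ⟨C, by linarith, fun u hu huc => ?_⟩
  have hu1 : ContDiff ℝ 1 u := hu.of_le (by exact_mod_cast le_top)
  have hgc : Continuous fun x => ‖fderiv ℝ u x‖ := (hu1.continuous_fderiv one_ne_zero).norm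
  have hgcs : HasCompactSupport fun x => ‖fderiv ℝ u x‖ := (huc.fderiv (𝕜 := ℝ)).norm
  have hdivc : ∀ {f : EuclideanSpace ℝ (Fin N) → ℝ}, HasCompactSupport f → ∀ c : ℝ,
      HasCompactSupport fun x => f x / c := fun hf c =>
    hf.comp_left (g := fun t : ℝ => t / c) (zero_div c)
  rw [sobNorm]
  set n₁ := luxNormW (fun _ => 1) p fun x => ‖fderiv ℝ u x‖
  set n₂ := luxNormW V p u
  have hn₁ : 0 ≤ n₁ := luxNormW_nonneg
  have hn₂ : 0 ≤ n₂ := luxNormW_nonneg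
  have hC0 : 0 < C := by linarith
  rw [← div_le_iff₀' hC0]
  refine le_of_forall_gt_imp_ge_of_dense fun c hc => ?_
  have hc0 : 0 < c := by linarith
  rw [div_le_iff₀' hC0]
  have hgrad : ∫ x, 1 * |‖fderiv ℝ u x‖ / c| ^ p x ≤ 1 :=
    integral_le_one_of_luxNormW_lt (w := fun _ => 1) (u := fun x => ‖fderiv ℝ u x‖) hp1
      (ae_of_all _ fun _ => zero_le_one) (fun d => by
        simp only [one_mul]
        exact integrable_abs_rpow hP.continuous (fun x => by linarith [hp1 x])
          (hgc.div_const d) (hdivc hgcs d)) (by linarith : n₁ < c)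
  have hmod : ∫ x, V x * |u x / c| ^ p x ≤ 1 :=
    integral_le_one_of_luxNormW_lt hp1 (hP.Vpos.mono fun x hx => hx.le)
      (fun d => hP.integrable_mul_abs_rpow (hu.continuous.div_const d) (hdivc huc d))
      (by linarith : n₂ < c)
  have hder : ∀ x, ‖fderiv ℝ (fun x => u x / c) x‖ = |‖fderiv ℝ u x‖ / c| := fun x => by
    have h1 : fderiv ℝ (fun x => u x / c) x = c⁻¹ • fderiv ℝ u x := by
      simp only [div_eq_inv_mul]
      exact fderiv_const_mul (hu1.differentiable one_ne_zero x) _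
    rw [h1, norm_smul, Real.norm_of_nonneg (by positivity), abs_of_nonneg (by positivity),
      div_eq_inv_mul]
  have hstar : ∫ x, |u x / c| ^ pstar N p x ≤ C := by
    refine hC _ (hu1.div_const c) (hdivc huc c) ?_ hmod
    simpa only [hder, one_mul] using hgrad
  have hps1 : ∀ x, 1 ≤ pstar N p x := fun x => (hp1 x).trans (hP.le_pstar x)
  refine luxNormW_le (by positivity) ?_
  refine (integral_mul_abs_div_rpow_le (w := fun _ => 1) hC1 hps1
    (ae_of_all _ fun _ => zero_le_one) ?_).trans ?_
  · simp only [one_mul]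
    exact integrable_abs_rpow hP.continuous_pstar (fun x => by linarith [hps1 x])
      (hu.continuous.div_const c) (hdivc huc c)
  · simp only [one_mul]
    exact (div_le_one hC0).2 hstar
end

section
/- Assume conditions (𝒫) and (𝒮). Then there exists a constant C > 0 such that |u|_{L^{r(x)}(a,ℝ^N)} ≤ C ‖u‖ for all u ∈ C_c^∞(ℝ^N); since the space X is defined as the closure of C_c^∞(ℝ^N) in the weighted Sobolev norm ‖·‖, this is precisely the continuous imbedding X ↪ L^{r(x)}(a,ℝ^N). -/
open MeasureTheory Filter Topology

open Set Function in
/-- A nonnegative compactly supported function on the line is bounded by the integral of any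
continuous bound on its pointwise Lipschitz constants. -/
lemma ofReal_le_lintegral_of_pointwise_lipschitz {f F : ℝ → ℝ} (hf : Continuous f)
    (hF : Continuous F) (hF0 : ∀ x, 0 ≤ F x) (hfc : HasCompactSupport f)
    (h : ∀ x, ∀ r > F x, ∀ᶠ y in 𝓝 x, |f y - f x| ≤ r * |y - x|) (x : ℝ) :
    ENNReal.ofReal (f x) ≤ ∫⁻ t, ENNReal.ofReal (F t) := by
  obtain ⟨a, hax, ha⟩ : ∃ a ≤ x, f a = 0 := by
    have h0 : ∀ᶠ y in cocompact ℝ, f y = 0 := by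
      have := hfc.isCompact.compl_mem_cocompact
      filter_upwards [this] with y hy
      exact image_eq_zero_of_notMem_tsupport hy
    have h1 : ∀ᶠ y in atBot, f y = 0 := atBot_le_cocompact h0
    obtain ⟨a, h2, h3⟩ := (h1.and (eventually_le_atBot x)).exists
    exact ⟨a, h3, h2⟩
  have key : f x ≤ ∫ t in a..x, F t := by
    refine image_le_of_liminf_slope_right_le_deriv_boundary (f := f) (a := a) (b := x)
      (B := fun y => ∫ t in a..y, F t) (B' := F) hf.continuousOn (by simp [ha])
      ?_ ?_ ?_ (right_mem_Icc.2 hax)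
    · exact fun y _ => (hF.integral_hasStrictDerivAt a y).hasDerivAt.continuousAt.continuousWithinAt
    · exact fun y _ => (hF.integral_hasStrictDerivAt a y).hasDerivAt.hasDerivWithinAt
    · intro y _ r hr
      obtain ⟨s, hs1, hs2⟩ := exists_between hr
      refine Eventually.frequently ?_
      filter_upwards [(h y s hs1).filter_mono nhdsWithin_le_nhds, self_mem_nhdsWithin] with z hz hyz
      have hyz' : 0 < z - y := sub_pos.2 hyz
      rw [abs_of_pos hyz'] at hz
      rw [slope_def_field, div_lt_iff₀ hyz']
      exact (le_abs_self _).trans_lt (hz.trans_lt (by gcongr))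
  calc ENNReal.ofReal (f x) ≤ ENNReal.ofReal (∫ t in a..x, F t) := ENNReal.ofReal_le_ofReal key
    _ = ∫⁻ t in Ioc a x, ENNReal.ofReal (F t) := by
      rw [intervalIntegral.integral_of_le hax, ofReal_integral_eq_lintegral_ofReal]
      · exact (hF.integrableOn_Icc (a := a) (b := x)).mono_set Ioc_subset_Icc_self
      · exact Eventually.of_forall hF0
    _ ≤ _ := setLIntegral_le_lintegral _ _

/-- The Gagliardo-Nirenberg-Sobolev inequality for functions controlled through their pointwise
Lipschitz constants. -/
lemma lintegral_rpow_le_of_pointwise_lipschitz {N : ℕ} {q : ℝ} (hq : Real.HolderConjugate N q)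
    {f F : EuclideanSpace ℝ (Fin N) → ℝ} (hf : Continuous f) (hF : Continuous F)
    (hF0 : ∀ x, 0 ≤ F x) (hfc : HasCompactSupport f)
    (h : ∀ x, ∀ r > F x, ∀ᶠ y in 𝓝 x, |f y - f x| ≤ r * ‖y - x‖) :
    ∫⁻ x, ENNReal.ofReal (f x) ^ q ≤ (∫⁻ x, ENNReal.ofReal (F x)) ^ q := by
  have hN : (1 : ℝ) ≤ N - 1 := by
    have : (2 : ℝ) ≤ N := by exact_mod_cast hq.lt
    linarith
  have e := PiLp.volume_preserving_toLp (Fin N)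
  have hcont : Continuous (WithLp.toLp 2 : (Fin N → ℝ) → EuclideanSpace ℝ (Fin N)) :=
    PiLp.continuous_toLp 2 _
  rw [← e.lintegral_comp (by fun_prop), ← e.lintegral_comp (by fun_prop)]
  have hq' : Real.HolderConjugate (Fintype.card (Fin N)) q := by simpa using hq
  refine le_trans ?_ (lintegral_prod_lintegral_pow_le (fun _ : Fin N => (volume : Measure ℝ)) hq'
    (f := fun x => ENNReal.ofReal (F (WithLp.toLp 2 x))) (by fun_prop))
  refine lintegral_mono fun x => ?_
  calc ENNReal.ofReal (f (WithLp.toLp 2 x)) ^ q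
      = ∏ _i : Fin N, ENNReal.ofReal (f (WithLp.toLp 2 x)) ^ (1 / (N - 1 : ℝ)) := by
        rw [Finset.prod_const, Finset.card_univ, Fintype.card_fin, ← ENNReal.rpow_natCast,
          ← ENNReal.rpow_mul, hq.conjugate_eq]
        congr 1
        field_simp
    _ ≤ _ := by
        simp only [Fintype.card_fin]
        refine Finset.prod_le_prod' fun i _ => ?_
        refine ENNReal.rpow_le_rpow ?_ (by positivity)
        have hline : Continuous fun t : ℝ => WithLp.toLp 2 (Function.update x i t) := by
          fun_prop
        have hnorm : ∀ s t : ℝ, ‖(WithLp.toLp 2 (Function.update x i s) :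
            EuclideanSpace ℝ (Fin N)) - WithLp.toLp 2 (Function.update x i t)‖ = |s - t| := by
          intro s t
          have : (WithLp.toLp 2 (Function.update x i s) : EuclideanSpace ℝ (Fin N))
              - WithLp.toLp 2 (Function.update x i t) = EuclideanSpace.single i (s - t) := by
            ext j
            by_cases hj : j = i
            · subst hj; simp
            · simp [hj]
          rw [this]; simp
        have := ofReal_le_lintegral_of_pointwise_lipschitz
          (f := fun t => f (WithLp.toLp 2 (Function.update x i t)))
          (F := fun t => F (WithLp.toLp 2 (Function.update x i t)))
          (hf.comp hline) (hF.comp hline) (fun _ => hF0 _) ?_ ?_ (x i)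
        · simpa using this
        · refine hfc.comp_isClosedEmbedding (g := fun t => WithLp.toLp 2 (Function.update x i t)) ?_
          refine Isometry.isClosedEmbedding (Isometry.of_dist_eq fun s t => ?_)
          rw [dist_eq_norm, hnorm, Real.dist_eq]
        · intro t r hr
          filter_upwards [hline.continuousAt.eventually (h _ r hr)] with s hs
          simpa only [hnorm] using hs

lemma integrable_of_continuous_of_eq_zero {N : ℕ} {Y : Type*} [Zero Y]
    {u : EuclideanSpace ℝ (Fin N) → Y} (hu : HasCompactSupport u)
    {g : EuclideanSpace ℝ (Fin N) → ℝ} (hg : Continuous g) (h : ∀ x, u x = 0 → g x = 0) :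
    Integrable g := by
  refine hg.integrable_of_hasCompactSupport (hu.mono fun x hx => ?_)
  exact fun h0 => hx (h x h0)

/-- Bochner-integral form of `lintegral_rpow_le_of_pointwise_lipschitz`. -/
lemma integral_rpow_le_of_pointwise_lipschitz {N : ℕ} {q : ℝ} (hq : Real.HolderConjugate N q)
    {f F : EuclideanSpace ℝ (Fin N) → ℝ} (hf : Continuous f) (hf0 : ∀ x, 0 ≤ f x)
    (hF : Continuous F) (hF0 : ∀ x, 0 ≤ F x) (hfc : HasCompactSupport f) (hFi : Integrable F)
    (h : ∀ x, ∀ r > F x, ∀ᶠ y in 𝓝 x, |f y - f x| ≤ r * ‖y - x‖) :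
    ∫ x, f x ^ q ≤ (∫ x, F x) ^ q := by
  have hq0 : 0 < q := hq.symm.pos
  have key := lintegral_rpow_le_of_pointwise_lipschitz hq hf hF hF0 hfc h
  rw [← ofReal_integral_eq_lintegral_ofReal hFi (Eventually.of_forall hF0),
    ENNReal.ofReal_rpow_of_nonneg (integral_nonneg hF0) hq0.le] at key
  have hfq : Continuous fun x => f x ^ q := hf.rpow_const fun x => Or.inr hq0.le
  rw [integral_eq_lintegral_of_nonneg_ae (Eventually.of_forall fun x => by
    have := hf0 x; positivity) hfq.aestronglyMeasurable]
  refine ENNReal.toReal_le_of_le_ofReal (Real.rpow_nonneg (integral_nonneg hF0) _) ?_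
  simpa only [ENNReal.ofReal_rpow_of_nonneg (hf0 _) hq0.le] using key

/-- Pointwise Lipschitz bound for a variable power of a nonnegative function. -/
lemma pointwise_lipschitz_rpow {E : Type*} [NormedAddCommGroup E] {g κ G : E → ℝ} {K : ℝ}
    (hg : Continuous g) (hg0 : ∀ x, 0 ≤ g x) (hκ : Continuous κ) (hκ1 : ∀ x, 1 < κ x)
    (hK : ∀ x y, |κ y - κ x| ≤ K * ‖y - x‖)
    (h : ∀ x, ∀ r > G x, ∀ᶠ y in 𝓝 x, |g y - g x| ≤ r * ‖y - x‖) (x : E) (r : ℝ)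
    (hr : g x ^ (κ x - 1) * (κ x * G x + |g x * Real.log (g x)| * K) < r) :
    ∀ᶠ y in 𝓝 x, |g y ^ κ y - g x ^ κ x| ≤ r * ‖y - x‖ := by
  rcases (hg0 x).eq_or_lt with h0 | h0
  · rw [← h0, Real.zero_rpow (by linarith [hκ1 x]), zero_mul] at hr
    obtain ⟨k, hk1, hk2⟩ := exists_between (hκ1 x)
    have hlim : Tendsto (fun y => (G x + 1) * g y ^ (k - 1)) (𝓝 x) (𝓝 0) := by
      have : Continuous fun y => (G x + 1) * g y ^ (k - 1) :=
        continuous_const.mul (hg.rpow_const fun _ => Or.inr (by linarith))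
      simpa [← h0, Real.zero_rpow (sub_ne_zero.2 hk1.ne')] using this.tendsto x
    filter_upwards [h x (G x + 1) (lt_add_one _), hκ.continuousAt.eventually (lt_mem_nhds hk2),
      hg.continuousAt.eventually (gt_mem_nhds (show g x < 1 by rw [← h0]; norm_num)),
      hlim.eventually (gt_mem_nhds hr)] with y h1 h2 h3 h4
    rw [← h0, sub_zero, abs_of_nonneg (hg0 y)] at h1
    rw [← h0, Real.zero_rpow (by linarith [hκ1 x]), sub_zero,
      abs_of_nonneg (Real.rpow_nonneg (hg0 y) _)]
    calc g y ^ κ y ≤ g y ^ k :=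
          Real.rpow_le_rpow_of_exponent_ge_of_imp (hg0 y) h3.le h2.le (fun _ h => by linarith)
      _ = g y * g y ^ (k - 1) := by
          conv_rhs => rw [← Real.rpow_one_add' (hg0 y) (by linarith)]
          congr 1; ring
      _ ≤ (G x + 1) * ‖y - x‖ * g y ^ (k - 1) := by
          gcongr; exact Real.rpow_nonneg (hg0 y) _
      _ = (G x + 1) * g y ^ (k - 1) * ‖y - x‖ := by ring
      _ ≤ r * ‖y - x‖ := by gcongr
  · have hκ0 : 0 < κ x := by linarith [hκ1 x]
    set A := κ x * g x ^ (κ x - 1) with hA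
    set B := |g x ^ κ x * Real.log (g x)| with hB
    have hA0 : 0 ≤ A := by positivity
    have hB0 : 0 ≤ B := abs_nonneg _
    have hr' : A * G x + B * K < r := by
      refine lt_of_eq_of_lt ?_ hr
      have : g x ^ κ x = g x ^ (κ x - 1) * g x := by
        rw [← Real.rpow_add_one h0.ne']; simp
      rw [hA, hB, this, mul_assoc (g x ^ (κ x - 1)) (g x), abs_mul,
        abs_of_pos (Real.rpow_pos_of_pos h0 _)]
      ring
    obtain ⟨c, hc, hc0⟩ : ∃ c, (A + c) * (G x + c) + (B + c) * K < r ∧ 0 < c := by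
      have hcont : Continuous fun c : ℝ => (A + c) * (G x + c) + (B + c) * K := by fun_prop
      have := (hcont.tendsto 0).eventually (Iio_mem_nhds (show _ < r by simpa using hr'))
      have h2 : ∀ᶠ c in 𝓝[>] (0 : ℝ), (A + c) * (G x + c) + (B + c) * K < r :=
        this.filter_mono nhdsWithin_le_nhds
      exact (h2.and self_mem_nhdsWithin).exists
    have hd := (Real.hasStrictFDerivAt_rpow_of_pos (g x, κ x) h0).hasFDerivAt.isLittleO.def hc0
    have hpair : Tendsto (fun y => (g y, κ y)) (𝓝 x) (𝓝 (g x, κ x)) := (hg.prodMk hκ).tendsto x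
    filter_upwards [hpair.eventually hd, h x (G x + c) (lt_add_of_pos_right _ hc0)] with y h1 h2
    have h3 := hK x y
    simp only [Real.norm_eq_abs, _root_.add_apply, _root_.smul_apply,
      ContinuousLinearMap.coe_fst', ContinuousLinearMap.coe_snd', smul_eq_mul, Prod.fst_sub,
      Prod.snd_sub] at h1
    have h4 : ‖((g y, κ y) : ℝ × ℝ) - (g x, κ x)‖ ≤ |g y - g x| + |κ y - κ x| := by
      simp only [Prod.norm_def, Prod.fst_sub, Prod.snd_sub, Real.norm_eq_abs]
      exact max_le (le_add_of_nonneg_right (abs_nonneg _)) (le_add_of_nonneg_left (abs_nonneg _))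
    have h5 : |κ x * g x ^ (κ x - 1) * (g y - g x) + g x ^ κ x * Real.log (g x) * (κ y - κ x)|
        ≤ A * |g y - g x| + B * |κ y - κ x| := by
      refine (abs_add_le _ _).trans (le_of_eq ?_)
      rw [abs_mul, abs_mul (_ * Real.log _), abs_of_nonneg hA0]
    have h6 := abs_sub_abs_le_abs_sub (g y ^ κ y - g x ^ κ x)
      (κ x * g x ^ (κ x - 1) * (g y - g x) + g x ^ κ x * Real.log (g x) * (κ y - κ x))
    have h7 := mul_le_mul_of_nonneg_left h4 hc0.le
    calc |g y ^ κ y - g x ^ κ x| ≤ (A + c) * |g y - g x| + (B + c) * |κ y - κ x| := by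
          linarith
      _ ≤ (A + c) * ((G x + c) * ‖y - x‖) + (B + c) * (K * ‖y - x‖) := by gcongr
      _ = ((A + c) * (G x + c) + (B + c) * K) * ‖y - x‖ := by ring
      _ ≤ r * ‖y - x‖ := by gcongr

/-- A function that varies less than `u` inherits `‖fderiv ℝ u‖` as a pointwise Lipschitz bound. -/
lemma pointwise_lipschitz_of_abs_sub_le {E : Type*} [NormedAddCommGroup E] [NormedSpace ℝ E]
    {u g : E → ℝ} (hu : Differentiable ℝ u) (hg : ∀ x y, |g y - g x| ≤ |u y - u x|)
    (x : E) (r : ℝ) (hr : ‖fderiv ℝ u x‖ < r) :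
    ∀ᶠ y in 𝓝 x, |g y - g x| ≤ r * ‖y - x‖ := by
  have hd := (hu x).hasFDerivAt.isLittleO.def (sub_pos.2 hr)
  filter_upwards [hd] with y hy
  rw [Real.norm_eq_abs] at hy
  have h1 := (fderiv ℝ u x).le_opNorm (y - x)
  rw [Real.norm_eq_abs] at h1
  have h2 := abs_sub_abs_le_abs_sub (u y - u x) (fderiv ℝ u x (y - x))
  linarith [hg x y]

/-- Young's inequality with a small factor, uniform for exponents in `(1, Q]`. -/
lemma mul_le_rpow_conj_add_rpow {a b q Q η : ℝ} (ha : 0 ≤ a) (hb : 0 ≤ b) (hq : 1 < q)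
    (hqQ : q ≤ Q) (hη : 0 < η) (hη1 : η ≤ 1) :
    a * b ≤ η * a ^ (q / (q - 1)) + η ^ (-Q) * b ^ q := by
  have hc : (q / (q - 1)).HolderConjugate q := (Real.HolderConjugate.conjExponent hq).symm
  have h := Real.young_inequality_of_nonneg (a := η * a) (b := b / η) (by positivity)
    (by positivity) hc
  have e : η * a * (b / η) = a * b := by field_simp
  rw [e] at h
  have hc1 : 1 < q / (q - 1) := hc.lt
  refine h.trans (add_le_add ?_ ?_)
  · refine (div_le_self (by positivity) hc1.le).trans ?_
    rw [Real.mul_rpow hη.le ha]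
    gcongr
    simpa using Real.rpow_le_rpow_of_exponent_ge hη hη1 hc1.le
  · refine (div_le_self (by positivity) hq.le).trans ?_
    rw [Real.div_rpow hb hη.le, div_eq_inv_mul, ← Real.rpow_neg hη.le]
    exact mul_le_mul_of_nonneg_right
      (Real.rpow_le_rpow_of_exponent_ge hη hη1 (by linarith)) (by positivity)

/-- Comparison of powers whose exponents are close, at the rate of the log-Hölder decay. -/
lemma exists_rpow_le_mul_rpow_add_decay {α₀ m l : ℝ} (C : ℝ) (hα₀ : 0 < α₀) (hm : 0 < m)
    (hl : 0 < l) :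
    ∃ K : ℝ, 0 < K ∧ ∀ t s α β : ℝ, 0 ≤ t → 0 ≤ s → s ≤ 1 → α₀ ≤ α →
      |α - β| ≤ C / Real.log (Real.exp 1 + t) → s ^ α ≤ K * s ^ β + l * (1 + t) ^ (-m) := by
  set l' := min l 1 with hl'
  have hl'0 : 0 < l' := lt_min hl one_pos
  refine ⟨Real.exp (C / α₀ * (m - Real.log l')), Real.exp_pos _, ?_⟩
  intro t s α β ht hs0 hs1 hα hαβ
  have hh : 0 < (1 + t) ^ (-m) := by positivity
  have hL1 : 1 ≤ Real.log (Real.exp 1 + t) := by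
    rw [Real.le_log_iff_exp_le (by positivity)]; linarith
  have hL0 : 0 < Real.log (Real.exp 1 + t) := by linarith
  have hLt : Real.log (1 + t) ≤ Real.log (Real.exp 1 + t) :=
    Real.log_le_log (by linarith) (by linarith [Real.one_le_exp (zero_le_one (α := ℝ))])
  have hC : 0 ≤ C := by
    have := (abs_nonneg _).trans hαβ
    rw [le_div_iff₀ hL0] at this
    linarith
  rcases le_total (s ^ α₀) (l' * (1 + t) ^ (-m)) with h | h
  · have h1 : s ^ α ≤ s ^ α₀ :=
      Real.rpow_le_rpow_of_exponent_ge_of_imp hs0 hs1 hα (fun _ h => by linarith)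
    have h2 : l' * (1 + t) ^ (-m) ≤ l * (1 + t) ^ (-m) := by gcongr; exact min_le_left _ _
    have h3 : 0 ≤ Real.exp (C / α₀ * (m - Real.log l')) * s ^ β := by positivity
    linarith
  · have hs : 0 < s := by
      rcases hs0.eq_or_lt with h0 | h0
      · rw [← h0, Real.zero_rpow hα₀.ne'] at h
        have : 0 < l' * (1 + t) ^ (-m) := by positivity
        linarith
      · exact h0
    have hlog : Real.log l' - m * Real.log (1 + t) ≤ α₀ * Real.log s := by
      have := Real.log_le_log (by positivity) h
      rwa [Real.log_mul hl'0.ne' hh.ne', Real.log_rpow (by linarith), Real.log_rpow hs,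
        neg_mul, ← sub_eq_add_neg] at this
    have hls : Real.log s ≤ 0 := Real.log_nonpos hs0 hs1
    have hll : Real.log l' ≤ 0 := Real.log_nonpos hl'0.le (min_le_right _ _)
    have key : Real.log s * (α - β) ≤ C / α₀ * (m - Real.log l') := by
      set L := Real.log (Real.exp 1 + t)
      have h1 : Real.log s * (α - β) ≤ -Real.log s * (C / L) := by
        have := neg_abs_le (α - β)
        nlinarith
      have h2 : -Real.log s ≤ (m * Real.log (1 + t) - Real.log l') / α₀ := by
        rw [le_div_iff₀ hα₀]; linarith
      have h3 : m * Real.log (1 + t) - Real.log l' ≤ L * (m - Real.log l') := by nlinarith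
      calc Real.log s * (α - β) ≤ -Real.log s * (C / L) := h1
        _ ≤ (L * (m - Real.log l')) / α₀ * (C / L) := by
            gcongr
            exact h2.trans (by gcongr)
        _ = C / α₀ * (m - Real.log l') := by field_simp
    have : s ^ α = s ^ (α - β) * s ^ β := by rw [← Real.rpow_add hs]; simp
    rw [this, Real.rpow_def_of_pos hs (α - β)]
    have h1 : Real.exp (Real.log s * (α - β)) * s ^ β
        ≤ Real.exp (C / α₀ * (m - Real.log l')) * s ^ β := by gcongr
    have h2 : 0 ≤ l * (1 + t) ^ (-m) := by positivity
    linarith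

/-- The logarithm is absorbed by a gap between the exponents. -/
lemma exists_rpow_mul_abs_log_le {g κM ε : ℝ} (hg : 0 < g) (hε : 0 < ε) :
    ∃ C : ℝ, 0 < C ∧ ∀ v κ Γ : ℝ, 0 ≤ v → 1 ≤ κ → κ ≤ κM → κ + g ≤ Γ →
      v ^ κ * |Real.log v| ≤ ε * v ^ Γ + C := by
  obtain ⟨R, hR⟩ := eventually_atTop.1 ((isLittleO_log_rpow_atTop hg).def hε)
  set R' := max R 1
  have hR'1 : 1 ≤ R' := le_max_right _ _
  refine ⟨R' ^ κM * R' + 1, by positivity, ?_⟩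
  intro v κ Γ hv hκ hκM hΓ
  have hA : 0 ≤ ε * v ^ Γ := by positivity
  have hB : 0 ≤ R' ^ κM * R' := by positivity
  rcases le_total v 1 with h1 | h1
  · rcases hv.eq_or_lt with h0 | h0
    · rw [← h0] at hA ⊢
      simp only [Real.log_zero, abs_zero, mul_zero]
      linarith
    · have h2 := Real.abs_log_mul_self_lt v h0 h1
      rw [abs_mul, abs_of_pos h0] at h2
      have h3 : v ^ κ ≤ v := by simpa using Real.rpow_le_rpow_of_exponent_ge h0 h1 hκ
      have h4 := mul_le_mul_of_nonneg_right h3 (abs_nonneg (Real.log v))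
      linarith
  · have hlog : 0 ≤ Real.log v := Real.log_nonneg h1
    rw [abs_of_nonneg hlog]
    rcases le_total R' v with h2 | h2
    · have h3 := hR v ((le_max_left _ _).trans h2)
      rw [Real.norm_eq_abs, Real.norm_eq_abs, abs_of_nonneg hlog, abs_of_nonneg (by positivity)]
        at h3
      have h4 : v ^ κ * Real.log v ≤ ε * v ^ Γ := by
        calc v ^ κ * Real.log v ≤ v ^ κ * (ε * v ^ g) := by gcongr
          _ = ε * v ^ (κ + g) := by rw [Real.rpow_add (by linarith)]; ring
          _ ≤ ε * v ^ Γ := by gcongr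
      linarith
    · have h3 : v ^ κ ≤ R' ^ κM :=
        (Real.rpow_le_rpow hv h2 (by linarith)).trans
          (Real.rpow_le_rpow_of_exponent_le hR'1 hκM)
      have h4 : Real.log v ≤ R' := (Real.log_le_self hv).trans h2
      have : v ^ κ * Real.log v ≤ R' ^ κM * R' := by gcongr
      linarith

/-- The exponent `t (n - 1) / (n - t)`, whose product with `n / (n - 1)` is the critical Sobolev
exponent. -/
noncomputable def sobolevTestExponent (n t : ℝ) : ℝ := t * (n - 1) / (n - t)

section TestExponent

variable {n t : ℝ}

lemma sobolevTestExponent_mul (h1 : 1 < t) (hn : t < n) :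
    sobolevTestExponent n t * (n / (n - 1)) = n * t / (n - t) := by
  have : n - 1 ≠ 0 := by linarith
  have : n - t ≠ 0 := by linarith
  unfold sobolevTestExponent
  field_simp

lemma sobolevTestExponent_sub_one_mul (h1 : 1 < t) (hn : t < n) :
    (sobolevTestExponent n t - 1) * (t / (t - 1)) = n * t / (n - t) := by
  have : t - 1 ≠ 0 := by linarith
  have : n - t ≠ 0 := by linarith
  unfold sobolevTestExponent
  field_simp
  ring

lemma one_lt_sobolevTestExponent (h1 : 1 < t) (hn : t < n) : 1 < sobolevTestExponent n t := by
  unfold sobolevTestExponent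
  rw [one_lt_div (by linarith)]
  nlinarith

lemma sobolevTestExponent_add_inv_le (h1 : 1 < t) (hn : t < n) :
    sobolevTestExponent n t + 1 / n ≤ n * t / (n - t) := by
  have h2 : 1 / n ≤ t / (n - t) := by
    rw [div_le_div_iff₀ (by linarith) (by linarith)]
    nlinarith
  have h3 : n * t / (n - t) = sobolevTestExponent n t + t / (n - t) := by
    unfold sobolevTestExponent
    rw [← add_div]
    ring
  linarith

lemma sobolevTestExponent_mono {s : ℝ} (h1 : 1 < t) (hts : t ≤ s) (hn : s < n) :
    sobolevTestExponent n t ≤ sobolevTestExponent n s := by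
  unfold sobolevTestExponent
  have h2 : 0 < n - s := by linarith
  have h3 : 0 ≤ n - 1 := by linarith
  have h4 : 0 ≤ s := by linarith
  gcongr

lemma abs_sobolevTestExponent_sub_le {s M : ℝ} (hn1 : 1 < n) (hs : s ≤ M) (ht : t ≤ M)
    (hM : M < n) :
    |sobolevTestExponent n s - sobolevTestExponent n t| ≤ n * (n - 1) / (n - M) ^ 2 * |s - t| := by
  have hs' : 0 < n - s := by linarith
  have ht' : 0 < n - t := by linarith
  have hM' : 0 < n - M := by linarith
  have hn' : 0 < n - 1 := by linarith
  have e : sobolevTestExponent n s - sobolevTestExponent n t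
      = n * (n - 1) / ((n - s) * (n - t)) * (s - t) := by
    unfold sobolevTestExponent
    field_simp
    ring
  rw [e, abs_mul, abs_of_nonneg (by positivity), pow_two]
  gcongr

end TestExponent

/-- Lipschitz exponents with values in `[pm, pM] ⊆ (1, N)`. -/
structure IsLipExponent (N : ℕ) (p : EuclideanSpace ℝ (Fin N) → ℝ) (pm pM K : ℝ) : Prop where
  one_lt : 1 < pm
  ge : ∀ x, pm ≤ p x
  le : ∀ x, p x ≤ pM
  lt : pM < N
  nonneg : 0 ≤ K
  lip : ∀ x y, |p y - p x| ≤ K * ‖y - x‖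

namespace IsLipExponent

variable {N : ℕ} {p : EuclideanSpace ℝ (Fin N) → ℝ} {pm pM K : ℝ}

lemma one_lt_apply (h : IsLipExponent N p pm pM K) (x) : 1 < p x := h.one_lt.trans_le (h.ge x)

lemma apply_lt (h : IsLipExponent N p pm pM K) (x) : p x < N := (h.le x).trans_lt h.lt

lemma one_lt_dim (h : IsLipExponent N p pm pM K) : (1 : ℝ) < N :=
  (h.one_lt_apply 0).trans (h.apply_lt 0)

lemma continuous (h : IsLipExponent N p pm pM K) : Continuous p := by
  refine (LipschitzWith.of_dist_le_mul (K := ⟨K, h.nonneg⟩) fun x y => ?_).continuous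
  rw [Real.dist_eq, dist_eq_norm]
  exact h.lip y x

lemma continuous_testExponent (h : IsLipExponent N p pm pM K) :
    Continuous fun x => sobolevTestExponent N (p x) := by
  unfold sobolevTestExponent
  exact (h.continuous.mul continuous_const).div (continuous_const.sub h.continuous)
    fun x => by linarith [h.apply_lt x]

lemma continuous_pstar (h : IsLipExponent N p pm pM K) : Continuous (pstar N p) := by
  unfold pstar
  exact (continuous_const.mul h.continuous).div (continuous_const.sub h.continuous)
    fun x => by linarith [h.apply_lt x]

lemma one_lt_pstar (h : IsLipExponent N p pm pM K) (x) : 1 < pstar N p x := by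
  have h1 := one_lt_sobolevTestExponent (h.one_lt_apply x) (h.apply_lt x)
  have h2 := sobolevTestExponent_add_inv_le (h.one_lt_apply x) (h.apply_lt x)
  have h3 : (0 : ℝ) < 1 / N := by have := h.one_lt_dim; positivity
  unfold pstar
  linarith

lemma le_pstar (h : IsLipExponent N p pm pM K) (x) : p x ≤ pstar N p x := by
  unfold pstar
  rw [le_div_iff₀ (by linarith [h.apply_lt x])]
  nlinarith [h.one_lt_apply x]

lemma pstar_le (h : IsLipExponent N p pm pM K) (x) : pstar N p x ≤ N * pM / (N - pM) := by
  unfold pstar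
  have h1 : 0 < N - pM := by linarith [h.lt]
  have h2 := h.le x
  have h3 : 0 ≤ pM := by linarith [h.one_lt_apply x]
  gcongr

lemma holderConjugate (h : IsLipExponent N p pm pM K) :
    Real.HolderConjugate N ((N : ℝ) / (N - 1)) :=
  Real.HolderConjugate.conjExponent h.one_lt_dim

lemma integrable_gradient (h : IsLipExponent N p pm pM K) {u : EuclideanSpace ℝ (Fin N) → ℝ}
    (hu : ContDiff ℝ 1 u) (hc : HasCompactSupport u) :
    Integrable fun x => ‖fderiv ℝ u x‖ ^ p x := by
  refine integrable_of_continuous_of_eq_zero (hc.fderiv (𝕜 := ℝ)) ?_ ?_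
  · exact (hu.continuous_fderiv one_ne_zero).norm.rpow h.continuous
      fun x => Or.inr (by linarith [h.one_lt_apply x])
  · intro x hx
    simp [hx, Real.zero_rpow (by linarith [h.one_lt_apply x] : p x ≠ 0)]

/-- Powers of size `p*` of functions vanishing with `u` are integrable. -/
lemma integrable_rpow_pstar (h : IsLipExponent N p pm pM K) {u g : EuclideanSpace ℝ (Fin N) → ℝ}
    (hc : HasCompactSupport u) (hg : Continuous g) (h0 : ∀ x, u x = 0 → g x = 0) :
    Integrable fun x => g x ^ pstar N p x := by
  refine integrable_of_continuous_of_eq_zero hc ?_ ?_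
  · exact hg.rpow h.continuous_pstar fun x => Or.inr (by linarith [h.one_lt_pstar x])
  · intro x hx
    simp [h0 x hx, Real.zero_rpow (by linarith [h.one_lt_pstar x] : pstar N p x ≠ 0)]

/-- Smallness of the gradient and of the truncation of `u` implies smallness of the part of `u`
above level one. -/
lemma integral_excess_le (h : IsLipExponent N p pm pM K) {η : ℝ} (hη : 0 < η) :
    ∃ δ : ℝ, 0 < δ ∧ ∀ u : EuclideanSpace ℝ (Fin N) → ℝ, ContDiff ℝ 1 u → HasCompactSupport u →
      ∫ x, |u x| ^ pstar N p x ≤ 1 → ∫ x, ‖fderiv ℝ u x‖ ^ p x ≤ δ →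
      ∫ x, min |u x| 1 ^ pstar N p x ≤ δ → ∫ x, max (|u x| - 1) 0 ^ pstar N p x ≤ η := by
  have hN := h.one_lt_dim
  set κM := sobolevTestExponent N pM with hκM
  set L := (N : ℝ) * (N - 1) / (N - pM) ^ 2 * K with hL
  have hpM : 1 < pM := (h.one_lt_apply 0).trans_le (h.le 0)
  have hκM1 : 1 < κM := one_lt_sobolevTestExponent hpM h.lt
  have hL0 : 0 ≤ L := by
    have := h.nonneg
    have h1 : (0 : ℝ) ≤ N - 1 := by linarith
    positivity
  set η₁ := min η 1 with hη₁
  have hη₁0 : 0 < η₁ := lt_min hη one_pos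
  set ε := min (η₁ / (2 * (κM + L))) 1 with hε
  have hε0 : 0 < ε := lt_min (by positivity) one_pos
  obtain ⟨C, hC0, hC⟩ := exists_rpow_mul_abs_log_le (g := 1 / (N : ℝ)) (κM := κM) (by positivity) hε0
  set A := κM * ε ^ (-pM) with hA
  have hA0 : 0 < A := by positivity
  refine ⟨η₁ / (2 * (A + L * C)), by positivity, ?_⟩
  intro u hu hc hu1 hG hS
  set v : EuclideanSpace ℝ (Fin N) → ℝ := fun x => max (|u x| - 1) 0 with hv
  set κ : EuclideanSpace ℝ (Fin N) → ℝ := fun x => sobolevTestExponent N (p x) with hκ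
  have huc : Continuous u := hu.continuous
  have hv0 : ∀ x, 0 ≤ v x := fun x => le_max_right _ _
  have hvc : Continuous v := by fun_prop
  have hvu : ∀ x, v x ≤ |u x| := fun x => max_le (by linarith) (abs_nonneg _)
  have hvz : ∀ x, u x = 0 → v x = 0 := fun x hx => by simp [hv, hx]
  have hκ1 : ∀ x, 1 < κ x := fun x => one_lt_sobolevTestExponent (h.one_lt_apply x) (h.apply_lt x)
  have hκc : Continuous κ := h.continuous_testExponent
  set F : EuclideanSpace ℝ (Fin N) → ℝ := fun x =>
    v x ^ (κ x - 1) * (κ x * ‖fderiv ℝ u x‖ + |v x * Real.log (v x)| * L) with hF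
  have hFc : Continuous F := by
    have h1 : Continuous fun x => v x ^ (κ x - 1) :=
      hvc.rpow (hκc.sub continuous_const) fun x => Or.inr (by linarith [hκ1 x])
    have h2 : Continuous fun x => v x * Real.log (v x) := Real.continuous_mul_log.comp hvc
    have h3 := (hu.continuous_fderiv one_ne_zero).norm
    exact h1.mul ((hκc.mul h3).add (h2.abs.mul continuous_const))
  have hF0 : ∀ x, 0 ≤ F x := fun x => by
    have h1 := hv0 x
    have h2 := hκ1 x
    positivity
  have hFi : Integrable F := integrable_of_continuous_of_eq_zero hc hFc fun x hx => by
    simp [hF, hvz x hx, Real.zero_rpow (by linarith [hκ1 x] : κ x - 1 ≠ 0)]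
  have hvi := h.integrable_rpow_pstar hc hvc hvz
  have hwi := h.integrable_rpow_pstar (g := fun x => min |u x| 1) hc (by fun_prop)
    (fun x hx => by simp [hx])
  have hgi := h.integrable_gradient hu hc
  have hbound : ∀ x, F x ≤ (κM + L) * ε * v x ^ pstar N p x + A * ‖fderiv ℝ u x‖ ^ p x
      + L * C * min |u x| 1 ^ pstar N p x := by
    intro x
    have hx0 := hv0 x
    have hy := mul_le_rpow_conj_add_rpow (Real.rpow_nonneg hx0 (κ x - 1))
      (norm_nonneg (fderiv ℝ u x)) (h.one_lt_apply x) (h.le x) hε0 (min_le_right _ _)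
    rw [← Real.rpow_mul hx0, sobolevTestExponent_sub_one_mul (h.one_lt_apply x) (h.apply_lt x)] at hy
    have hκle : κ x ≤ κM := sobolevTestExponent_mono (h.one_lt_apply x) (h.le x) h.lt
    have hlog : v x ^ (κ x - 1) * |v x * Real.log (v x)|
        ≤ ε * v x ^ pstar N p x + C * min |u x| 1 ^ pstar N p x := by
      rcases le_or_gt (|u x|) 1 with h1 | h1
      · have : v x = 0 := max_eq_right (by linarith)
        have h2 : 0 ≤ min |u x| 1 ^ pstar N p x :=
          Real.rpow_nonneg (le_min (abs_nonneg _) zero_le_one) _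
        simp only [this, zero_mul, abs_zero, mul_zero]
        positivity
      · have hpos : 0 < v x := lt_max_of_lt_left (by linarith)
        rw [min_eq_right h1.le, Real.one_rpow, mul_one, abs_mul, abs_of_pos hpos, ← mul_assoc,
          ← Real.rpow_add_one hpos.ne', sub_add_cancel]
        exact hC _ _ _ hx0 (hκ1 x).le hκle
          (sobolevTestExponent_add_inv_le (h.one_lt_apply x) (h.apply_lt x))
    have e1 : F x = κ x * (v x ^ (κ x - 1) * ‖fderiv ℝ u x‖)
        + L * (v x ^ (κ x - 1) * |v x * Real.log (v x)|) := by simp only [hF]; ring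
    rw [e1]
    have h1 : κ x * (v x ^ (κ x - 1) * ‖fderiv ℝ u x‖)
        ≤ κM * (ε * v x ^ pstar N p x + ε ^ (-pM) * ‖fderiv ℝ u x‖ ^ p x) := by
      refine mul_le_mul hκle hy (by positivity) (by positivity)
    have h2 := mul_le_mul_of_nonneg_left hlog hL0
    calc _ ≤ _ := add_le_add h1 h2
      _ = _ := by rw [hA]; ring
  have hint : ∫ x, F x ≤ η₁ := by
    have h1 : ∫ x, F x ≤ (κM + L) * ε * (∫ x, v x ^ pstar N p x)
        + A * (∫ x, ‖fderiv ℝ u x‖ ^ p x) + L * C * (∫ x, min |u x| 1 ^ pstar N p x) := by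
      rw [← integral_const_mul, ← integral_const_mul, ← integral_const_mul, ← integral_add,
        ← integral_add]
      · exact integral_mono hFi (((hvi.const_mul _).add (hgi.const_mul _)).add (hwi.const_mul _))
          hbound
      · exact (hvi.const_mul _).add (hgi.const_mul _)
      · exact hwi.const_mul _
      · exact hvi.const_mul _
      · exact hgi.const_mul _
    have h2 : ∫ x, v x ^ pstar N p x ≤ 1 := by
      refine le_trans (integral_mono hvi (h.integrable_rpow_pstar hc huc.abs (by simp)) ?_) hu1
      exact fun x => Real.rpow_le_rpow (hv0 x) (hvu x) (by linarith [h.one_lt_pstar x])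
    have h3 : (κM + L) * ε ≤ η₁ / 2 := by
      have : ε ≤ η₁ / (2 * (κM + L)) := min_le_left _ _
      calc (κM + L) * ε ≤ (κM + L) * (η₁ / (2 * (κM + L))) := by gcongr
        _ = η₁ / 2 := by field_simp
    have h4 : A * (η₁ / (2 * (A + L * C))) + L * C * (η₁ / (2 * (A + L * C))) = η₁ / 2 := by
      field_simp
    have h5 : (κM + L) * ε * (∫ x, v x ^ pstar N p x) ≤ (κM + L) * ε * 1 := by gcongr
    have h6 := mul_le_mul_of_nonneg_left hG hA0.le
    have h7 := mul_le_mul_of_nonneg_left hS (by positivity : 0 ≤ L * C)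
    linarith
  have key := integral_rpow_le_of_pointwise_lipschitz h.holderConjugate (f := fun x => v x ^ κ x)
    (hvc.rpow hκc fun x => Or.inr (by linarith [hκ1 x])) (fun x => Real.rpow_nonneg (hv0 x) _)
    hFc hF0
    (hc.mono fun x hx => fun h0 => hx (by
      simp [hvz x h0, Real.zero_rpow (by linarith [hκ1 x] : κ x ≠ 0)])) hFi
    (pointwise_lipschitz_rpow hvc hv0 hκc hκ1
      (fun x y => (abs_sobolevTestExponent_sub_le hN (h.le y) (h.le x) h.lt).trans (by
        rw [hL, mul_assoc]
        have h1 : (0 : ℝ) ≤ N - 1 := by linarith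
        exact mul_le_mul_of_nonneg_left (h.lip x y) (by positivity)))
      (pointwise_lipschitz_of_abs_sub_le (hu.differentiable one_ne_zero) fun x y => by
        refine (abs_max_sub_max_le_abs _ _ _).trans ?_
        rw [sub_sub_sub_cancel_right]
        exact abs_abs_sub_abs_le_abs_sub _ _))
  have e : ∀ x, (v x ^ κ x) ^ ((N : ℝ) / (N - 1)) = v x ^ pstar N p x := fun x => by
    rw [← Real.rpow_mul (hv0 x), sobolevTestExponent_mul (h.one_lt_apply x) (h.apply_lt x), pstar]
  simp only [e] at key
  have hq1 : 1 ≤ (N : ℝ) / (N - 1) := h.holderConjugate.symm.lt.le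
  calc ∫ x, v x ^ pstar N p x ≤ (∫ x, F x) ^ ((N : ℝ) / (N - 1)) := key
    _ ≤ η₁ ^ ((N : ℝ) / (N - 1)) :=
        Real.rpow_le_rpow (integral_nonneg hF0) hint (by linarith)
    _ ≤ η₁ := by
        simpa using Real.rpow_le_rpow_of_exponent_ge hη₁0 (min_le_right _ _) hq1
    _ ≤ η := min_le_left _ _

end IsLipExponent

namespace IsLipExponent

variable {N : ℕ} {p : EuclideanSpace ℝ (Fin N) → ℝ} {pm pM K : ℝ}

/-- The limit at infinity of the exponent stays between its bounds. -/
lemma mem_Icc_of_decay (h : IsLipExponent N p pm pM K) {pinf C₀ : ℝ}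
    (hd : ∀ x, |p x - pinf| ≤ C₀ / Real.log (Real.exp 1 + ‖x‖)) : pm ≤ pinf ∧ pinf ≤ pM := by
  have hN : 0 < N := by
    have := h.one_lt_dim
    exact_mod_cast zero_lt_one.trans this
  set y : ℕ → EuclideanSpace ℝ (Fin N) := fun k => EuclideanSpace.single ⟨0, hN⟩ (k : ℝ) with hy
  have hlim : Tendsto (fun k => p (y k)) atTop (𝓝 pinf) := by
    rw [tendsto_iff_dist_tendsto_zero]
    refine squeeze_zero (fun _ => dist_nonneg) (fun k => hd (y k)) ?_
    refine Tendsto.const_div_atTop (Real.tendsto_log_atTop.comp ?_) _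
    refine tendsto_atTop_add_const_left _ _ ?_
    simpa [hy] using tendsto_natCast_atTop_atTop (R := ℝ)
  exact ⟨ge_of_tendsto' hlim fun k => h.ge _, le_of_tendsto' hlim fun k => h.le _⟩

/-- Under the decay condition at infinity, smallness of the gradient implies smallness of the
truncation of `u` at level one. -/
lemma integral_truncation_le_of_decay (h : IsLipExponent N p pm pM K) {pinf C₀ : ℝ}
    (hd : ∀ x, |p x - pinf| ≤ C₀ / Real.log (Real.exp 1 + ‖x‖)) {η : ℝ} (hη : 0 < η) :
    ∃ δ : ℝ, 0 < δ ∧ ∀ u : EuclideanSpace ℝ (Fin N) → ℝ, ContDiff ℝ 1 u → HasCompactSupport u →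
      ∫ x, |u x| ^ pstar N p x ≤ 1 → ∫ x, ‖fderiv ℝ u x‖ ^ p x ≤ δ →
      ∫ x, min |u x| 1 ^ pstar N p x ≤ η := by
  have hN := h.one_lt_dim
  obtain ⟨hi1, hi2⟩ := h.mem_Icc_of_decay hd
  have hp1 : 1 < pinf := h.one_lt.trans_le hi1
  have hpN : pinf < N := hi2.trans_lt h.lt
  set γ := sobolevTestExponent N pinf with hγ
  have hγ1 : 1 < γ := one_lt_sobolevTestExponent hp1 hpN
  set q := (N : ℝ) / (N - 1) with hq
  have hq1 : 1 < q := h.holderConjugate.symm.lt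
  set L := (N : ℝ) * (N - 1) / (N - pM) ^ 2 with hL
  have hL0 : 0 ≤ L := by
    have h1 : (0 : ℝ) ≤ N - 1 := by linarith
    positivity
  have hγd : ∀ x, |γ - sobolevTestExponent N (p x)|
      ≤ L * (C₀ / Real.log (Real.exp 1 + ‖x‖)) := fun x => by
    refine (abs_sobolevTestExponent_sub_le hN hi2 (h.le x) h.lt).trans ?_
    rw [abs_sub_comm]
    exact mul_le_mul_of_nonneg_left (hd x) hL0
  have hconj : ∀ x, 0 < p x / (p x - 1) ∧ 1 ≤ p x / (p x - 1) ∧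
      p x / (p x - 1) ≤ pm / (pm - 1) := fun x => by
    have h1 := h.one_lt_apply x
    have h2 := h.one_lt
    have h3 := h.ge x
    refine ⟨div_pos (by linarith) (by linarith), ?_, ?_⟩
    · rw [one_le_div (by linarith)]; linarith
    · rw [div_le_div_iff₀ (by linarith) (by linarith)]; nlinarith
  have hm : (0 : ℝ) < N + 1 := by linarith
  set H := ∫ x : EuclideanSpace ℝ (Fin N), (1 + ‖x‖) ^ (-((N : ℝ) + 1)) with hH
  have hHi : Integrable fun x : EuclideanSpace ℝ (Fin N) => (1 + ‖x‖) ^ (-((N : ℝ) + 1)) :=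
    integrable_one_add_norm (by simp)
  have hH0 : 0 ≤ H := integral_nonneg fun x => by positivity
  obtain ⟨K₁, hK₁0, hK₁⟩ := exists_rpow_le_mul_rpow_add_decay (pm / (pm - 1) * (L * C₀))
    (sub_pos.2 hγ1) hm one_pos
  obtain ⟨K₂, hK₂0, hK₂⟩ := exists_rpow_le_mul_rpow_add_decay (q * (L * C₀))
    one_pos hm (l := η / (2 * (H + 1))) (by positivity)
  set η₂ := min (η / (2 * K₂)) 1 with hη₂
  have hη₂0 : 0 < η₂ := lt_min (by positivity) one_pos
  set ε := min (η₂ / (2 * (γ * (K₁ + H)))) 1 with hε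
  have hγ0 : 0 < γ := by linarith
  have hε0 : 0 < ε := lt_min (by positivity) one_pos
  refine ⟨η₂ / (2 * (γ * ε ^ (-pM))), by positivity, ?_⟩
  intro u hu hc hu1 hG
  set ω : EuclideanSpace ℝ (Fin N) → ℝ := fun x => min |u x| 1 with hω
  have huc : Continuous u := hu.continuous
  have hω0 : ∀ x, 0 ≤ ω x := fun x => le_min (abs_nonneg _) zero_le_one
  have hω1 : ∀ x, ω x ≤ 1 := fun x => min_le_right _ _
  have hωc : Continuous ω := by fun_prop
  have hωz : ∀ x, u x = 0 → ω x = 0 := fun x hx => by simp [hω, hx]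
  set F : EuclideanSpace ℝ (Fin N) → ℝ := fun x => ω x ^ (γ - 1) * (γ * ‖fderiv ℝ u x‖) with hF
  have hFc : Continuous F :=
    (hωc.rpow_const fun x => Or.inr (by linarith)).mul
      (continuous_const.mul (hu.continuous_fderiv one_ne_zero).norm)
  have hF0 : ∀ x, 0 ≤ F x := fun x => by
    have h1 := hω0 x
    positivity
  have hFi : Integrable F := integrable_of_continuous_of_eq_zero hc hFc fun x hx => by
    simp [hF, hωz x hx, Real.zero_rpow (by linarith : γ - 1 ≠ 0)]
  have hωi := h.integrable_rpow_pstar hc hωc hωz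
  have hgi := h.integrable_gradient hu hc
  have hbound : ∀ x, F x ≤ γ * ε * K₁ * ω x ^ pstar N p x
      + γ * ε * (1 + ‖x‖) ^ (-((N : ℝ) + 1)) + γ * ε ^ (-pM) * ‖fderiv ℝ u x‖ ^ p x := by
    intro x
    obtain ⟨hc0, hc1, hc2⟩ := hconj x
    have hy := mul_le_rpow_conj_add_rpow (Real.rpow_nonneg (hω0 x) (γ - 1))
      (norm_nonneg (fderiv ℝ u x)) (h.one_lt_apply x) (h.le x) hε0 (min_le_right _ _)
    rw [← Real.rpow_mul (hω0 x)] at hy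
    have hk := hK₁ ‖x‖ (ω x) ((γ - 1) * (p x / (p x - 1))) (pstar N p x) (norm_nonneg _) (hω0 x)
      (hω1 x) (le_mul_of_one_le_right (by linarith) hc1) (by
        rw [pstar, ← sobolevTestExponent_sub_one_mul (h.one_lt_apply x) (h.apply_lt x), ← sub_mul,
          sub_sub_sub_cancel_right, abs_mul, abs_of_pos hc0, mul_comm]
        have h1 := hγd x
        calc _ ≤ pm / (pm - 1) * (L * (C₀ / Real.log (Real.exp 1 + ‖x‖))) :=
              mul_le_mul hc2 h1 (abs_nonneg _) (hc0.le.trans hc2)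
          _ = _ := by ring)
    have h1 := mul_le_mul_of_nonneg_left hy hγ0.le
    have h2 := mul_le_mul_of_nonneg_left hk (by positivity : 0 ≤ γ * ε)
    calc F x = γ * (ω x ^ (γ - 1) * ‖fderiv ℝ u x‖) := by simp only [hF]; ring
      _ ≤ _ := h1
      _ = γ * ε * ω x ^ ((γ - 1) * (p x / (p x - 1))) + γ * ε ^ (-pM) * ‖fderiv ℝ u x‖ ^ p x := by
          ring
      _ ≤ γ * ε * (K₁ * ω x ^ pstar N p x + 1 * (1 + ‖x‖) ^ (-((N : ℝ) + 1)))
          + γ * ε ^ (-pM) * ‖fderiv ℝ u x‖ ^ p x := by gcongr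
      _ = _ := by ring
  have hint : ∫ x, F x ≤ η₂ := by
    have h1 : ∫ x, F x ≤ γ * ε * K₁ * (∫ x, ω x ^ pstar N p x) + γ * ε * H
        + γ * ε ^ (-pM) * (∫ x, ‖fderiv ℝ u x‖ ^ p x) := by
      rw [hH, ← integral_const_mul, ← integral_const_mul, ← integral_const_mul, ← integral_add,
        ← integral_add]
      · exact integral_mono hFi (((hωi.const_mul _).add (hHi.const_mul _)).add (hgi.const_mul _))
          hbound
      · exact (hωi.const_mul _).add (hHi.const_mul _)
      · exact hgi.const_mul _
      · exact hωi.const_mul _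
      · exact hHi.const_mul _
    have h2 : ∫ x, ω x ^ pstar N p x ≤ 1 := by
      refine le_trans (integral_mono hωi (h.integrable_rpow_pstar hc huc.abs (by simp)) ?_) hu1
      exact fun x => Real.rpow_le_rpow (hω0 x) (min_le_left _ _) (by linarith [h.one_lt_pstar x])
    have h3 : γ * ε * K₁ + γ * ε * H ≤ η₂ / 2 := by
      have : ε ≤ η₂ / (2 * (γ * (K₁ + H))) := min_le_left _ _
      calc γ * ε * K₁ + γ * ε * H = γ * (K₁ + H) * ε := by ring
        _ ≤ γ * (K₁ + H) * (η₂ / (2 * (γ * (K₁ + H)))) := by gcongr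
        _ = η₂ / 2 := by field_simp
    have h4 : γ * ε ^ (-pM) * (η₂ / (2 * (γ * ε ^ (-pM)))) = η₂ / 2 := by
      have : γ * ε ^ (-pM) ≠ 0 := by positivity
      field_simp
    have h5 : γ * ε * K₁ * (∫ x, ω x ^ pstar N p x) ≤ γ * ε * K₁ * 1 := by gcongr
    have h6 := mul_le_mul_of_nonneg_left hG (by positivity : 0 ≤ γ * ε ^ (-pM))
    linarith
  have key := integral_rpow_le_of_pointwise_lipschitz h.holderConjugate (f := fun x => ω x ^ γ)
    (hωc.rpow_const fun x => Or.inr hγ0.le) (fun x => Real.rpow_nonneg (hω0 x) _)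
    hFc hF0
    (hc.mono fun x hx => fun h0 => hx (by simp [hωz x h0, Real.zero_rpow hγ0.ne'])) hFi
    (fun x r hr => pointwise_lipschitz_rpow (κ := fun _ => γ) (K := 0)
      (G := fun x => ‖fderiv ℝ u x‖) hωc hω0 continuous_const (fun _ => hγ1) (by simp)
      (pointwise_lipschitz_of_abs_sub_le (hu.differentiable one_ne_zero) fun x y => by
        refine (abs_min_sub_min_le_max _ _ _ _).trans ?_
        rw [sub_self, abs_zero, max_eq_left (abs_nonneg _)]
        exact abs_abs_sub_abs_le_abs_sub _ _) x r (by simpa [hF] using hr))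
  have hM : ∫ x, (ω x ^ γ) ^ q ≤ η₂ := by
    refine (key.trans (Real.rpow_le_rpow (integral_nonneg hF0) hint (by linarith))).trans ?_
    simpa using Real.rpow_le_rpow_of_exponent_ge hη₂0 (min_le_right _ _) hq1.le
  have hωγi : Integrable fun x => (ω x ^ γ) ^ q := by
    refine integrable_of_continuous_of_eq_zero hc ?_ ?_
    · exact (hωc.rpow_const fun x => Or.inr hγ0.le).rpow_const fun x => Or.inr (by linarith)
    · intro x hx
      simp [hωz x hx, Real.zero_rpow hγ0.ne', Real.zero_rpow (by linarith : q ≠ 0)]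
  calc ∫ x, ω x ^ pstar N p x
      ≤ ∫ x, (K₂ * (ω x ^ γ) ^ q + η / (2 * (H + 1)) * (1 + ‖x‖) ^ (-((N : ℝ) + 1))) := by
        refine integral_mono hωi ((hωγi.const_mul _).add (hHi.const_mul _)) fun x => ?_
        show ω x ^ pstar N p x ≤ K₂ * (ω x ^ γ) ^ q + _
        rw [← Real.rpow_mul (hω0 x)]
        refine hK₂ ‖x‖ (ω x) (pstar N p x) (γ * q) (norm_nonneg _) (hω0 x) (hω1 x)
          (h.one_lt_pstar x).le ?_
        rw [pstar, ← sobolevTestExponent_mul (h.one_lt_apply x) (h.apply_lt x), ← hq, ← sub_mul,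
          abs_mul, abs_of_pos (by linarith : 0 < q), mul_comm, abs_sub_comm]
        calc _ ≤ q * (L * (C₀ / Real.log (Real.exp 1 + ‖x‖))) :=
              mul_le_mul_of_nonneg_left (hγd x) (by linarith)
          _ = _ := by ring
    _ = K₂ * (∫ x, (ω x ^ γ) ^ q) + η / (2 * (H + 1)) * H := by
        rw [integral_add (hωγi.const_mul _) (hHi.const_mul _), integral_const_mul,
          integral_const_mul]
    _ ≤ K₂ * (η / (2 * K₂)) + η / (2 * (H + 1)) * (H + 1) := by
        gcongr
        · exact hM.trans (min_le_left _ _)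
        · linarith
    _ = η := by field_simp; ring

end IsLipExponent

lemma essInf_eq_zero_of_forall_pos {E : Type*} [MeasurableSpace E] {μ : Measure E} {V : E → ℝ}
    (hV : ∀ᵐ x ∂μ, 0 < V x) (h : ¬ ∃ c, 0 < c ∧ ∀ᵐ x ∂μ, c ≤ V x) : essInf V μ = 0 := by
  rw [essInf, liminf_eq]
  refine IsGreatest.csSup_eq ⟨hV.mono fun x hx => hx.le, fun c hc => ?_⟩
  by_contra! h0
  exact h ⟨c, h0, hc⟩

/-- A locally bounded weight times a continuous compactly supported function is integrable. -/
lemma CondP.integrable_weight_mul {N : ℕ} {p V : EuclideanSpace ℝ (Fin N) → ℝ}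
    (hP : CondP N p V) {g : EuclideanSpace ℝ (Fin N) → ℝ} (hg : Continuous g)
    (hc : HasCompactSupport g) : Integrable fun x => V x * g x := by
  obtain ⟨R, hR0, hR⟩ := hc.isCompact.isBounded.subset_ball_lt 0 0
  obtain ⟨c, C, hc0, hVb⟩ := hP.Vloc R hR0
  rw [ae_restrict_iff' Metric.isOpen_ball.measurableSet] at hVb
  refine ((hg.integrable_of_hasCompactSupport hc).norm.const_mul C).mono'
    (hP.Vmeas.mul hg.measurable).aestronglyMeasurable ?_
  filter_upwards [hVb] with x hx
  by_cases h0 : g x = 0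
  · simp [h0]
  · obtain ⟨h1, h2⟩ := hx (hR (subset_tsupport g h0))
    rw [norm_mul, Real.norm_of_nonneg (hc0.le.trans h1)]
    gcongr

lemma abs_div_rpow_le {c q : ℝ} (hc : 1 ≤ c) (hq : 1 ≤ q) (t : ℝ) :
    |t / c| ^ q ≤ c⁻¹ * |t| ^ q := by
  have hc0 : 0 < c := by linarith
  have h : c⁻¹ ^ q ≤ c⁻¹ := by
    simpa using Real.rpow_le_rpow_of_exponent_ge (inv_pos.2 hc0) (inv_le_one_of_one_le₀ hc) hq
  rw [div_eq_inv_mul, abs_mul, abs_of_pos (inv_pos.2 hc0),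
    Real.mul_rpow (inv_pos.2 hc0).le (abs_nonneg _)]
  gcongr

/-- Dividing by `c ≥ 1` shrinks a weighted modular of exponent at least one by `c⁻¹`. -/
lemma integral_weight_mul_rpow_div_le {E : Type*} [MeasurableSpace E] {μ : Measure E}
    {w q g : E → ℝ} (hw : ∀ᵐ x ∂μ, 0 ≤ w x) (hq : ∀ x, 1 ≤ q x)
    (hi : Integrable (fun x => w x * |g x| ^ q x) μ) {c : ℝ} (hc : 1 ≤ c) :
    ∫ x, w x * |g x / c| ^ q x ∂μ ≤ c⁻¹ * ∫ x, w x * |g x| ^ q x ∂μ := by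
  have hc0 : 0 < c := by linarith
  rw [← integral_const_mul]
  refine integral_mono_of_nonneg ?_ (hi.const_mul _) ?_
  · filter_upwards [hw] with x hx
    positivity
  · filter_upwards [hw] with x hx
    calc w x * |g x / c| ^ q x ≤ w x * (c⁻¹ * |g x| ^ q x) := by
          gcongr
          exact abs_div_rpow_le hc (hq x) _
      _ = _ := by ring

lemma integral_weight_mul_rpow_div_anti {E : Type*} [MeasurableSpace E] {μ : Measure E}
    {w q g : E → ℝ} (hw : ∀ᵐ x ∂μ, 0 ≤ w x) (hq : ∀ x, 1 ≤ q x) {b c : ℝ}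
    (hi : Integrable (fun x => w x * |g x / b| ^ q x) μ) (hb : 0 < b) (hbc : b ≤ c) :
    ∫ x, w x * |g x / c| ^ q x ∂μ ≤ ∫ x, w x * |g x / b| ^ q x ∂μ := by
  refine integral_mono_of_nonneg ?_ hi ?_
  · filter_upwards [hw] with x hx
    positivity
  · filter_upwards [hw] with x hx
    have hq0 : 0 ≤ q x := zero_le_one.trans (hq x)
    have hc : 0 < c := hb.trans_le hbc
    simp only [abs_div, abs_of_pos hb, abs_of_pos hc]
    gcongr

/-- The set defining the Luxemburg norm is nonempty when the modular is finite. -/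
lemma exists_integral_weight_mul_rpow_div_le_one {E : Type*} [MeasurableSpace E] {μ : Measure E}
    {w q g : E → ℝ} (hw : ∀ᵐ x ∂μ, 0 ≤ w x) (hq : ∀ x, 1 ≤ q x)
    (hi : Integrable (fun x => w x * |g x| ^ q x) μ) :
    ∃ c : ℝ, 0 < c ∧ ∫ x, w x * |g x / c| ^ q x ∂μ ≤ 1 := by
  set c := max 1 (∫ x, w x * |g x| ^ q x ∂μ)
  have hc : 1 ≤ c := le_max_left _ _
  have hc0 : 0 < c := by linarith
  refine ⟨c, hc0, (integral_weight_mul_rpow_div_le hw hq hi hc).trans ?_⟩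
  rw [inv_mul_le_one₀ hc0]
  exact le_max_right _ _

namespace CondP

variable {N : ℕ} {p V : EuclideanSpace ℝ (Fin N) → ℝ} {pm pM K : ℝ}

lemma exists_isLipExponent (hP : CondP N p V) : ∃ pm pM K, IsLipExponent N p pm pM K := by
  obtain ⟨K, hK⟩ := hP.lip
  refine ⟨_, _, K, hP.inf_gt_one, fun x => csInf_le hP.pbddBelow ⟨x, rfl⟩,
    fun x => le_csSup hP.pbddAbove ⟨x, rfl⟩, hP.sup_lt_N, K.2, fun x y => ?_⟩
  simpa [Real.dist_eq, dist_eq_norm] using hK.dist_le_mul y x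

lemma integrable_potential (hP : CondP N p V) (h : IsLipExponent N p pm pM K)
    {u : EuclideanSpace ℝ (Fin N) → ℝ} (hu : Continuous u) (hc : HasCompactSupport u) :
    Integrable fun x => V x * |u x| ^ p x := by
  refine hP.integrable_weight_mul (hu.abs.rpow h.continuous
    fun x => Or.inr (by linarith [h.one_lt_apply x])) (hc.mono fun x hx h0 => hx ?_)
  simp [h0, Real.zero_rpow (by linarith [h.one_lt_apply x] : p x ≠ 0)]

/-- Smallness of the gradient and of the potential energy implies smallness of the part of `u`
below level one. -/
lemma integral_truncation_le (hP : CondP N p V) (h : IsLipExponent N p pm pM K) {η : ℝ}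
    (hη : 0 < η) :
    ∃ δ : ℝ, 0 < δ ∧ ∀ u : EuclideanSpace ℝ (Fin N) → ℝ, ContDiff ℝ 1 u → HasCompactSupport u →
      ∫ x, |u x| ^ pstar N p x ≤ 1 → ∫ x, ‖fderiv ℝ u x‖ ^ p x ≤ δ →
      ∫ x, V x * |u x| ^ p x ≤ δ → ∫ x, min |u x| 1 ^ pstar N p x ≤ η := by
  by_cases hV : ∃ c, 0 < c ∧ ∀ᵐ x ∂(volume : Measure (EuclideanSpace ℝ (Fin N))), c ≤ V x
  · obtain ⟨c, hc0, hcV⟩ := hV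
    refine ⟨c * η, by positivity, fun u hu hc _ _ hW => ?_⟩
    have hi := (hP.integrable_potential h hu.continuous hc).const_mul c⁻¹
    calc ∫ x, min |u x| 1 ^ pstar N p x ≤ ∫ x, c⁻¹ * (V x * |u x| ^ p x) := by
          refine integral_mono_of_nonneg (Eventually.of_forall fun x => ?_) hi ?_
          · exact Real.rpow_nonneg (le_min (abs_nonneg _) zero_le_one) _
          filter_upwards [hcV] with x hx
          have hm : 0 ≤ min |u x| 1 := le_min (abs_nonneg _) zero_le_one
          have hp : 0 < p x := by linarith [h.one_lt_apply x]
          calc min |u x| 1 ^ pstar N p x ≤ min |u x| 1 ^ p x :=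
                Real.rpow_le_rpow_of_exponent_ge' hm (min_le_right _ _) hp.le (h.le_pstar x)
            _ ≤ |u x| ^ p x := Real.rpow_le_rpow hm (min_le_left _ _) hp.le
            _ = c⁻¹ * (c * |u x| ^ p x) := by field_simp
            _ ≤ c⁻¹ * (V x * |u x| ^ p x) := by gcongr
      _ = c⁻¹ * ∫ x, V x * |u x| ^ p x := integral_const_mul _ _
      _ ≤ c⁻¹ * (c * η) := by gcongr
      _ = η := by field_simp
  · obtain ⟨pinf, C₀, hd⟩ := hP.logHolderDecay (essInf_eq_zero_of_forall_pos hP.Vpos hV)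
    obtain ⟨δ, hδ, H⟩ := h.integral_truncation_le_of_decay hd hη
    exact ⟨δ, hδ, fun u hu hc h1 h2 _ => H u hu hc h1 h2⟩

/-- A function of unit critical modular cannot have arbitrarily small energy. -/
lemma exists_energy_lower_bound (hP : CondP N p V) (h : IsLipExponent N p pm pM K) :
    ∃ δ : ℝ, 0 < δ ∧ ∀ u : EuclideanSpace ℝ (Fin N) → ℝ, ContDiff ℝ 1 u → HasCompactSupport u →
      ∫ x, ‖fderiv ℝ u x‖ ^ p x ≤ δ → ∫ x, V x * |u x| ^ p x ≤ δ →
      ∫ x, |u x| ^ pstar N p x ≠ 1 := by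
  set Q := N * pM / (N - pM) with hQ
  set η : ℝ := 1 / (4 * 2 ^ Q) with hη
  have h2Q : (0 : ℝ) < 2 ^ Q := by positivity
  have hη0 : 0 < η := by positivity
  obtain ⟨δ₁, hδ₁, H₁⟩ := h.integral_excess_le hη0
  obtain ⟨δ₂, hδ₂, H₂⟩ := hP.integral_truncation_le h (lt_min hη0 hδ₁)
  refine ⟨min δ₁ δ₂, lt_min hδ₁ hδ₂, fun u hu hc hG hW h1 => ?_⟩
  have ht := H₂ u hu hc h1.le (hG.trans (min_le_right _ _)) (hW.trans (min_le_right _ _))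
  have he := H₁ u hu hc h1.le (hG.trans (min_le_left _ _)) (ht.trans (min_le_right _ _))
  have ht' := ht.trans (min_le_left _ _)
  have huc := hu.continuous
  have hei := h.integrable_rpow_pstar (g := fun x => max (|u x| - 1) 0) hc (by fun_prop)
    (fun x hx => by simp [hx])
  have hti := h.integrable_rpow_pstar (g := fun x => min |u x| 1) hc (by fun_prop)
    (fun x hx => by simp [hx])
  have key : ∫ x, |u x| ^ pstar N p x
      ≤ ∫ x, 2 ^ Q * (max (|u x| - 1) 0 ^ pstar N p x + min |u x| 1 ^ pstar N p x) := by
    refine integral_mono (h.integrable_rpow_pstar hc huc.abs (by simp))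
      ((hei.add hti).const_mul _) fun x => ?_
    have hm : 0 ≤ min |u x| 1 := le_min (abs_nonneg _) zero_le_one
    have hv : 0 ≤ max (|u x| - 1) 0 := le_max_right _ _
    have hp : 0 ≤ pstar N p x := by linarith [h.one_lt_pstar x]
    set M := max (max (|u x| - 1) 0) (min |u x| 1) with hM
    have hM0 : 0 ≤ M := hv.trans (le_max_left _ _)
    have hle : |u x| ≤ 2 * M := by
      have e1 : max (|u x| - 1) 0 ≤ M := le_max_left _ _
      have e2 : min |u x| 1 ≤ M := le_max_right _ _
      have e3 : |u x| = max (|u x| - 1) 0 + min |u x| 1 := by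
        rcases le_total |u x| 1 with h | h
        · rw [max_eq_right (by linarith), min_eq_left h]; ring
        · rw [max_eq_left (by linarith), min_eq_right h]; ring
      linarith
    have hMp : M ^ pstar N p x ≤ max (|u x| - 1) 0 ^ pstar N p x + min |u x| 1 ^ pstar N p x := by
      have e1 := Real.rpow_nonneg hv (pstar N p x)
      have e2 := Real.rpow_nonneg hm (pstar N p x)
      rcases max_choice (max (|u x| - 1) 0) (min |u x| 1) with h | h <;>
      · rw [hM, h]; linarith
    calc |u x| ^ pstar N p x ≤ (2 * M) ^ pstar N p x := Real.rpow_le_rpow (abs_nonneg _) hle hp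
      _ = 2 ^ pstar N p x * M ^ pstar N p x := Real.mul_rpow zero_le_two hM0
      _ ≤ 2 ^ Q * (max (|u x| - 1) 0 ^ pstar N p x + min |u x| 1 ^ pstar N p x) := by
          gcongr
          · norm_num
          · exact h.pstar_le x
  rw [integral_const_mul, integral_add hei hti, h1] at key
  have : (2 : ℝ) ^ Q * (η + η) = 1 / 2 := by
    rw [hη]; field_simp; norm_num
  have := mul_le_mul_of_nonneg_left (add_le_add he ht') h2Q.le
  linarith

/-- The critical Sobolev embedding, in modular form. -/
lemma exists_integral_rpow_pstar_le_one (hP : CondP N p V) (h : IsLipExponent N p pm pM K) :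
    ∃ L : ℝ, 1 ≤ L ∧ ∀ u : EuclideanSpace ℝ (Fin N) → ℝ, ContDiff ℝ 1 u → HasCompactSupport u →
      ∫ x, ‖fderiv ℝ u x‖ ^ p x ≤ 1 → ∫ x, V x * |u x| ^ p x ≤ 1 →
      ∫ x, |u x / L| ^ pstar N p x ≤ 1 := by
  obtain ⟨δ, hδ, H⟩ := hP.exists_energy_lower_bound h
  set L := max 1 δ⁻¹
  have hL : 1 ≤ L := le_max_left _ _
  refine ⟨L, hL, fun u hu hc hG hW => ?_⟩
  have huc := hu.continuous
  by_contra! hgt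
  set φ : ℝ → ℝ := fun t => ∫ x, |t * u x| ^ pstar N p x with hφ
  have hps : ∀ x, 0 ≤ pstar N p x := fun x => by linarith [h.one_lt_pstar x]
  have hcont : ContinuousOn φ (Set.Icc 0 L⁻¹) := by
    refine continuousOn_of_dominated (bound := fun x => |u x| ^ pstar N p x) ?_ ?_
      (h.integrable_rpow_pstar hc huc.abs (by simp)) ?_
    · exact fun t _ => (((continuous_const.mul huc).abs).rpow h.continuous_pstar
        fun x => Or.inr (by linarith [h.one_lt_pstar x])).aestronglyMeasurable
    · refine fun t ht => Eventually.of_forall fun x => ?_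
      rw [Real.norm_of_nonneg (by positivity)]
      refine Real.rpow_le_rpow (abs_nonneg _) ?_ (hps x)
      rw [abs_mul, abs_of_nonneg ht.1]
      exact mul_le_of_le_one_left (abs_nonneg _) (ht.2.trans (inv_le_one_of_one_le₀ hL))
    · exact Eventually.of_forall fun x => (((continuous_id.mul continuous_const).abs).rpow_const
        fun t => Or.inr (hps x)).continuousOn
  have h0 : φ 0 = 0 := by
    have : ∀ x, |0 * u x| ^ pstar N p x = 0 := fun x => by
      simp [Real.zero_rpow (by linarith [h.one_lt_pstar x] : pstar N p x ≠ 0)]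
    simp only [hφ, this, integral_zero]
  have h1 : 1 < φ L⁻¹ := by
    simpa only [hφ, div_eq_inv_mul] using hgt
  obtain ⟨t, ht, hφt⟩ := intermediate_value_Icc (by positivity) hcont
    (show (1 : ℝ) ∈ Set.Icc (φ 0) (φ L⁻¹) from ⟨by rw [h0]; exact zero_le_one, h1.le⟩)
  have ht0 : 0 < t := lt_of_le_of_ne ht.1 fun e => by
    rw [← e, h0] at hφt
    exact zero_ne_one hφt
  have ht1 : 1 ≤ t⁻¹ := hL.trans (by
    rw [le_inv_comm₀ (by positivity) ht0]; exact ht.2)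
  have htδ : t ≤ δ := ht.2.trans (inv_le_of_inv_le₀ hδ (le_max_right _ _))
  have hp1 : ∀ x, 1 ≤ p x := fun x => (h.one_lt_apply x).le
  refine H (fun x => t * u x) (contDiff_const.mul hu) hc.mul_left ?_ ?_ hφt
  · have := integral_weight_mul_rpow_div_le (μ := volume) (w := fun _ => 1)
      (g := fun x => ‖fderiv ℝ u x‖) (Eventually.of_forall fun _ => zero_le_one) hp1
      (by simpa using h.integrable_gradient hu hc) ht1
    simp only [one_mul, abs_norm, abs_mul, inv_inv, div_inv_eq_mul, abs_of_pos ht0] at this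
    have e : ∀ x, ‖fderiv ℝ (fun x => t * u x) x‖ = ‖fderiv ℝ u x‖ * t := fun x => by
      rw [fderiv_const_mul (hu.differentiable one_ne_zero x), norm_smul,
        Real.norm_of_nonneg ht0.le, mul_comm]
    simp only [e]
    exact this.trans ((mul_le_of_le_one_right ht0.le hG).trans htδ)
  · have := integral_weight_mul_rpow_div_le (hP.Vpos.mono fun x hx => hx.le) hp1
      (hP.integrable_potential h huc hc) ht1
    simp only [inv_inv, div_inv_eq_mul, mul_comm _ t] at this
    refine this.trans (le_trans ?_ htδ)
    rw [mul_comm]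
    exact mul_le_of_le_one_left ht0.le hW

end CondP

namespace CondS

variable {N : ℕ} {p r a : EuclideanSpace ℝ (Fin N) → ℝ}

lemma one_lt_apply (hS : CondS N p r a) (x : EuclideanSpace ℝ (Fin N)) : 1 < r x := by
  have hb : BddBelow (Set.range r) := by
    by_contra hb
    have := hS.inf_gt_one
    rw [Real.sInf_of_not_bddBelow hb] at this
    linarith
  exact hS.inf_gt_one.trans_le (csInf_le hb ⟨x, rfl⟩)

lemma apply_lt_pstar (hS : CondS N p r a) (x : EuclideanSpace ℝ (Fin N)) : r x < pstar N p x := by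
  have hb : BddBelow (Set.range fun x => pstar N p x - r x) := by
    by_contra hb
    have := hS.gap
    rw [Real.sInf_of_not_bddBelow hb] at this
    exact lt_irrefl _ this
  exact sub_pos.1 (hS.gap.trans_le (csInf_le hb ⟨x, rfl⟩))

/-- The weighted modular of exponent `r` is controlled by the critical modular. -/
lemma exists_integral_weight_mul_le_one (hS : CondS N p r a) (hps : Measurable (pstar N p)) :
    ∃ D : ℝ, 1 ≤ D ∧ ∀ z : EuclideanSpace ℝ (Fin N) → ℝ,
      Integrable (fun x => |z x| ^ pstar N p x) → ∫ x, |z x| ^ pstar N p x ≤ 1 →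
      ∫ x, a x * |z x / D| ^ r x ≤ 1 := by
  set F : EuclideanSpace ℝ (Fin N) → ℝ := fun x => a x ^ (pstar N p x / (pstar N p x - r x))
  have hF0 : ∀ᵐ x, 0 ≤ F x := hS.apos.mono fun x hx => Real.rpow_nonneg hx.le _
  have hFi : Integrable F := (lintegral_ofReal_ne_top_iff_integrable
    (hS.ameas.pow (hps.div (hps.sub hS.rcont.measurable))).aestronglyMeasurable hF0).1 hS.aint.ne
  have hA : 0 ≤ ∫ x, F x := integral_nonneg_of_ae hF0
  set D := (∫ x, F x) + 1
  have hD : 1 ≤ D := le_add_of_nonneg_left hA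
  have hD0 : 0 < D := by linarith
  refine ⟨D, hD, fun z hz hz1 => ?_⟩
  calc ∫ x, a x * |z x / D| ^ r x ≤ ∫ x, D⁻¹ * (F x + |z x| ^ pstar N p x) := by
        refine integral_mono_of_nonneg ?_ ((hFi.add hz).const_mul _) ?_
        · filter_upwards [hS.apos] with x hx
          positivity
        filter_upwards [hS.apos] with x hx
        have hr1 := hS.one_lt_apply x
        have hrp := hS.apply_lt_pstar x
        have hpr : 0 < pstar N p x - r x := sub_pos.2 hrp
        have hr0 : 0 < r x := by linarith
        have hp0 : 0 < pstar N p x := by linarith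
        have hconj : Real.HolderConjugate (pstar N p x / (pstar N p x - r x))
            (pstar N p x / r x) := by
          rw [Real.holderConjugate_iff]
          refine ⟨by rw [lt_div_iff₀ hpr]; linarith, ?_⟩
          field_simp
          ring
        have hy := Real.young_inequality_of_nonneg hx.le
          (Real.rpow_nonneg (abs_nonneg (z x)) (r x)) hconj
        rw [← Real.rpow_mul (abs_nonneg _), mul_div_cancel₀ _ hr0.ne'] at hy
        have hy1 := div_le_self (Real.rpow_nonneg hx.le (pstar N p x / (pstar N p x - r x)))
          hconj.lt.le
        have hy2 := div_le_self (Real.rpow_nonneg (abs_nonneg (z x)) (pstar N p x))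
          hconj.symm.lt.le
        calc a x * |z x / D| ^ r x ≤ a x * (D⁻¹ * |z x| ^ r x) := by
              gcongr
              exact abs_div_rpow_le hD hr1.le _
          _ = D⁻¹ * (a x * |z x| ^ r x) := by ring
          _ ≤ D⁻¹ * (F x + |z x| ^ pstar N p x) := by
              gcongr
              exact hy.trans (add_le_add hy1 hy2)
    _ = D⁻¹ * ((∫ x, F x) + ∫ x, |z x| ^ pstar N p x) := by
        rw [integral_const_mul, integral_add hFi hz]
    _ ≤ D⁻¹ * D := by
        gcongr
        exact add_le_add_right hz1 _
    _ = 1 := inv_mul_cancel₀ hD0.ne'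

end CondS

/-- Continuous imbedding `X ↪ L^{r(x)}(a,ℝ^N)` under conditions (𝒫) and (𝒮):
`|u|_{L^{r(x)}(a,ℝ^N)} ≤ C ‖u‖` for all `u ∈ C_c^∞(ℝ^N)`. -/
theorem imbedding_X_into_Lr_a
    (N : ℕ) (p V r a : EuclideanSpace ℝ (Fin N) → ℝ)
    (hP : CondP N p V) (hS : CondS N p r a) :
    ∃ C : ℝ, 0 < C ∧
      ∀ u : EuclideanSpace ℝ (Fin N) → ℝ, ContDiff ℝ (⊤ : ℕ∞) u → HasCompactSupport u →
        luxNormW a r u ≤ C * sobNorm p V u := by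
  obtain ⟨pm, pM, K, h⟩ := hP.exists_isLipExponent
  obtain ⟨L, hL, hLu⟩ := hP.exists_integral_rpow_pstar_le_one h
  obtain ⟨D, hD, hDz⟩ := hS.exists_integral_weight_mul_le_one h.continuous_pstar.measurable
  have hL0 : 0 < L := by linarith
  have hD0 : 0 < D := by linarith
  have hp1 : ∀ x, 1 ≤ p x := fun x => (h.one_lt_apply x).le
  refine ⟨D * L, by positivity, fun u hu' hc => ?_⟩
  have hu : ContDiff ℝ 1 u := hu'.of_le (mod_cast le_top)
  have hV : ∀ᵐ x, 0 ≤ V x := hP.Vpos.mono fun x hx => hx.le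
  have hone : ∀ᵐ _ : EuclideanSpace ℝ (Fin N), (0 : ℝ) ≤ 1 :=
    Eventually.of_forall fun _ => zero_le_one
  have hdiv : ∀ c : ℝ, HasCompactSupport fun x => u x / c := fun c => by
    simp only [div_eq_mul_inv]
    exact hc.mul_right
  have hgrad : ∀ c : ℝ, 0 < c → ∀ x,
      ‖fderiv ℝ (fun x => u x / c) x‖ ^ p x = 1 * |‖fderiv ℝ u x‖ / c| ^ p x := fun c hc0 x => by
    rw [one_mul, abs_div, abs_norm, abs_of_pos hc0]
    simp only [div_eq_inv_mul]
    rw [fderiv_const_mul (hu.differentiable one_ne_zero x), norm_smul,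
      Real.norm_of_nonneg (inv_pos.2 hc0).le]
  have main : ∀ c₁ c₂ : ℝ, 0 < c₁ → ∫ x, 1 * |‖fderiv ℝ u x‖ / c₁| ^ p x ≤ 1 → 0 < c₂ →
      ∫ x, V x * |u x / c₂| ^ p x ≤ 1 → luxNormW a r u ≤ D * L * (c₁ + c₂) := by
    intro c₁ c₂ h₁ hG h₂ hW
    set c := c₁ + c₂
    have hc0 : 0 < c := by positivity
    have hGU : ∫ x, ‖fderiv ℝ (fun x => u x / c) x‖ ^ p x ≤ 1 := by
      have hi := h.integrable_gradient (hu.div_const c₁) (hdiv c₁)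
      simp only [hgrad c hc0, hgrad c₁ h₁] at hi ⊢
      exact (integral_weight_mul_rpow_div_anti hone hp1 hi h₁ (by linarith)).trans hG
    have hWU : ∫ x, V x * |u x / c| ^ p x ≤ 1 :=
      (integral_weight_mul_rpow_div_anti hV hp1 (hP.integrable_potential h
        (hu.continuous.div_const c₂) (hdiv c₂)) h₂ (by linarith)).trans hW
    refine csInf_le ⟨0, fun b hb => hb.1.le⟩ ⟨by positivity, ?_⟩
    have := hDz (fun x => u x / c / L)
      (h.integrable_rpow_pstar hc (by fun_prop) (by intro x hx; simp [hx]))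
      (hLu _ (hu.div_const c) (hdiv c) hGU hWU)
    have e : c * L * D = D * L * c := by ring
    simpa only [div_div, e] using this
  have hGi : Integrable fun x => 1 * |‖fderiv ℝ u x‖| ^ p x := by
    simpa using h.integrable_gradient hu hc
  have hDL : 0 < D * L := by positivity
  rw [← div_le_iff₀' hDL, sobNorm, ← sub_le_iff_le_add']
  refine le_csInf (exists_integral_weight_mul_rpow_div_le_one hV hp1
    (hP.integrable_potential h hu.continuous hc)) fun c₂ hc₂ => ?_
  rw [sub_le_comm]
  refine le_csInf (exists_integral_weight_mul_rpow_div_le_one hone hp1 hGi) fun c₁ hc₁ => ?_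
  rw [sub_le_iff_le_add, div_le_iff₀' hDL]
  exact main c₁ c₂ hc₁.1 hc₁.2 hc₂.1 hc₂.2
end

section
/- Let p : ℝ^N → ℝ be measurable with 1 < p⁻ := inf p ≤ p⁺ := sup p < N, set p*(x) := Np(x)/(N − p(x)), and assume condition (𝒮). Then for every ε ∈ (0,1) there exist δ > 0 and R > 0 such that for every measurable u : ℝ^N → ℝ with ∫_{ℝ^N} |u(x)|^{p*(x)} dx ≤ 1: (i) for every measurable Q ⊆ ℝ^N with Lebesgue measure |Q| < δ one has ∫_Q a(x)|u(x)|^{r(x)} dx < ε; and (ii) ∫_{{|x| > R}} a(x)|u(x)|^{r(x)} dx < ε. -/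
open MeasureTheory Filter Topology

/-- Young's inequality with a small parameter `l`, in a form uniform in the exponents. -/
theorem mul_rpow_le_add_rpow {A t s P l K : ℝ} (hA : 0 < A) (ht : 0 ≤ t) (hs : 0 < s)
    (hsP : s < P) (hl : 0 < l) (hl1 : l ≤ 1) (hK : s / (P - s) ≤ K) :
    A * t ^ s ≤ l * t ^ P + l ^ (-K) * A ^ (P / (P - s)) := by
  have hd : 0 < P - s := sub_pos.2 hsP
  rcases le_total A (l * t ^ (P - s)) with h | h
  · have h1 : A * t ^ s ≤ l * t ^ P := by
      calc A * t ^ s ≤ l * t ^ (P - s) * t ^ s := by gcongr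
        _ = l * t ^ P := by
          rw [mul_assoc, ← Real.rpow_add' ht (by linarith), sub_add_cancel]
    have h2 : 0 ≤ l ^ (-K) * A ^ (P / (P - s)) := by positivity
    linarith
  · have h0 : t ^ (P - s) ≤ A / l := by rwa [le_div_iff₀' hl]
    have h1 : t ^ s ≤ l ^ (-(s / (P - s))) * A ^ (s / (P - s)) := by
      calc t ^ s = (t ^ (P - s)) ^ (s / (P - s)) := by
            rw [← Real.rpow_mul ht, mul_div_cancel₀ _ hd.ne']
        _ ≤ (A / l) ^ (s / (P - s)) := by gcongr
        _ = l ^ (-(s / (P - s))) * A ^ (s / (P - s)) := by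
            rw [Real.div_rpow hA.le hl.le, Real.rpow_neg hl.le, div_eq_inv_mul]
    have h2 : l ^ (-(s / (P - s))) ≤ l ^ (-K) :=
      Real.rpow_le_rpow_of_exponent_ge hl hl1 (by linarith)
    have h3 : A ^ (P / (P - s)) = A * A ^ (s / (P - s)) := by
      rw [← Real.rpow_one_add' hA.le (by positivity)]
      congr 1
      field_simp
      ring
    calc A * t ^ s ≤ A * (l ^ (-K) * A ^ (s / (P - s))) := by
          gcongr
          exact h1.trans (by gcongr)
      _ = l ^ (-K) * A ^ (P / (P - s)) := by rw [h3]; ring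
      _ ≤ l * t ^ P + l ^ (-K) * A ^ (P / (P - s)) := by
          have : 0 ≤ l * t ^ P := by positivity
          linarith

/-- A function of finite integral has small integral far away from the origin. -/
theorem exists_setLIntegral_norm_gt_lt {E : Type*} [NormedAddCommGroup E] [MeasurableSpace E]
    [OpensMeasurableSpace E] {μ : Measure E} {f : E → ENNReal} (hf : ∫⁻ x, f x ∂μ ≠ ⊤)
    {η : ENNReal} (hη : 0 < η) :
    ∃ R : ℝ, 0 < R ∧ ∫⁻ x in {x | R < ‖x‖}, f x ∂μ < η := by
  have hmeas : ∀ n : ℕ, MeasurableSet {x : E | (n : ℝ) < ‖x‖} := fun n =>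
    measurableSet_lt measurable_const measurable_norm
  have hanti : Antitone fun n : ℕ => {x : E | (n : ℝ) < ‖x‖} := by
    intro m n hmn x hx
    have hx' : (n : ℝ) < ‖x‖ := hx
    exact (Nat.cast_le.2 hmn).trans_lt hx'
  have hempty : ⋂ n : ℕ, {x : E | (n : ℝ) < ‖x‖} = ∅ := by
    refine Set.eq_empty_of_forall_notMem fun x hx => ?_
    obtain ⟨n, hn⟩ := exists_nat_ge ‖x‖
    exact absurd (Set.mem_iInter.1 hx n) (not_lt.2 hn)
  have hfin : ∃ n : ℕ, μ.withDensity f {x : E | (n : ℝ) < ‖x‖} ≠ ⊤ := by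
    refine ⟨0, ?_⟩
    rw [withDensity_apply _ (hmeas 0)]
    exact ne_top_of_le_ne_top hf (setLIntegral_le_lintegral _ _)
  have hlim := tendsto_measure_iInter_atTop (μ := μ.withDensity f)
    (fun n => (hmeas n).nullMeasurableSet) hanti hfin
  rw [hempty, measure_empty] at hlim
  obtain ⟨n, hn, hn0⟩ := ((hlim.eventually_lt_const hη).and (eventually_gt_atTop 0)).exists
  refine ⟨n, Nat.cast_pos.2 hn0, ?_⟩
  rwa [Function.comp_apply, withDensity_apply _ (hmeas n)] at hn

/-- A set of reals with positive `sInf` is bounded below by it, since `sInf` is `0` on sets that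
are not bounded below. -/
theorem Real.sInf_le_of_sInf_pos {S : Set ℝ} (hS : 0 < sInf S) {y : ℝ} (hy : y ∈ S) :
    sInf S ≤ y := by
  refine csInf_le ?_ hy
  by_contra h
  exact hS.ne' (Real.sInf_of_not_bddBelow h)

/-- Uniform absolute continuity and uniform decay at infinity of the integrals
`∫ a(x)|u(x)|^{r(x)} dx` over the unit ball of `L^{p*(x)}(ℝ^N)`. -/
theorem uniform_integrability_of_weight
    (N : ℕ) (p r a : EuclideanSpace ℝ (Fin N) → ℝ)
    (hp : Measurable p)
    (hpBelow : BddBelow (Set.range p)) (hpAbove : BddAbove (Set.range p))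
    (hp1 : 1 < sInf (Set.range p)) (hpN : sSup (Set.range p) < N)
    (hS : CondS N p r a) :
    ∀ ε : ℝ, ε ∈ Set.Ioo (0 : ℝ) 1 →
      ∃ δ R : ℝ, 0 < δ ∧ 0 < R ∧
        ∀ u : EuclideanSpace ℝ (Fin N) → ℝ, Measurable u →
          (∫⁻ x, ENNReal.ofReal (|u x| ^ pstar N p x)) ≤ 1 →
          (∀ Q : Set (EuclideanSpace ℝ (Fin N)), MeasurableSet Q →
              volume Q < ENNReal.ofReal δ →
              (∫⁻ x in Q, ENNReal.ofReal (a x * |u x| ^ r x)) < ENNReal.ofReal ε) ∧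
          (∫⁻ x in {x : EuclideanSpace ℝ (Fin N) | R < ‖x‖},
              ENNReal.ofReal (a x * |u x| ^ r x)) < ENNReal.ofReal ε := by
  intro ε hε
  obtain ⟨hε0, hε1⟩ := hε
  set P := pstar N p with hP
  set g := sInf (Set.range fun x => P x - r x) with hg
  have hg0 : 0 < g := hS.gap
  obtain ⟨M, hM⟩ := hS.rbddAbove
  have hr : ∀ x, 1 < r x := fun x =>
    hS.inf_gt_one.trans_le
      (Real.sInf_le_of_sInf_pos (zero_lt_one.trans hS.inf_gt_one) (Set.mem_range_self x))
  have hgap : ∀ x, g ≤ P x - r x := fun x =>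
    Real.sInf_le_of_sInf_pos hg0 (Set.mem_range_self x)
  have hPmeas : Measurable P := by
    rw [hP]
    unfold pstar
    fun_prop
  set l := ε / 2 with hl
  have hl0 : 0 < l := by positivity
  have hC0 : 0 < l ^ (-(M / g)) := by positivity
  set C := l ^ (-(M / g)) with hC
  set F : EuclideanSpace ℝ (Fin N) → ENNReal :=
    fun x => ENNReal.ofReal (a x ^ (P x / (P x - r x))) with hF
  have hFmeas : Measurable F :=
    (hS.ameas.pow (hPmeas.div (hPmeas.sub hS.rcont.measurable))).ennreal_ofReal
  have hFint : ∫⁻ x, F x ≠ ⊤ := hS.aint.ne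
  have hη : 0 < ENNReal.ofReal (l / C) := ENNReal.ofReal_pos.2 (by positivity)
  have hpt : ∀ u : EuclideanSpace ℝ (Fin N) → ℝ, ∀ᵐ x,
      ENNReal.ofReal (a x * |u x| ^ r x) ≤
        ENNReal.ofReal l * ENNReal.ofReal (|u x| ^ P x) + ENNReal.ofReal C * F x := by
    intro u
    filter_upwards [hS.apos] with x hx
    have hrx := hr x
    have hgx := hgap x
    have hMx : r x ≤ M := hM (Set.mem_range_self x)
    rw [← ENNReal.ofReal_mul hl0.le, hF, ← ENNReal.ofReal_mul hC0.le,
      ← ENNReal.ofReal_add (by positivity) (by positivity)]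
    refine ENNReal.ofReal_le_ofReal (mul_rpow_le_add_rpow hx (abs_nonneg _) (by linarith)
      (by linarith) hl0 (by linarith) ?_)
    exact div_le_div₀ (by linarith) hMx hg0 hgx
  have key : ∀ u : EuclideanSpace ℝ (Fin N) → ℝ,
      (∫⁻ x, ENNReal.ofReal (|u x| ^ P x)) ≤ 1 →
      ∀ S : Set (EuclideanSpace ℝ (Fin N)), ∫⁻ x in S, F x < ENNReal.ofReal (l / C) →
        (∫⁻ x in S, ENNReal.ofReal (a x * |u x| ^ r x)) < ENNReal.ofReal ε := by
    intro u hu S hFS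
    calc ∫⁻ x in S, ENNReal.ofReal (a x * |u x| ^ r x)
        ≤ ∫⁻ x in S, (ENNReal.ofReal l * ENNReal.ofReal (|u x| ^ P x)
            + ENNReal.ofReal C * F x) := lintegral_mono_ae (ae_restrict_of_ae (hpt u))
      _ = ENNReal.ofReal l * (∫⁻ x in S, ENNReal.ofReal (|u x| ^ P x))
            + ENNReal.ofReal C * ∫⁻ x in S, F x := by
          rw [lintegral_add_right _ (hFmeas.const_mul _), lintegral_const_mul _ hFmeas,
            lintegral_const_mul' _ _ ENNReal.ofReal_ne_top]
      _ < ENNReal.ofReal l + ENNReal.ofReal l := by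
          refine ENNReal.add_lt_add_of_le_of_lt ?_ ?_ ?_
          · exact ENNReal.mul_ne_top ENNReal.ofReal_ne_top (ne_top_of_le_ne_top
              ENNReal.one_ne_top ((setLIntegral_le_lintegral _ _).trans hu))
          · exact mul_le_of_le_one_right' ((setLIntegral_le_lintegral _ _).trans hu)
          · calc ENNReal.ofReal C * ∫⁻ x in S, F x
                < ENNReal.ofReal C * ENNReal.ofReal (l / C) :=
                  ENNReal.mul_lt_mul_right (ENNReal.ofReal_pos.2 hC0).ne'
                    ENNReal.ofReal_ne_top hFS
              _ = ENNReal.ofReal l := by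
                  rw [← ENNReal.ofReal_mul hC0.le, mul_div_cancel₀ _ hC0.ne']
      _ = ENNReal.ofReal ε := by
          rw [← ENNReal.ofReal_add hl0.le hl0.le, hl, add_halves]
  obtain ⟨d, hd0, hd⟩ := exists_pos_setLIntegral_lt_of_measure_lt hFint hη.ne'
  obtain ⟨R, hR0, hR⟩ := exists_setLIntegral_norm_gt_lt hFint hη
  have hd1 : min d 1 ≠ ⊤ := ne_top_of_le_ne_top ENNReal.one_ne_top (min_le_right _ _)
  refine ⟨(min d 1).toReal, R, ENNReal.toReal_pos (lt_min hd0 one_pos).ne' hd1, hR0,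
    fun u _ hu => ⟨fun Q _ hQ => key u hu Q (hd Q ?_), key u hu _ hR⟩⟩
  rw [ENNReal.ofReal_toReal hd1] at hQ
  exact hQ.trans_le (min_le_left _ _)
end

section
/- Let p : ℝ^N → ℝ be measurable with 1 < p⁻ := inf p ≤ p⁺ := sup p < N, set p*(x) := Np(x)/(N − p(x)), and let u : ℝ^N → ℝ be measurable with ∫_{ℝ^N} |u(x)|^{p*(x)} dx < ∞. Then lim_{R→∞} ∫_{{R ≤ |x| ≤ 2R}} (2|u(x)|/R)^{p(x)} dx = 0. (This is the modular form of the statement that ||u∇φ_R||_{L^{p(x)}(B_{2R}∖B̄_R)} → 0 as R → ∞ for cutoff functions φ_R with |∇φ_R| ≤ 2/R supported in the annulus.) -/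
open MeasureTheory Filter Topology

/-- Young's inequality with the conjugate exponents `n / q` and `n / (n - q)`. -/
lemma mul_rpow_le_rpow_add_rpow {q n a b : ℝ} (hq : 0 < q) (hqn : q < n)
    (ha : 0 ≤ a) (hb : 0 ≤ b) :
    (a * b) ^ q ≤ a ^ n + b ^ (n * q / (n - q)) := by
  have hn : 0 < n := hq.trans hqn
  have hnq : 0 < n - q := sub_pos.2 hqn
  have hconj : (n / q).HolderConjugate (n / (n - q)) := by
    rw [Real.holderConjugate_iff]
    refine ⟨(one_lt_div hq).2 hqn, ?_⟩
    field_simp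
    ring
  have hyoung := Real.young_inequality_of_nonneg (Real.rpow_nonneg ha q)
    (Real.rpow_nonneg hb q) hconj
  rw [← Real.rpow_mul ha, ← Real.rpow_mul hb, ← Real.mul_rpow ha hb,
    mul_div_cancel₀ _ hq.ne', ← mul_div_assoc, mul_comm q n] at hyoung
  refine hyoung.trans (add_le_add ?_ ?_)
  · exact div_le_self (Real.rpow_nonneg ha _) hconj.lt.le
  · exact div_le_self (Real.rpow_nonneg hb _) hconj.symm.lt.le

/-- The integral of an integrable function outside large balls tends to zero. -/
lemma tendsto_setLIntegral_norm_ge_zero {E : Type*} [NormedAddCommGroup E] [MeasurableSpace E]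
    [OpensMeasurableSpace E] {μ : Measure E} {f : E → ENNReal} (hf : ∫⁻ x, f x ∂μ ≠ ⊤) :
    Tendsto (fun R : ℝ => ∫⁻ x in {x | R ≤ ‖x‖}, f x ∂μ) atTop (𝓝 0) := by
  have hmeas (R : ℝ) : MeasurableSet {x : E | R ≤ ‖x‖} :=
    measurableSet_le measurable_const measurable_norm
  have hanti : Antitone fun R : ℝ => {x : E | R ≤ ‖x‖} :=
    fun _ _ hab _ hx => le_trans hab hx
  have hempty : ⋂ R : ℝ, {x : E | R ≤ ‖x‖} = ∅ := by
    refine Set.eq_empty_of_forall_notMem fun x hx => ?_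
    have hx' : ‖x‖ + 1 ≤ ‖x‖ := Set.mem_iInter.1 hx (‖x‖ + 1)
    linarith
  have hfin : μ.withDensity f {x | (0 : ℝ) ≤ ‖x‖} ≠ ⊤ := by
    rw [withDensity_apply _ (hmeas 0)]
    exact ((setLIntegral_le_lintegral _ _).trans_lt hf.lt_top).ne
  have htend := tendsto_measure_iInter_atTop (μ := μ.withDensity f)
    (fun R => (hmeas R).nullMeasurableSet) hanti ⟨0, hfin⟩
  rw [hempty, measure_empty] at htend
  exact htend.congr fun R => withDensity_apply _ (hmeas R)

lemma pstar_le {N : ℕ} {p : EuclideanSpace ℝ (Fin N) → ℝ} {s : ℝ}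
    {x : EuclideanSpace ℝ (Fin N)} (hx : 0 ≤ p x) (hxs : p x ≤ s) (hs : s < N) :
    pstar N p x ≤ N * s / (N - s) := by
  have : 0 < (N : ℝ) - s := sub_pos.2 hs
  unfold pstar
  gcongr
  exact mul_nonneg N.cast_nonneg (hx.trans hxs)

lemma two_mul_div_rpow_le {N : ℕ} {p : EuclideanSpace ℝ (Fin N) → ℝ} {s δ R t : ℝ}
    {x : EuclideanSpace ℝ (Fin N)} (hx : 0 < p x) (hxs : p x ≤ s) (hs : s < N)
    (hδ : 0 < δ) (hδ2 : δ ≤ 2) (hR : 0 < R) (ht : 0 ≤ t) :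
    (2 * t / R) ^ p x ≤
      (δ / R) ^ N + (2 / δ) ^ (N * s / (N - s)) * t ^ pstar N p x := by
  have hbase : 2 * t / R = δ / R * (2 / δ * t) := by field_simp
  rw [hbase]
  refine (mul_rpow_le_rpow_add_rpow hx (hxs.trans_lt hs) (by positivity)
    (by positivity)).trans ?_
  rw [Real.rpow_natCast, Real.mul_rpow (by positivity) ht]
  refine add_le_add_right (mul_le_mul_of_nonneg_right ?_ (Real.rpow_nonneg ht _)) _
  exact Real.rpow_le_rpow_of_exponent_le ((one_le_div hδ).2 hδ2) (pstar_le hx.le hxs hs)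

lemma setLIntegral_annulus_le {N : ℕ} {p u : EuclideanSpace ℝ (Fin N) → ℝ} {s δ R : ℝ}
    (hp : ∀ x, 0 < p x) (hps : ∀ x, p x ≤ s) (hs : s < N)
    (hδ : 0 < δ) (hδ2 : δ ≤ 2) (hR : 0 < R) :
    ∫⁻ x in {x : EuclideanSpace ℝ (Fin N) | R ≤ ‖x‖ ∧ ‖x‖ ≤ 2 * R},
        ENNReal.ofReal ((2 * |u x| / R) ^ p x) ≤
      ENNReal.ofReal ((2 * δ) ^ N) * volume (Metric.ball (0 : EuclideanSpace ℝ (Fin N)) 1) +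
        ENNReal.ofReal ((2 / δ) ^ (N * s / (N - s))) *
          ∫⁻ x in {x | R ≤ ‖x‖}, ENNReal.ofReal (|u x| ^ pstar N p x) := by
  have hvol : volume {x : EuclideanSpace ℝ (Fin N) | R ≤ ‖x‖ ∧ ‖x‖ ≤ 2 * R} ≤
      ENNReal.ofReal ((2 * R) ^ N) *
        volume (Metric.ball (0 : EuclideanSpace ℝ (Fin N)) 1) := by
    refine (measure_mono fun x hx => mem_closedBall_zero_iff.2 hx.2).trans_eq ?_
    rw [Measure.addHaar_closedBall _ _ (by positivity), finrank_euclideanSpace_fin]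
  calc
    _ ≤ ∫⁻ x in {x : EuclideanSpace ℝ (Fin N) | R ≤ ‖x‖ ∧ ‖x‖ ≤ 2 * R},
        (ENNReal.ofReal ((δ / R) ^ N) + ENNReal.ofReal ((2 / δ) ^ (N * s / (N - s))) *
          ENNReal.ofReal (|u x| ^ pstar N p x)) := by
      refine lintegral_mono fun x => ?_
      rw [← ENNReal.ofReal_mul (by positivity),
        ← ENNReal.ofReal_add (by positivity) (by positivity)]
      exact ENNReal.ofReal_le_ofReal
        (two_mul_div_rpow_le (hp x) (hps x) hs hδ hδ2 hR (abs_nonneg _))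
    _ = ENNReal.ofReal ((δ / R) ^ N) *
          volume {x : EuclideanSpace ℝ (Fin N) | R ≤ ‖x‖ ∧ ‖x‖ ≤ 2 * R} +
        ENNReal.ofReal ((2 / δ) ^ (N * s / (N - s))) *
          ∫⁻ x in {x | R ≤ ‖x‖ ∧ ‖x‖ ≤ 2 * R}, ENNReal.ofReal (|u x| ^ pstar N p x) := by
      rw [lintegral_add_left measurable_const, setLIntegral_const,
        lintegral_const_mul' _ _ ENNReal.ofReal_ne_top]
    _ ≤ _ := by
      refine add_le_add ((mul_le_mul_right hvol _).trans_eq ?_)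
        (mul_le_mul_right (lintegral_mono_set fun x hx => hx.1) _)
      rw [← mul_assoc, ← ENNReal.ofReal_mul (by positivity), ← mul_pow]
      congr 3
      field_simp

/-- If `∫ |u|^{p*(x)} dx < ∞`, then the modular of `u ∇φ_R` over the annulus
`{R ≤ |x| ≤ 2R}` (with `|∇φ_R| ≤ 2/R`) tends to `0` as `R → ∞`. -/
theorem annulus_modular_tendsto_zero
    (N : ℕ) (p : EuclideanSpace ℝ (Fin N) → ℝ) (hp : Measurable p)
    (hpBelow : BddBelow (Set.range p)) (hpAbove : BddAbove (Set.range p))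
    (hp1 : 1 < sInf (Set.range p)) (hpN : sSup (Set.range p) < N)
    (u : EuclideanSpace ℝ (Fin N) → ℝ) (hu : Measurable u)
    (hint : (∫⁻ x, ENNReal.ofReal (|u x| ^ pstar N p x)) < ⊤) :
    Tendsto (fun R : ℝ =>
        ∫⁻ x in {x : EuclideanSpace ℝ (Fin N) | R ≤ ‖x‖ ∧ ‖x‖ ≤ 2 * R},
          ENNReal.ofReal ((2 * |u x| / R) ^ p x))
      atTop (nhds 0) := by
  have hp0 (x) : 0 < p x :=
    (zero_lt_one.trans hp1).trans_le (csInf_le hpBelow (Set.mem_range_self x))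
  have hps (x) : p x ≤ sSup (Set.range p) := le_csSup hpAbove (Set.mem_range_self x)
  have hN : N ≠ 0 := by
    have : (0 : ℝ) < N := ((hp0 0).trans_le (hps 0)).trans hpN
    exact_mod_cast this.ne'
  have hsmall : Tendsto (fun δ : ℝ => ENNReal.ofReal ((2 * δ) ^ N) *
      volume (Metric.ball (0 : EuclideanSpace ℝ (Fin N)) 1)) (𝓝[>] 0) (𝓝 0) := by
    have hcont : Tendsto (fun δ : ℝ => ENNReal.ofReal ((2 * δ) ^ N)) (𝓝[>] 0) (𝓝 0) := by
      have : Continuous fun δ : ℝ => ENNReal.ofReal ((2 * δ) ^ N) :=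
        ENNReal.continuous_ofReal.comp (by fun_prop)
      simpa [hN] using (this.tendsto 0).mono_left nhdsWithin_le_nhds
    simpa using ENNReal.Tendsto.mul_const hcont (Or.inr measure_ball_lt_top.ne)
  rw [ENNReal.tendsto_nhds_zero]
  intro ε hε
  have hε2 : 0 < ε / 2 := ENNReal.half_pos hε.ne'
  obtain ⟨δ, hδε, hδ, hδ2⟩ := ((ENNReal.tendsto_nhds_zero.1 hsmall _ hε2).and
    (Ioc_mem_nhdsGT (zero_lt_two' ℝ))).exists
  have htail := ENNReal.Tendsto.const_mul (tendsto_setLIntegral_norm_ge_zero hint.ne)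
    (Or.inr (ENNReal.ofReal_ne_top
      (r := (2 / δ) ^ (N * sSup (Set.range p) / (N - sSup (Set.range p))))))
  rw [mul_zero] at htail
  filter_upwards [ENNReal.tendsto_nhds_zero.1 htail _ hε2, eventually_gt_atTop 0] with R hRε hR
  calc
    _ ≤ _ := setLIntegral_annulus_le hp0 hps hpN hδ hδ2 hR
    _ ≤ ε / 2 + ε / 2 := add_le_add hδε hRε
    _ = ε := ENNReal.add_halves ε
end

section
/- Let (g_n) be a sequence of nonnegative Lebesgue-integrable functions on ℝ^N with sup_n ∫_{ℝ^N} g_n dx < ∞, and let μ be a nonnegative finite Borel measure on ℝ^N such that ∫_{ℝ^N} f(x) g_n(x) dx → ∫_{ℝ^N} f dμ for every continuous function f : ℝ^N → ℝ vanishing at infinity (i.e. g_n·dx ⇀* μ in M(ℝ^N)). Then the iterated limit μ_∞ := lim_{R→∞} limsup_{n→∞} ∫_{{|x| > R}} g_n dx exists and limsup_{n→∞} ∫_{ℝ^N} g_n dx = μ(ℝ^N) + μ_∞. (Applied with g_n = |∇u_n|^{p(x)} + V|u_n|^{p(x)} and g_n = b|u_n|^{q(x)}, this yields identities (3.12) and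 (3.14) of the concentration-compactness principle at infinity.) -/
open MeasureTheory Filter Topology

/-- Adding a convergent sequence to a bounded one shifts its upper limit by the limit. -/
lemma limsup_add_of_bounded_of_tendsto {u v : ℕ → ℝ} {c : ℝ}
    (hu : IsBoundedUnder (· ≤ ·) atTop u) (hu' : IsBoundedUnder (· ≥ ·) atTop u)
    (hv : Tendsto v atTop (𝓝 c)) :
    limsup (fun n => u n + v n) atTop = limsup u atTop + c := by
  have hvb := hv.isBoundedUnder_le
  have hvb' := hv.isBoundedUnder_ge
  apply le_antisymm
  · have h := limsup_add_le hu' hu hvb'.isCoboundedUnder_le hvb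
    rwa [hv.limsup_eq] at h
  · have h := le_limsup_add hu hu'.isCoboundedUnder_le hvb hvb'
    rwa [hv.liminf_eq] at h

/-- The radial cutoff equal to `1` on `‖x‖ ≤ R` and to `0` on `R + 1 ≤ ‖x‖`. -/
noncomputable def radialCutoff {E : Type*} [NormedAddCommGroup E] (R : ℝ) (x : E) : ℝ :=
  max 0 (min 1 (R + 1 - ‖x‖))

section radialCutoff

variable {E : Type*} [NormedAddCommGroup E]

lemma continuous_radialCutoff (R : ℝ) : Continuous (radialCutoff (E := E) R) := by
  unfold radialCutoff
  fun_prop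

lemma radialCutoff_nonneg (R : ℝ) (x : E) : 0 ≤ radialCutoff R x :=
  le_max_left _ _

lemma radialCutoff_le_one (R : ℝ) (x : E) : radialCutoff R x ≤ 1 :=
  max_le zero_le_one (min_le_left _ _)

lemma norm_radialCutoff_le_one (R : ℝ) (x : E) : ‖radialCutoff R x‖ ≤ 1 := by
  rw [Real.norm_of_nonneg (radialCutoff_nonneg R x)]
  exact radialCutoff_le_one R x

lemma radialCutoff_eq_one {R : ℝ} {x : E} (h : ‖x‖ ≤ R) : radialCutoff R x = 1 := by
  rw [radialCutoff, min_eq_left (by linarith), max_eq_right zero_le_one]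

lemma radialCutoff_eq_zero {R : ℝ} {x : E} (h : R + 1 ≤ ‖x‖) : radialCutoff R x = 0 :=
  max_eq_left ((min_le_right _ _).trans (by linarith))

lemma tendsto_radialCutoff_cocompact [ProperSpace E] (R : ℝ) :
    Tendsto (radialCutoff (E := E) R) (cocompact E) (𝓝 0) := by
  refine tendsto_const_nhds.congr' ?_
  filter_upwards [(tendsto_norm_cocompact_atTop (E := E)).eventually_ge_atTop (R + 1)]
    with x hx using (radialCutoff_eq_zero hx).symm

variable [MeasurableSpace E] [BorelSpace E]

/-- The integrals of the cutoffs against a finite measure exhaust its total mass. -/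
lemma tendsto_integral_radialCutoff (μ : Measure E) [IsFiniteMeasure μ] :
    Tendsto (fun R : ℝ => ∫ x, radialCutoff R x ∂μ) atTop (𝓝 (μ Set.univ).toReal) := by
  have h : Tendsto (fun R : ℝ => ∫ x, radialCutoff R x ∂μ) atTop (𝓝 (∫ _, (1 : ℝ) ∂μ)) := by
    refine tendsto_integral_filter_of_dominated_convergence (fun _ => 1)
      (Eventually.of_forall fun R => (continuous_radialCutoff R).aestronglyMeasurable)
      (Eventually.of_forall fun R => ae_of_all _ (norm_radialCutoff_le_one R))
      (integrable_const _) (ae_of_all _ fun x => ?_)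
    refine tendsto_const_nhds.congr' ?_
    filter_upwards [eventually_ge_atTop ‖x‖] with R hR using (radialCutoff_eq_one hR).symm
  simpa [Measure.real] using h

variable {ν : Measure E} {f : E → ℝ}

lemma MeasureTheory.Integrable.radialCutoff_mul (hf : Integrable f ν) (R : ℝ) :
    Integrable (fun x => radialCutoff R x * f x) ν :=
  hf.bdd_mul (continuous_radialCutoff R).aestronglyMeasurable
    (ae_of_all _ (norm_radialCutoff_le_one R))

/-- The mass outside a ball dominates the total mass minus the cutoff at the same radius. -/
lemma integral_sub_radialCutoff_le (hf : Integrable f ν) (hpos : ∀ x, 0 ≤ f x) (R : ℝ) :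
    (∫ x, f x ∂ν) + -∫ x, radialCutoff R x * f x ∂ν ≤ ∫ x in {x | R < ‖x‖}, f x ∂ν := by
  have hm : MeasurableSet {x : E | R < ‖x‖} := measurableSet_lt measurable_const measurable_norm
  rw [← sub_eq_add_neg, ← integral_sub hf (hf.radialCutoff_mul R), ← integral_indicator hm]
  refine integral_mono (hf.sub (hf.radialCutoff_mul R)) (hf.indicator hm) fun x => ?_
  by_cases hx : R < ‖x‖
  · have := mul_nonneg (radialCutoff_nonneg R x) (hpos x)
    simpa [Set.indicator, hx] using this
  · simp [Set.indicator, hx, radialCutoff_eq_one (not_lt.1 hx)]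

/-- The mass outside a ball is at most the total mass minus the cutoff at radius one less. -/
lemma setIntegral_le_integral_sub_radialCutoff (hf : Integrable f ν) (hpos : ∀ x, 0 ≤ f x)
    (R : ℝ) :
    ∫ x in {x | R < ‖x‖}, f x ∂ν ≤
      (∫ x, f x ∂ν) + -∫ x, radialCutoff (R - 1) x * f x ∂ν := by
  have hm : MeasurableSet {x : E | R < ‖x‖} := measurableSet_lt measurable_const measurable_norm
  rw [← sub_eq_add_neg, ← integral_sub hf (hf.radialCutoff_mul _), ← integral_indicator hm]
  refine integral_mono (hf.indicator hm) (hf.sub (hf.radialCutoff_mul _)) fun x => ?_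
  by_cases hx : R < ‖x‖
  · simp [Set.indicator, hx, radialCutoff_eq_zero (R := R - 1) (x := x) (by linarith)]
  · have := mul_le_of_le_one_left (hpos x) (radialCutoff_le_one (R - 1) x)
    simpa [Set.indicator, hx] using this

end radialCutoff

/-- Mass decomposition at infinity: if `g_n·dx ⇀* μ` in `M(ℝ^N)` with `(g_n)` nonnegative
and bounded in `L¹(ℝ^N)`, then `μ_∞ := lim_{R→∞} limsup_n ∫_{|x|>R} g_n dx` exists and
`limsup_n ∫ g_n dx = μ(ℝ^N) + μ_∞`. -/
theorem mass_at_infinity_decomposition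
    (N : ℕ) (g : ℕ → EuclideanSpace ℝ (Fin N) → ℝ)
    (hgint : ∀ n, Integrable (g n) (volume : Measure (EuclideanSpace ℝ (Fin N))))
    (hgpos : ∀ n x, 0 ≤ g n x)
    (hbdd : ∃ M : ℝ, ∀ n, (∫ x, g n x) ≤ M)
    (μ : Measure (EuclideanSpace ℝ (Fin N))) (hμ : IsFiniteMeasure μ)
    (hweak : ∀ f : EuclideanSpace ℝ (Fin N) → ℝ, Continuous f →
      Tendsto f (cocompact (EuclideanSpace ℝ (Fin N))) (nhds 0) →
      Tendsto (fun n => ∫ x, f x * g n x) atTop (nhds (∫ x, f x ∂μ))) :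
    ∃ μinf : ℝ,
      Tendsto (fun R : ℝ =>
          limsup (fun n => ∫ x in {x : EuclideanSpace ℝ (Fin N) | R < ‖x‖}, g n x) atTop)
        atTop (nhds μinf) ∧
      limsup (fun n => ∫ x, g n x) atTop = (μ Set.univ).toReal + μinf := by
  obtain ⟨M, hM⟩ := hbdd
  have hu : IsBoundedUnder (· ≤ ·) atTop (fun n => ∫ x, g n x) := isBoundedUnder_of ⟨M, hM⟩
  have hu' : IsBoundedUnder (· ≥ ·) atTop (fun n => ∫ x, g n x) :=
    isBoundedUnder_of ⟨0, fun n => integral_nonneg (hgpos n)⟩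
  have hconv (R : ℝ) := (hweak _ (continuous_radialCutoff R) (tendsto_radialCutoff_cocompact R)).neg
  have hlim (R : ℝ) := limsup_add_of_bounded_of_tendsto hu hu' (hconv R)
  have htail (R : ℝ) : IsBoundedUnder (· ≤ ·) atTop
      (fun n => ∫ x in {x : EuclideanSpace ℝ (Fin N) | R < ‖x‖}, g n x) :=
    isBoundedUnder_of ⟨M, fun n =>
      (setIntegral_le_integral (hgint n) (ae_of_all _ (hgpos n))).trans (hM n)⟩
  have htail' (R : ℝ) : IsBoundedUnder (· ≥ ·) atTop
      (fun n => ∫ x in {x : EuclideanSpace ℝ (Fin N) | R < ‖x‖}, g n x) :=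
    isBoundedUnder_of ⟨0, fun n => integral_nonneg (hgpos n)⟩
  have hmass := tendsto_integral_radialCutoff μ
  refine ⟨limsup (fun n => ∫ x, g n x) atTop + -(μ Set.univ).toReal, ?_, by ring⟩
  refine tendsto_of_tendsto_of_tendsto_of_le_of_le (hmass.neg.const_add _)
    ((hmass.comp (tendsto_atTop_add_const_right _ (-1) tendsto_id)).neg.const_add _)
    (fun R => ?_) (fun R => ?_)
  · refine (hlim R).symm.le.trans (limsup_le_limsup (Eventually.of_forall fun n =>
      integral_sub_radialCutoff_le (hgint n) (hgpos n) R) ?_ (htail R))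
    exact (isBoundedUnder_ge_add hu' (hconv R).isBoundedUnder_ge).isCoboundedUnder_le
  · refine (limsup_le_limsup (Eventually.of_forall fun n =>
      setIntegral_le_integral_sub_radialCutoff (hgint n) (hgpos n) R)
      (htail' R).isCoboundedUnder_le ?_).trans (hlim (R - 1)).le
    exact isBoundedUnder_le_add hu (hconv (R - 1)).isBoundedUnder_le
end
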